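/- Let d ≥ 2 and 1 < p ≤ d, and let ρ > 0. If u and v are positive C¹ weak solutions of the p-Laplace equation -Δ_p w = 0 in the punctured ball B_ρ \ {0} ⊆ ℝ^d, then the limit lim_{x → 0} u(x)/v(x) exists in the extended interval [0, +∞]. -/

import Mathlib

open MeasureTheory Metric Filter Topology Set
open scoped RealInnerProductSpace ENNReal

noncomputable section

/-- `u` is a positive `C¹` weak solution of `-Δ_p u + V|u|^{p-2}u = 0` in the open set `Ω`. -/
def IsPosWeakSol {d : ℕ} (p : ℝ) (V : EuclideanSpace ℝ (Fin d) → ℝ)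
    (Ω : Set (EuclideanSpace ℝ (Fin d))) (u : EuclideanSpace ℝ (Fin d) → ℝ) : Prop :=
  ContDiffOn ℝ 1 u Ω ∧ (∀ x ∈ Ω, 0 < u x) ∧
  ∀ φ : EuclideanSpace ℝ (Fin d) → ℝ, ContDiff ℝ (⊤ : ℕ∞) φ → HasCompactSupport φ →
    tsupport φ ⊆ Ω →
    ∫ x in Ω, (‖gradient u x‖ ^ (p - 2) * ⟪gradient u x, gradient φ x⟫ +
      V x * |u x| ^ (p - 2) * u x * φ x) = 0

namespace PLaplace

section Flux

variable {E : Type*} [NormedAddCommGroup E] [InnerProductSpace ℝ E] {p : ℝ}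

/-- The vector field `ξ ↦ ‖ξ‖^{p-2} ξ`. -/
def pflux (p : ℝ) (ξ : E) : E := ‖ξ‖ ^ (p - 2) • ξ

lemma norm_pflux (hp : 1 < p) (ξ : E) : ‖pflux p ξ‖ = ‖ξ‖ ^ (p - 1) := by
  rcases eq_or_ne ξ 0 with rfl | h
  · simp [pflux, Real.zero_rpow (by linarith : p - 1 ≠ 0)]
  · have h' : 0 < ‖ξ‖ := norm_pos_iff.2 h
    rw [pflux, norm_smul, Real.norm_of_nonneg (by positivity)]
    nth_rw 2 [← Real.rpow_one ‖ξ‖]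
    rw [← Real.rpow_add h']; congr 1; ring

lemma inner_pflux_self (hp : 1 < p) (ξ : E) : ⟪pflux p ξ, ξ⟫ = ‖ξ‖ ^ p := by
  rcases eq_or_ne ξ 0 with rfl | h
  · simp [Real.zero_rpow (by linarith : p ≠ 0)]
  · have h' : 0 < ‖ξ‖ := norm_pos_iff.2 h
    rw [pflux, inner_smul_left, real_inner_self_eq_norm_sq]
    simp only [conj_trivial]
    rw [← Real.rpow_natCast, ← Real.rpow_add h']; congr 1; push_cast; ring

@[simp] lemma pflux_neg (ξ : E) : pflux p (-ξ) = -pflux p ξ := by simp [pflux]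

@[simp] lemma pflux_zero : pflux p (0 : E) = 0 := by simp [pflux]

lemma pflux_smul {t : ℝ} (ht : 0 < t) (ξ : E) : pflux p (t • ξ) = t ^ (p - 1) • pflux p ξ := by
  rw [pflux, pflux, norm_smul, Real.norm_of_nonneg ht.le, Real.mul_rpow ht.le (norm_nonneg _),
    smul_smul, smul_smul]
  congr 1
  have : t ^ (p - 1) = t ^ (p - 2) * t := by
    nth_rw 3 [← Real.rpow_one t]
    rw [← Real.rpow_add ht]; congr 1; ring
  rw [this]; ring

lemma continuous_pflux (hp : 1 < p) : Continuous (pflux p : E → E) := by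
  rw [continuous_iff_continuousAt]
  intro ξ
  rcases eq_or_ne ξ 0 with rfl | h
  · rw [ContinuousAt, pflux_zero, tendsto_zero_iff_norm_tendsto_zero]
    simp_rw [norm_pflux hp]
    have : ContinuousAt (fun ξ : E => ‖ξ‖ ^ (p - 1)) 0 :=
      (continuous_norm.continuousAt).rpow_const (Or.inr (by linarith))
    simpa [ContinuousAt, Real.zero_rpow (by linarith : p - 1 ≠ 0)] using this
  · exact (continuous_norm.continuousAt.rpow_const
      (Or.inl (norm_ne_zero_iff.2 h))).smul continuousAt_id

lemma pflux_strictMono (hp : 1 < p) {a b : E} (hab : a ≠ b) :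
    0 < ⟪pflux p a - pflux p b, a - b⟫ := by
  have key : ⟪pflux p a - pflux p b, a - b⟫ =
      (‖a‖ ^ (p - 1) - ‖b‖ ^ (p - 1)) * (‖a‖ - ‖b‖) +
        (‖a‖ ^ (p - 2) + ‖b‖ ^ (p - 2)) * (‖a‖ * ‖b‖ - ⟪a, b⟫) := by
    have h1 : ∀ c : E, ‖c‖ ^ (p - 1) = ‖c‖ ^ (p - 2) * ‖c‖ := fun c => by
      rw [← norm_pflux hp c, pflux, norm_smul, Real.norm_of_nonneg (by positivity)]
    rw [h1, h1]
    simp only [pflux, inner_sub_left, inner_sub_right, inner_smul_left, conj_trivial,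
      real_inner_self_eq_norm_sq, real_inner_comm a b]
    ring
  rw [key]
  have hc := real_inner_le_norm a b
  have hm : StrictMonoOn (fun t : ℝ => t ^ (p - 1)) (Ici 0) := fun s hs t _ hst =>
    Real.rpow_lt_rpow hs hst (by linarith)
  have h2 : 0 ≤ (‖a‖ ^ (p - 2) + ‖b‖ ^ (p - 2)) * (‖a‖ * ‖b‖ - ⟪a, b⟫) :=
    mul_nonneg (by positivity) (by linarith)
  rcases lt_trichotomy ‖a‖ ‖b‖ with h | h | h
  · have := hm (norm_nonneg a) (norm_nonneg b) h
    have := mul_pos_of_neg_of_neg (sub_neg.2 this) (sub_neg.2 h)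
    linarith
  · have h3 : 0 < ‖a - b‖ ^ 2 := by
      have := norm_pos_iff.2 (sub_ne_zero.2 hab); positivity
    rw [@norm_sub_sq_real] at h3
    have ha : 0 < ‖b‖ := by
      rcases eq_or_ne b 0 with rfl | hb
      · simp at h; exact absurd h hab
      · exact norm_pos_iff.2 hb
    rw [h, sub_self, zero_mul, zero_add]
    rw [h] at h3
    have : 0 < ‖b‖ ^ (p - 2) := by positivity
    apply mul_pos (by positivity)
    nlinarith
  · have := hm (norm_nonneg b) (norm_nonneg a) h
    have := mul_pos (sub_pos.2 this) (sub_pos.2 h)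
    linarith

lemma pflux_mono (hp : 1 < p) (a b : E) : 0 ≤ ⟪pflux p a - pflux p b, a - b⟫ := by
  rcases eq_or_ne a b with rfl | h
  · simp
  · exact (pflux_strictMono hp h).le

lemma pflux_coercive [FiniteDimensional ℝ E] (hp : 1 < p) (B : ℝ) {δ : ℝ} (hδ : 0 < δ) :
    ∃ c > 0, ∀ b : E, ‖b‖ ≤ B → ∀ a : E,
      c * (‖a - b‖ - δ) ≤ ⟪pflux p a - pflux p b, a - b⟫ := by
  let F : E × E → ℝ := fun z => ⟪pflux p (z.1 + δ • z.2) - pflux p z.1, z.2⟫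
  have hF : Continuous F := by
    have := continuous_pflux (E := E) hp
    fun_prop
  have hpos : ∀ z : E × E, z.2 ≠ 0 → 0 < F z := fun z hz => by
    have h := pflux_strictMono hp (a := z.1 + δ • z.2) (b := z.1) (by simp [hδ.ne', hz])
    rw [add_sub_cancel_left, inner_smul_right] at h
    exact pos_of_mul_pos_right h hδ.le
  have hK : IsCompact (closedBall (0 : E) B ×ˢ sphere (0 : E) 1) :=
    (isCompact_closedBall _ _).prod (isCompact_sphere _ _)
  obtain ⟨c, hc, hcF⟩ : ∃ c > 0, ∀ z ∈ closedBall (0 : E) B ×ˢ sphere (0 : E) 1, c ≤ F z := by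
    rcases (closedBall (0 : E) B ×ˢ sphere (0 : E) 1).eq_empty_or_nonempty with he | hne
    · exact ⟨1, one_pos, by simp [he]⟩
    · obtain ⟨z, hz, hmin⟩ := hK.exists_isMinOn hne hF.continuousOn
      refine ⟨F z, hpos z ?_, fun y hy => hmin hy⟩
      rintro h
      have := hz.2
      simp [h] at this
  refine ⟨c, hc, fun b hb a => ?_⟩
  rcases le_or_gt ‖a - b‖ δ with h | h
  · exact (mul_nonpos_of_nonneg_of_nonpos hc.le (by linarith)).trans (pflux_mono hp a b)
  · set s := ‖a - b‖ with hs
    have hs0 : 0 < s := hδ.trans h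
    set e : E := s⁻¹ • (a - b) with he
    have hse : a - b = s • e := by rw [he, smul_smul, mul_inv_cancel₀ hs0.ne', one_smul]
    have ha : a = b + s • e := by rw [← hse]; abel
    have he1 : ‖e‖ = 1 := by
      rw [he, norm_smul, norm_inv, ← hs, norm_norm, inv_mul_cancel₀ hs0.ne']
    have h1 := hcF (b, e) ⟨by simpa using hb, by simp [he1]⟩
    have h2 := pflux_mono hp (b + s • e) (b + δ • e)
    have h3 : b + s • e - (b + δ • e) = (s - δ) • e := by rw [sub_smul]; abel
    rw [h3, inner_smul_right] at h2
    have h4 := nonneg_of_mul_nonneg_right h2 (sub_pos.2 h)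
    have h5 : c ≤ ⟪pflux p a - pflux p b, e⟫ := by
      have : pflux p a - pflux p b = (pflux p (b + s • e) - pflux p (b + δ • e)) +
        (pflux p (b + δ • e) - pflux p b) := by rw [ha]; abel
      rw [this, inner_add_left]
      simp only [F] at h1
      linarith
    rw [hse, inner_smul_right, mul_comm]
    calc (s - δ) * c ≤ s * c := by gcongr; linarith
      _ ≤ _ := by gcongr

end Flux

section Weak

variable {E : Type*} [NormedAddCommGroup E] [InnerProductSpace ℝ E] [FiniteDimensional ℝ E]

lemma inner_gradient_eq_fderiv (φ : E → ℝ) (x y : E) : ⟪y, gradient φ x⟫ = fderiv ℝ φ x y := by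
  rw [real_inner_comm, inner_gradient_left]

lemma norm_gradient (φ : E → ℝ) (x : E) : ‖gradient φ x‖ = ‖fderiv ℝ φ x‖ := by
  simp [gradient]

lemma hasGradientAt_of_contDiffOn {Ω : Set E} (hΩ : IsOpen Ω) {u : E → ℝ}
    (hu : ContDiffOn ℝ 1 u Ω) {x : E} (hx : x ∈ Ω) : HasGradientAt u (gradient u x) x :=
  ((hu.contDiffAt (hΩ.mem_nhds hx)).differentiableAt (by simp)).hasGradientAt

lemma continuousOn_gradient {Ω : Set E} (hΩ : IsOpen Ω) {u : E → ℝ}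
    (hu : ContDiffOn ℝ 1 u Ω) : ContinuousOn (gradient u) Ω :=
  (InnerProductSpace.toDual ℝ E).symm.continuous.comp_continuousOn
    (hu.continuousOn_fderiv_of_isOpen hΩ le_rfl)

lemma continuous_gradient {u : E → ℝ} (hu : ContDiff ℝ 1 u) : Continuous (gradient u) :=
  (InnerProductSpace.toDual ℝ E).symm.continuous.comp (hu.continuous_fderiv (by simp))

lemma gradient_eq_zero_of_notMem_tsupport {u : E → ℝ} {x : E} (hx : x ∉ tsupport u) :
    gradient u x = 0 := by
  have : u =ᶠ[𝓝 x] fun _ => 0 := notMem_tsupport_iff_eventuallyEq.1 hx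
  rw [this.gradient_eq]; simp

lemma HasGradientAt.mul {f g : E → ℝ} {f' g' x : E} (hf : HasGradientAt f f' x)
    (hg : HasGradientAt g g' x) : HasGradientAt (fun y => f y * g y) (f x • g' + g x • f') x := by
  rw [hasGradientAt_iff_hasFDerivAt] at *
  exact (hf.mul hg).congr_fderiv (by ext; simp)

lemma HasGradientAt.comp {f : E → ℝ} {f' x : E} {g : ℝ → ℝ} {g' : ℝ} (hg : HasDerivAt g g' (f x))
    (hf : HasGradientAt f f' x) : HasGradientAt (fun y => g (f y)) (g' • f') x := by
  rw [hasGradientAt_iff_hasFDerivAt] at *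
  exact (hg.comp_hasFDerivAt x hf).congr_fderiv (by ext; simp)

lemma HasGradientAt.sub {f g : E → ℝ} {f' g' x : E} (hf : HasGradientAt f f' x)
    (hg : HasGradientAt g g' x) : HasGradientAt (fun y => f y - g y) (f' - g') x := by
  rw [hasGradientAt_iff_hasFDerivAt] at *
  exact (hf.sub hg).congr_fderiv (by ext; simp)

lemma HasGradientAt.const_mul {f : E → ℝ} {f' x : E} (c : ℝ) (hf : HasGradientAt f f' x) :
    HasGradientAt (fun y => c * f y) (c • f') x := by
  rw [hasGradientAt_iff_hasFDerivAt] at *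
  exact (hf.const_mul c).congr_fderiv (by ext; simp)

lemma HasGradientAt.add_const {f : E → ℝ} {f' x : E} (c : ℝ) (hf : HasGradientAt f f' x) :
    HasGradientAt (fun y => f y + c) f' x := by
  rw [hasGradientAt_iff_hasFDerivAt] at *
  exact hf.add_const c

/-- A continuous integrand on an open set, cut off by a compact set, is continuous. -/
lemma continuous_of_continuousOn_of_eq_zero {X F : Type*} [TopologicalSpace X]
    [TopologicalSpace F] [Zero F] {Ω K : Set X} (hΩ : IsOpen Ω) (hK : IsClosed K) (hKΩ : K ⊆ Ω)
    {f : X → F} (hf : ContinuousOn f Ω) (h0 : ∀ x ∉ K, f x = 0) : Continuous f := by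
  rw [continuous_iff_continuousAt]
  intro x
  by_cases hx : x ∈ K
  · exact hf.continuousAt (hΩ.mem_nhds (hKΩ hx))
  · have : f =ᶠ[𝓝 x] fun _ => 0 := by
      filter_upwards [hK.isOpen_compl.mem_nhds hx] with y hy using h0 y hy
    exact this.continuousAt

omit [FiniteDimensional ℝ E] in
lemma contDiff_of_contDiffOn_of_eq_zero {Ω K : Set E} (hΩ : IsOpen Ω) (hK : IsClosed K)
    (hKΩ : K ⊆ Ω) {f : E → ℝ} (hf : ContDiffOn ℝ 1 f Ω) (h0 : ∀ x ∉ K, f x = 0) :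
    ContDiff ℝ 1 f := by
  rw [contDiff_iff_contDiffAt]
  intro x
  by_cases hx : x ∈ K
  · exact hf.contDiffAt (hΩ.mem_nhds (hKΩ hx))
  · have : f =ᶠ[𝓝 x] fun _ => 0 := by
      filter_upwards [hK.isOpen_compl.mem_nhds hx] with y hy using h0 y hy
    exact contDiffAt_const.congr_of_eventuallyEq this

variable [MeasurableSpace E] [BorelSpace E]

open ContinuousLinearMap in
/-- A vector field that is weakly divergence free against smooth test functions is weakly
divergence free against `C¹` test functions. -/
lemma integral_inner_gradient_eq_zero_of_smooth {Ω : Set E} (hΩ : IsOpen Ω) {F : E → E}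
    (hF : ContinuousOn F Ω)
    (h : ∀ φ : E → ℝ, ContDiff ℝ (⊤ : ℕ∞) φ → HasCompactSupport φ → tsupport φ ⊆ Ω →
      ∫ x, ⟪F x, gradient φ x⟫ = 0) {φ : E → ℝ} (hφ : ContDiff ℝ 1 φ) (hc : HasCompactSupport φ)
    (hs : tsupport φ ⊆ Ω) : ∫ x, ⟪F x, gradient φ x⟫ = 0 := by
  obtain ⟨δ, hδ, hδΩ⟩ := IsCompact.exists_cthickening_subset_open hc hΩ hs
  set K := cthickening δ (tsupport φ) with hKdef
  have hK : IsCompact K := IsCompact.cthickening hc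
  obtain ⟨M, hM⟩ := hK.exists_bound_of_continuousOn (hF.mono hδΩ)
  have hM0 : ∀ x ∈ K, ‖F x‖ ≤ |M| := fun x hx => (hM x hx).trans (le_abs_self M)
  have hint : ∀ {ψ : E → ℝ}, ContDiff ℝ 1 ψ → tsupport ψ ⊆ K →
      Integrable (fun x => ⟪F x, gradient ψ x⟫) := fun {ψ} hψ hψK => by
    have h0 : ∀ x ∉ tsupport ψ, ⟪F x, gradient ψ x⟫ = 0 := fun x hx => by
      rw [gradient_eq_zero_of_notMem_tsupport hx, inner_zero_right]
    refine Continuous.integrable_of_hasCompactSupport (continuous_of_continuousOn_of_eq_zero hΩ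
      (isClosed_tsupport ψ) (hψK.trans hδΩ) (hF.inner (continuous_gradient hψ).continuousOn) h0) ?_
    exact HasCompactSupport.intro (hK.of_isClosed_subset (isClosed_tsupport ψ) hψK) h0
  have huc : UniformContinuous (fderiv ℝ φ) :=
    (hc.fderiv (𝕜 := ℝ)).uniformContinuous_of_continuous (hφ.continuous_fderiv (by simp))
  have key : ∀ ε > 0, |∫ x, ⟪F x, gradient φ x⟫| ≤ ε * |M| * volume.real K := fun ε hε => by
    obtain ⟨δ', hδ', hd⟩ := Metric.uniformContinuous_iff.1 huc ε hε
    set r := min δ δ' with hr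
    have hr0 : 0 < r := lt_min hδ hδ'
    let b : ContDiffBump (0 : E) := ⟨r / 2, r, by linarith, by linarith⟩
    set ψ : E → ℝ := MeasureTheory.convolution (b.normed volume) φ (lsmul ℝ ℝ) volume with hψ
    have hsupp : tsupport ψ ⊆ K := by
      refine closure_minimal ?_ isClosed_cthickening
      refine (support_convolution_subset _).trans ?_
      rw [b.support_normed_eq]
      rintro _ ⟨y, hy, z, hz, rfl⟩
      refine mem_cthickening_of_dist_le _ z δ _ (subset_tsupport φ hz) ?_
      have : dist y 0 < r := hy
      simp only [dist_add_self_left]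
      rw [dist_zero_right] at this
      exact this.le.trans (min_le_left _ _)
    have hsm : ContDiff ℝ (⊤ : ℕ∞) ψ :=
      b.hasCompactSupport_normed.contDiff_convolution_left _ b.contDiff_normed
        (hφ.continuous.locallyIntegrable)
    have hfd : ∀ x, ‖fderiv ℝ φ x - fderiv ℝ ψ x‖ ≤ ε := fun x => by
      have h1 := (hc.hasFDerivAt_convolution_right (lsmul ℝ ℝ) (μ := volume)
        (f := b.normed volume)
        (b.continuous_normed.locallyIntegrable) hφ x).fderiv
      have h2 := b.dist_normed_convolution_le (μ := volume) (g := fderiv ℝ φ) (x₀ := x) (ε := ε)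
        (hφ.continuous_fderiv (by simp)).aestronglyMeasurable
        (fun y hy => (hd (lt_of_lt_of_le hy (min_le_right _ _))).le)
      rw [dist_comm, dist_eq_norm] at h2
      have h3 : fderiv ℝ ψ x =
          MeasureTheory.convolution (b.normed volume) (fderiv ℝ φ) (lsmul ℝ ℝ) volume x := by
        refine h1.trans ?_
        simp only [MeasureTheory.convolution]
        refine integral_congr_ae (Eventually.of_forall fun t => ?_)
        ext
        simp
      rw [h3]
      exact h2
    have h3 : ∫ x, ⟪F x, gradient φ x⟫ = ∫ x, (⟪F x, gradient φ x⟫ - ⟪F x, gradient ψ x⟫) := by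
      rw [integral_sub (hint hφ (self_subset_cthickening _)) (hint (hsm.of_le (by
        exact_mod_cast le_top)) hsupp), h ψ hsm ?_ (hsupp.trans hδΩ), sub_zero]
      exact hK.of_isClosed_subset (isClosed_tsupport ψ) hsupp
    rw [h3, ← setIntegral_eq_integral_of_forall_compl_eq_zero (s := K), ← Real.norm_eq_abs]
    · refine norm_setIntegral_le_of_norm_le_const hK.measure_lt_top fun x hx => ?_
      rw [inner_gradient_eq_fderiv, inner_gradient_eq_fderiv, ← sub_apply]
      exact (le_opNorm _ _).trans (mul_le_mul (hfd x) (hM0 x hx) (norm_nonneg _) hε.le)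
    · intro x hx
      rw [gradient_eq_zero_of_notMem_tsupport (fun h => hx (hsupp h)),
        gradient_eq_zero_of_notMem_tsupport (fun h => hx (self_subset_cthickening _ h))]
      simp
  have : |∫ x, ⟪F x, gradient φ x⟫| ≤ 0 := by
    have ht : Tendsto (fun ε : ℝ => ε * |M| * volume.real K) (𝓝[>] 0)
        (𝓝 (0 * |M| * volume.real K)) := by
      apply Tendsto.mono_left _ nhdsWithin_le_nhds
      exact Continuous.tendsto (by fun_prop) 0
    rw [zero_mul, zero_mul] at ht
    exact ge_of_tendsto ht (by filter_upwards [self_mem_nhdsWithin] with ε hε using key ε hε)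
  exact abs_nonpos_iff.1 this

/-- `u` is a `C¹` weak solution of `-Δ_p u = 0` in `Ω`. -/
def IsPHarmonic (p : ℝ) (Ω : Set E) (u : E → ℝ) : Prop :=
  ContDiffOn ℝ 1 u Ω ∧ ∀ φ : E → ℝ, ContDiff ℝ 1 φ → HasCompactSupport φ → tsupport φ ⊆ Ω →
    ∫ x, ⟪pflux p (gradient u x), gradient φ x⟫ = 0

variable {p : ℝ} {Ω Ω' : Set E} {u : E → ℝ}

lemma IsPHarmonic.mono (h : IsPHarmonic p Ω u) (hΩ : Ω' ⊆ Ω) : IsPHarmonic p Ω' u :=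
  ⟨h.1.mono hΩ, fun φ h1 h2 h3 => h.2 φ h1 h2 (h3.trans hΩ)⟩

lemma IsPHarmonic.add_const (h : IsPHarmonic p Ω u) (c : ℝ) :
    IsPHarmonic p Ω (fun x => u x + c) := by
  refine ⟨h.1.add contDiffOn_const, fun φ h1 h2 h3 => ?_⟩
  have : ∀ x, gradient (fun x => u x + c) x = gradient u x := fun x => by
    simp [gradient, fderiv_add_const]
  simp_rw [this]
  exact h.2 φ h1 h2 h3

lemma IsPHarmonic.neg (h : IsPHarmonic p Ω u) : IsPHarmonic p Ω (fun x => -u x) := by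
  refine ⟨h.1.neg, fun φ h1 h2 h3 => ?_⟩
  have : ∀ x, gradient (fun x => -u x) x = -gradient u x := fun x => by
    simp [gradient, fderiv_fun_neg]
  simp_rw [this, pflux_neg, inner_neg_left, integral_neg, h.2 φ h1 h2 h3, neg_zero]

lemma IsPHarmonic.const_mul (h : IsPHarmonic p Ω u) {c : ℝ} (hc : 0 < c) :
    IsPHarmonic p Ω (fun x => c * u x) := by
  refine ⟨contDiffOn_const.mul h.1, fun φ h1 h2 h3 => ?_⟩
  have : ∀ x, gradient (fun x => c * u x) x = c • gradient u x := fun x => by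
    simp only [gradient]
    have : (fun x => c * u x) = c • u := rfl
    rw [this, fderiv_const_smul_field]; simp
  simp_rw [this, pflux_smul hc, inner_smul_left, integral_const_mul, h.2 φ h1 h2 h3, mul_zero]

end Weak

lemma _root_.IsPosWeakSol.isPHarmonic {d : ℕ} {p : ℝ} (hp : 1 < p)
    {Ω : Set (EuclideanSpace ℝ (Fin d))} (hΩ : IsOpen Ω) {u : EuclideanSpace ℝ (Fin d) → ℝ}
    (hu : IsPosWeakSol p (fun _ => 0) Ω u) : IsPHarmonic p Ω u := by
  refine ⟨hu.1, fun φ h1 h2 h3 => ?_⟩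
  refine integral_inner_gradient_eq_zero_of_smooth hΩ
    ((continuous_pflux hp).comp_continuousOn (continuousOn_gradient hΩ hu.1))
    (fun ψ h1 h2 h3 => ?_) h1 h2 h3
  have := hu.2.2 ψ h1 h2 h3
  simp only [zero_mul, add_zero] at this
  rw [← this, setIntegral_eq_integral_of_forall_compl_eq_zero]
  · simp [pflux]
  · intro x hx
    rw [gradient_eq_zero_of_notMem_tsupport (fun h => hx (h3 h))]; simp

section Cutoff

variable {E : Type*} [NormedAddCommGroup E] [InnerProductSpace ℝ E] [FiniteDimensional ℝ E]

lemma hasGradientAt_norm_sub_sq (x₀ x : E) :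
    HasGradientAt (fun y => ‖y - x₀‖ ^ 2) ((2 : ℝ) • (x - x₀)) x := by
  rw [hasGradientAt_iff_hasFDerivAt]
  refine (((hasFDerivAt_id x).sub_const x₀).norm_sq).congr_fderiv ?_
  ext y
  simp

lemma exists_bound_deriv_smoothTransition : ∃ K > 0, ∀ t, |deriv Real.smoothTransition t| ≤ K := by
  have hsm : ContDiff ℝ 1 Real.smoothTransition := Real.smoothTransition.contDiff
  obtain ⟨K, hK⟩ := (isCompact_Icc (a := (0 : ℝ)) (b := 1)).exists_bound_of_continuousOn
    (hsm.continuous_deriv le_rfl).continuousOn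
  refine ⟨|K| + 1, by positivity, fun t => ?_⟩
  by_cases ht : t ∈ Icc (0 : ℝ) 1
  · exact (hK t ht).trans ((le_abs_self K).trans (by linarith))
  · have : deriv Real.smoothTransition t = 0 := by
      rw [mem_Icc, not_and_or, not_le, not_le] at ht
      rcases ht with ht | ht
      · have : Real.smoothTransition =ᶠ[𝓝 t] fun _ => 0 := by
          filter_upwards [Iio_mem_nhds ht] with y hy
          exact Real.smoothTransition.zero_of_nonpos (le_of_lt hy)
        rw [this.deriv_eq]; simp
      · have : Real.smoothTransition =ᶠ[𝓝 t] fun _ => 1 := by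
          filter_upwards [Ioi_mem_nhds ht] with y hy
          exact Real.smoothTransition.one_of_one_le (le_of_lt hy)
        rw [this.deriv_eq]; simp
    rw [this]; simp; positivity

variable (E) in
/-- Cutoff functions between concentric balls with the scale-invariant gradient bound. -/
lemma exists_cutoff : ∃ C > 0, ∀ (x₀ : E) (a b : ℝ), 0 < a → a < b → ∃ η : E → ℝ,
    ContDiff ℝ 1 η ∧ (∀ x, 0 ≤ η x) ∧ (∀ x, η x ≤ 1) ∧ (∀ x ∈ closedBall x₀ a, η x = 1) ∧
    (∀ x ∉ ball x₀ b, η x = 0) ∧ (∀ x, ‖gradient η x‖ ≤ C / (b - a)) := by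
  obtain ⟨K, hK0, hK⟩ := exists_bound_deriv_smoothTransition
  refine ⟨2 * K, by positivity, fun x₀ a b ha hab => ?_⟩
  have hD : 0 < b ^ 2 - a ^ 2 := by nlinarith
  have hsm : ContDiff ℝ 1 Real.smoothTransition := Real.smoothTransition.contDiff
  set f : E → ℝ := fun x => (b ^ 2 - ‖x - x₀‖ ^ 2) / (b ^ 2 - a ^ 2) with hf
  have hfc : ContDiff ℝ 1 f := by
    have : ContDiff ℝ 1 fun x : E => ‖x - x₀‖ ^ 2 := (contDiff_id.sub contDiff_const).norm_sq ℝ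
    exact (contDiff_const.sub this).div_const _
  have hfg : ∀ x, HasGradientAt f ((-(b ^ 2 - a ^ 2)⁻¹) • (2 : ℝ) • (x - x₀)) x := fun x => by
    have h1 := HasGradientAt.add_const (b ^ 2 / (b ^ 2 - a ^ 2))
      (HasGradientAt.const_mul (-(b ^ 2 - a ^ 2)⁻¹) (hasGradientAt_norm_sub_sq x₀ x))
    have : f = fun y => -(b ^ 2 - a ^ 2)⁻¹ * ‖y - x₀‖ ^ 2 + b ^ 2 / (b ^ 2 - a ^ 2) := by
      ext y; simp only [hf]; field_simp; ring
    rw [this]; exact h1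
  have hout : ∀ x ∉ ball x₀ b, Real.smoothTransition (f x) = 0 := fun x hx => by
    apply Real.smoothTransition.zero_of_nonpos
    rw [mem_ball, not_lt, dist_eq_norm] at hx
    refine div_nonpos_of_nonpos_of_nonneg ?_ hD.le
    nlinarith
  refine ⟨fun x => Real.smoothTransition (f x), hsm.comp hfc,
    fun x => Real.smoothTransition.nonneg _, fun x => Real.smoothTransition.le_one _,
    fun x hx => ?_, hout, fun x => ?_⟩
  · apply Real.smoothTransition.one_of_one_le
    rw [mem_closedBall, dist_eq_norm] at hx
    rw [one_le_div hD]
    nlinarith [norm_nonneg (x - x₀)]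
  · have hg := HasGradientAt.comp (g := Real.smoothTransition)
      ((hsm.differentiable (by simp)) (f x)).hasDerivAt (hfg x)
    by_cases hx : x ∈ closedBall x₀ b
    · rw [mem_closedBall, dist_eq_norm] at hx
      rw [hg.gradient, norm_smul, norm_smul, norm_smul, norm_neg, norm_inv, Real.norm_eq_abs,
        Real.norm_eq_abs, abs_of_pos hD, Real.norm_eq_abs, abs_of_pos (by norm_num : (0 : ℝ) < 2)]
      calc |deriv Real.smoothTransition (f x)| * ((b ^ 2 - a ^ 2)⁻¹ * (2 * ‖x - x₀‖))
          ≤ K * ((b ^ 2 - a ^ 2)⁻¹ * (2 * b)) := by gcongr; exact hK _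
        _ ≤ 2 * K / (b - a) := by
          have h1 : 0 < b - a := by linarith
          have h2 : b ^ 2 - a ^ 2 = (b - a) * (b + a) := by ring
          rw [h2, mul_inv, le_div_iff₀ h1]
          have h3 : 0 < b + a := by linarith
          field_simp
          linarith
    · have h0 : (fun x => Real.smoothTransition (f x)) =ᶠ[𝓝 x] fun _ => 0 := by
        filter_upwards [isClosed_closedBall.isOpen_compl.mem_nhds hx] with y hy
        exact hout y (fun h => hy (ball_subset_closedBall h))
      rw [h0.gradient_eq]
      simp only [gradient_fun_const, norm_zero]
      exact div_nonneg (by positivity) (by linarith)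

omit [InnerProductSpace ℝ E] [FiniteDimensional ℝ E] in
lemma tsupport_subset_closedBall {η : E → ℝ} {x₀ : E} {b : ℝ} (h : ∀ x ∉ ball x₀ b, η x = 0) :
    tsupport η ⊆ closedBall x₀ b := by
  refine closure_minimal (fun x hx => ?_) isClosed_closedBall
  by_contra hx'
  exact hx (h x fun h' => hx' (ball_subset_closedBall h'))

omit [InnerProductSpace ℝ E] in
lemma hasCompactSupport_of_ball [NormedSpace ℝ E] [FiniteDimensional ℝ E] {η : E → ℝ} {x₀ : E} {b : ℝ}
    (h : ∀ x ∉ ball x₀ b, η x = 0) : HasCompactSupport η :=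
  haveI := FiniteDimensional.proper ℝ E
  (isCompact_closedBall x₀ b).of_isClosed_subset (isClosed_tsupport η)
    (tsupport_subset_closedBall h)

end Cutoff

section Caccioppoli

variable {E : Type*} [NormedAddCommGroup E] [InnerProductSpace ℝ E] [FiniteDimensional ℝ E]
  [MeasurableSpace E] [BorelSpace E] {p : ℝ} {Ω : Set E} {u : E → ℝ}

lemma integrable_of_continuousOn_of_eq_zero {K : Set E} (hΩ : IsOpen Ω) (hK : IsCompact K)
    (hKΩ : K ⊆ Ω) {F : Type*} [NormedAddCommGroup F] {f : E → F} (hf : ContinuousOn f Ω)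
    (h0 : ∀ x ∉ K, f x = 0) : Integrable f :=
  (continuous_of_continuousOn_of_eq_zero hΩ hK.isClosed hKΩ hf h0).integrable_of_hasCompactSupport
    (HasCompactSupport.intro hK h0)

omit [FiniteDimensional ℝ E] [MeasurableSpace E] [BorelSpace E] in
lemma contDiff_rpow_comp {η : E → ℝ} (hη : ContDiff ℝ 1 η) (hp : 1 ≤ p) :
    ContDiff ℝ 1 fun x => η x ^ p :=
  (Real.contDiff_rpow_const_of_le (n := 1) (by simpa using hp)).comp hη

lemma young_caccioppoli {p e g G h N n : ℝ} (hp : 1 < p) (he : 0 ≤ e) (hg : 0 ≤ g) (hG : 0 ≤ G)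
    (hh : 0 ≤ h) (hN : 0 ≤ N) (hn : 0 ≤ n) (hgh : g ^ p ≤ G ^ (p - 1) * h) :
    p * (e ^ (p - 1) * g * (N ^ (p - 1) * n)) ≤
      (1 - 1 / p) * (e ^ p * G * N ^ p) + p ^ (p - 1) * (h * n ^ p) := by
  have hp0 : 0 < p := by linarith
  have hp1 : 0 < p - 1 := by linarith
  have hq : (p / (p - 1)).HolderConjugate p := by
    have := Real.HolderConjugate.conjExponent hp
    exact this.symm
  have hg' : g ≤ G ^ ((p - 1) / p) * h ^ (1 / p) := by
    have := Real.rpow_le_rpow (by positivity) hgh (by positivity : 0 ≤ 1 / p)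
    rwa [← Real.rpow_mul hg, mul_one_div_cancel hp0.ne', Real.rpow_one,
      Real.mul_rpow (by positivity) hh, ← Real.rpow_mul hG, mul_one_div] at this
  set A := (e ^ p * G * N ^ p) ^ ((p - 1) / p) with hA
  set B := h ^ (1 / p) * n with hB
  have hyo := Real.young_inequality_of_nonneg (a := A) (b := p * B) (by positivity) (by positivity) hq
  have hAq : A ^ (p / (p - 1)) = e ^ p * G * N ^ p := by
    rw [hA, ← Real.rpow_mul (by positivity)]
    have : (p - 1) / p * (p / (p - 1)) = 1 := by field_simp
    rw [this, Real.rpow_one]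
  have hBp : (p * B) ^ p = p ^ p * (h * n ^ p) := by
    rw [hB, Real.mul_rpow hp0.le (by positivity), Real.mul_rpow (by positivity) hn,
      ← Real.rpow_mul hh, one_div_mul_cancel hp0.ne', Real.rpow_one]
  rw [hAq, hBp] at hyo
  have hAe : A = e ^ (p - 1) * G ^ ((p - 1) / p) * N ^ (p - 1) := by
    have h1 : p * ((p - 1) / p) = p - 1 := by field_simp
    rw [hA, Real.mul_rpow (by positivity) (by positivity), Real.mul_rpow (by positivity) hG,
      ← Real.rpow_mul he, ← Real.rpow_mul hN, h1]
  have hpp : p ^ p = p ^ (p - 1) * p := by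
    rw [← Real.rpow_add_one hp0.ne']; congr 1; ring
  calc p * (e ^ (p - 1) * g * (N ^ (p - 1) * n))
      ≤ p * (e ^ (p - 1) * (G ^ ((p - 1) / p) * h ^ (1 / p)) * (N ^ (p - 1) * n)) := by gcongr
    _ = A * (p * B) := by rw [hAe, hB]; ring
    _ ≤ _ := hyo
    _ = _ := by rw [hpp]; field_simp

/-- The Caccioppoli inequality with a general decreasing weight. -/
lemma caccioppoli (hp : 1 < p) (hΩ : IsOpen Ω) (hu : IsPHarmonic p Ω u) {η : E → ℝ}
    (hη : ContDiff ℝ 1 η) (hη0 : ∀ x, 0 ≤ η x) (hc : HasCompactSupport η) (hs : tsupport η ⊆ Ω)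
    {I : Set ℝ} (hI : IsOpen I) (huI : ∀ x ∈ Ω, u x ∈ I) {g G h : ℝ → ℝ}
    (hg : ∀ s ∈ I, HasDerivAt g (-G s) s) (hGc : ContinuousOn G I) (hhc : ContinuousOn h I)
    (hg0 : ∀ s ∈ I, 0 ≤ g s) (hG0 : ∀ s ∈ I, 0 ≤ G s) (hh0 : ∀ s ∈ I, 0 ≤ h s)
    (hgh : ∀ s ∈ I, g s ^ p ≤ G s ^ (p - 1) * h s) :
    ∫ x, η x ^ p * G (u x) * ‖gradient u x‖ ^ p ≤ p ^ p * ∫ x, h (u x) * ‖gradient η x‖ ^ p := by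
  have hp0 : 0 < p := by linarith
  have hK : IsCompact (tsupport η) := hc
  have hη' : ∀ x ∉ tsupport η, η x = 0 := fun x hx => image_eq_zero_of_notMem_tsupport hx
  have hgr := continuousOn_gradient hΩ hu.1
  have hηgr := continuous_gradient hη
  have huc := hu.1.continuousOn
  have hgcd : ContDiffOn ℝ 1 g I := by
    rw [show (1 : WithTop ℕ∞) = 0 + 1 by simp, contDiffOn_succ_iff_deriv_of_isOpen hI]
    refine ⟨fun s hs => (hg s hs).differentiableAt.differentiableWithinAt, by simp, ?_⟩
    exact contDiffOn_zero.2 (hGc.neg.congr fun s hs => (hg s hs).deriv)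
  set φ : E → ℝ := fun x => η x ^ p * g (u x) with hφ
  have hφ0 : ∀ x ∉ tsupport η, φ x = 0 := fun x hx => by
    simp [hφ, hη' x hx, Real.zero_rpow hp0.ne']
  have hφc : ContDiff ℝ 1 φ := contDiff_of_contDiffOn_of_eq_zero hΩ hK.isClosed hs
    ((contDiff_rpow_comp hη hp.le).contDiffOn.mul (hgcd.comp hu.1 huI)) hφ0
  have hφs : tsupport φ ⊆ tsupport η := closure_minimal (fun x hx => by
    by_contra h; exact hx (hφ0 x h)) (isClosed_tsupport η)
  have h0 := hu.2 φ hφc (hK.of_isClosed_subset (isClosed_tsupport φ) hφs) (hφs.trans hs)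
  have hgrad : ∀ x ∈ Ω, gradient φ x = (η x ^ p * -G (u x)) • gradient u x +
      (g (u x) * (p * η x ^ (p - 1))) • gradient η x := fun x hx => by
    have h1 : HasGradientAt (fun x => η x ^ p) ((p * η x ^ (p - 1)) • gradient η x) x :=
      HasGradientAt.comp (g := fun t => t ^ p) (Real.hasDerivAt_rpow_const (Or.inr hp.le))
      (hasGradientAt_of_contDiffOn isOpen_univ hη.contDiffOn (mem_univ x))
    have h2 := HasGradientAt.comp (hg _ (huI x hx)) (hasGradientAt_of_contDiffOn hΩ hu.1 hx)
    rw [(HasGradientAt.mul h1 h2).gradient, smul_smul, smul_smul]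
  have hi1 : Integrable fun x => η x ^ p * G (u x) * ‖gradient u x‖ ^ p := by
    refine integrable_of_continuousOn_of_eq_zero hΩ hK hs ?_ fun x hx => by
      simp [hη' x hx, Real.zero_rpow hp0.ne']
    exact ((hη.continuous.rpow_const fun _ => Or.inr hp0.le).continuousOn.mul
      (hGc.comp huc huI)).mul (hgr.norm.rpow_const fun _ _ => Or.inr hp0.le)
  have hi2 : Integrable fun x => h (u x) * ‖gradient η x‖ ^ p := by
    refine integrable_of_continuousOn_of_eq_zero hΩ hK hs ?_ fun x hx => by
      simp [gradient_eq_zero_of_notMem_tsupport hx, Real.zero_rpow hp0.ne']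
    exact (hhc.comp huc huI).mul (hηgr.norm.rpow_const fun _ => Or.inr hp0.le).continuousOn
  have hi3 : Integrable fun x => ⟪pflux p (gradient u x), gradient φ x⟫ := by
    refine integrable_of_continuousOn_of_eq_zero hΩ hK hs
      (((continuous_pflux hp).comp_continuousOn hgr).inner (continuous_gradient hφc).continuousOn)
      fun x hx => ?_
    rw [gradient_eq_zero_of_notMem_tsupport (fun h => hx (hφs h)), inner_zero_right]
  have hpt : ∀ x, η x ^ p * G (u x) * ‖gradient u x‖ ^ p + ⟪pflux p (gradient u x), gradient φ x⟫ ≤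
      (1 - 1 / p) * (η x ^ p * G (u x) * ‖gradient u x‖ ^ p) +
        p ^ (p - 1) * (h (u x) * ‖gradient η x‖ ^ p) := fun x => by
    by_cases hx : x ∈ tsupport η
    · have hxΩ := hs hx
      have hxI := huI x hxΩ
      refine le_trans ?_ (young_caccioppoli hp (hη0 x) (hg0 _ hxI) (hG0 _ hxI) (hh0 _ hxI)
        (norm_nonneg _) (norm_nonneg _) (hgh _ hxI))
      rw [hgrad x hxΩ, inner_add_right, inner_smul_right, inner_smul_right, inner_pflux_self hp]
      have h1 := real_inner_le_norm (pflux p (gradient u x)) (gradient η x)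
      rw [norm_pflux hp] at h1
      have h2 : 0 ≤ g (u x) * (p * η x ^ (p - 1)) :=
        mul_nonneg (hg0 _ hxI) (mul_nonneg hp0.le (Real.rpow_nonneg (hη0 x) _))
      have h3 := mul_le_mul_of_nonneg_left h1 h2
      linarith
    · rw [hη' x hx, gradient_eq_zero_of_notMem_tsupport hx,
        gradient_eq_zero_of_notMem_tsupport (fun h => hx (hφs h))]
      simp [Real.zero_rpow hp0.ne']
  have hI := integral_mono (hi1.add hi3) ((hi1.const_mul _).add (hi2.const_mul _)) hpt
  simp only [Pi.add_apply] at hI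
  rw [integral_add hi1 hi3, h0, integral_add (hi1.const_mul _) (hi2.const_mul _),
    integral_const_mul, integral_const_mul] at hI
  have hpp : p ^ p = p ^ (p - 1) * p := by
    rw [← Real.rpow_add_one hp0.ne']; congr 1; ring
  rw [hpp]
  have : (∫ x, η x ^ p * G (u x) * ‖gradient u x‖ ^ p) / p ≤
      p ^ (p - 1) * ∫ x, h (u x) * ‖gradient η x‖ ^ p := by
    rw [div_eq_mul_one_div]; linarith
  rw [div_le_iff₀ hp0] at this
  linarith

end Caccioppoli

section DeGiorgi

open Module (finrank)

variable {E : Type*} [NormedAddCommGroup E] [InnerProductSpace ℝ E] [FiniteDimensional ℝ E]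
  [MeasurableSpace E] [BorelSpace E] {p : ℝ} {Ω : Set E} {u : E → ℝ}

/-- The logarithmic gradient estimate for positive `p`-harmonic functions. -/
lemma caccioppoli_log (hp : 1 < p) : ∃ C > 0, ∀ {Ω : Set E} {u : E → ℝ}, IsOpen Ω →
    IsPHarmonic p Ω u → (∀ x ∈ Ω, 0 < u x) → ∀ {η : E → ℝ}, ContDiff ℝ 1 η → (∀ x, 0 ≤ η x) →
    HasCompactSupport η → tsupport η ⊆ Ω →
    ∫ x, η x ^ p * u x ^ (-p) * ‖gradient u x‖ ^ p ≤ C * ∫ x, ‖gradient η x‖ ^ p := by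
  have hp1 : 0 < p - 1 := by linarith
  refine ⟨(p - 1)⁻¹ * (p ^ p * ((p - 1) ^ (p - 1))⁻¹), by positivity, ?_⟩
  intro Ω u hΩ hu hpos η hη hη0 hc hs
  have h := caccioppoli hp hΩ hu hη hη0 hc hs isOpen_Ioi (I := Ioi 0) hpos
    (g := fun s => s ^ (1 - p)) (G := fun s => (p - 1) * s ^ (-p))
    (h := fun _ => ((p - 1) ^ (p - 1))⁻¹) (fun s hs => by
      have := Real.hasDerivAt_rpow_const (x := s) (p := 1 - p) (Or.inl (ne_of_gt hs))
      convert this using 1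
      rw [show 1 - p - 1 = -p by ring]; ring)
    (continuousOn_const.mul (continuousOn_id.rpow_const fun s hs => Or.inl (ne_of_gt hs)))
    continuousOn_const (fun s hs => Real.rpow_nonneg (le_of_lt hs) _)
    (fun s hs => mul_nonneg hp1.le (Real.rpow_nonneg (le_of_lt hs) _))
    (fun s hs => by positivity)
    (fun s hs => by
      have hs' : 0 ≤ s := le_of_lt hs
      rw [← Real.rpow_mul hs', Real.mul_rpow hp1.le (by positivity), ← Real.rpow_mul hs',
        mul_right_comm, mul_inv_cancel₀ (by positivity), one_mul]
      apply le_of_eq; congr 1; ring)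
  have h1 : ∫ x, η x ^ p * ((p - 1) * u x ^ (-p)) * ‖gradient u x‖ ^ p =
      (p - 1) * ∫ x, η x ^ p * u x ^ (-p) * ‖gradient u x‖ ^ p := by
    rw [← integral_const_mul]; congr 1; ext x; ring
  rw [h1, integral_const_mul] at h
  rw [mul_assoc, mul_assoc, ← div_eq_inv_mul, le_div_iff₀ hp1]
  linarith

lemma hasDerivAt_sq_pos_part (k s : ℝ) :
    HasDerivAt (fun s : ℝ => max (k - s) 0 ^ 2) (-(2 * max (k - s) 0)) s := by
  rcases lt_trichotomy s k with h | h | h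
  · have h1 : HasDerivAt (fun s : ℝ => (k - s) ^ 2) (-(2 * (k - s))) s := by
      have := ((hasDerivAt_id s).const_sub k).pow 2
      refine this.congr_deriv ?_
      simp
    rw [max_eq_left (by linarith)]
    refine h1.congr_of_eventuallyEq ?_
    filter_upwards [Iio_mem_nhds h] with y hy
    rw [max_eq_left (by linarith [mem_Iio.1 hy])]
  · subst h
    rw [sub_self, max_self, mul_zero, neg_zero, hasDerivAt_iff_isLittleO]
    simp only [sub_self, max_self, smul_zero, sub_zero]
    have h1 : (fun x : ℝ => max (s - x) 0 ^ 2 - 0 ^ 2) =O[𝓝 s] fun x => ‖x - s‖ ^ 2 := by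
      refine Asymptotics.IsBigO.of_bound 1 (Eventually.of_forall fun x => ?_)
      rw [zero_pow two_ne_zero, sub_zero, one_mul, norm_pow, norm_pow, norm_norm]
      have : ‖max (s - x) 0‖ ≤ ‖x - s‖ := by
        rw [Real.norm_eq_abs, Real.norm_eq_abs, abs_of_nonneg (le_max_right _ _), abs_sub_comm]
        exact max_le (le_abs_self _) (abs_nonneg _)
      gcongr
    exact h1.trans_isLittleO (by
      have := Asymptotics.isLittleO_pow_sub_sub s (show 1 < 2 by norm_num)
      exact this)
  · rw [max_eq_right (by linarith), mul_zero, neg_zero]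
    refine (hasDerivAt_const s (0 : ℝ)).congr_of_eventuallyEq ?_
    filter_upwards [Ioi_mem_nhds h] with y hy
    rw [max_eq_right (by linarith [mem_Ioi.1 hy])]; norm_num

/-- The Caccioppoli inequality for truncations from above. -/
lemma caccioppoli_truncated (hp : 1 < p) (hΩ : IsOpen Ω) (hu : IsPHarmonic p Ω u) {η : E → ℝ}
    (hη : ContDiff ℝ 1 η) (hη0 : ∀ x, 0 ≤ η x) (hc : HasCompactSupport η) (hs : tsupport η ⊆ Ω)
    (k : ℝ) : ∫ x, η x ^ p * max (k - u x) 0 * ‖gradient u x‖ ^ p ≤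
      p ^ p * ∫ x, max (k - u x) 0 ^ (p + 1) * ‖gradient η x‖ ^ p := by
  have hp0 : 0 < p := by linarith
  have h := caccioppoli hp hΩ hu hη hη0 hc hs isOpen_univ (fun x _ => mem_univ (u x))
    (g := fun s => max (k - s) 0 ^ 2) (G := fun s => 2 * max (k - s) 0)
    (h := fun s => max (k - s) 0 ^ (p + 1)) (fun s _ => hasDerivAt_sq_pos_part k s)
    (Continuous.continuousOn (by fun_prop))
    (Continuous.continuousOn (Continuous.rpow_const (by fun_prop)
      fun _ => Or.inr (by linarith)))
    (fun s _ => by positivity) (fun s _ => by positivity) (fun s _ => by positivity)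
    (fun s _ => by
      set w := max (k - s) 0
      have hw : 0 ≤ w := le_max_right _ _
      rw [Real.mul_rpow zero_le_two hw, ← Real.rpow_natCast, ← Real.rpow_mul hw, mul_assoc,
        ← Real.rpow_add_of_nonneg hw (by linarith) (by linarith),
        show ((2 : ℕ) : ℝ) * p = p - 1 + (p + 1) by push_cast; ring]
      exact le_mul_of_one_le_left (by positivity) (Real.one_le_rpow one_le_two (by linarith)))
  refine le_trans ?_ h
  have h1 : ∫ x, η x ^ p * (2 * max (k - u x) 0) * ‖gradient u x‖ ^ p =
      2 * ∫ x, η x ^ p * max (k - u x) 0 * ‖gradient u x‖ ^ p := by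
    rw [← integral_const_mul]; congr 1; ext x; ring
  rw [h1]
  have : 0 ≤ ∫ x, η x ^ p * max (k - u x) 0 * ‖gradient u x‖ ^ p :=
    integral_nonneg fun x => mul_nonneg (mul_nonneg (Real.rpow_nonneg (hη0 x) _)
      (le_max_right _ _)) (by positivity)
  linarith

variable (E) in
lemma sobolev_integral {s : ℝ} (hs : Real.HolderConjugate (finrank ℝ E) s) : ∃ K > 0,
    ∀ f : E → ℝ, ContDiff ℝ 1 f → HasCompactSupport f → (∀ x, 0 ≤ f x) →
      ∫ x, f x ^ s ≤ K * (∫ x, ‖gradient f x‖) ^ s := by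
  have hs0 : 0 < s := hs.symm.pos
  set K := lintegralPowLePowLIntegralFDerivConst (volume : Measure E) s with hK
  refine ⟨K + 1, by positivity, fun f hf hc h0 => ?_⟩
  have h := lintegral_pow_le_pow_lintegral_fderiv (volume : Measure E) hf hc hs
  have hi1 : Integrable fun x => f x ^ s := by
    refine (hf.continuous.rpow_const fun _ => Or.inr hs0.le).integrable_of_hasCompactSupport ?_
    exact HasCompactSupport.intro (K := tsupport f) hc fun x hx => by
      simp [image_eq_zero_of_notMem_tsupport hx, Real.zero_rpow hs0.ne']
  have hi2 : Integrable (gradient f) := by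
    refine (continuous_gradient hf).integrable_of_hasCompactSupport ?_
    exact HasCompactSupport.intro (K := tsupport f) hc fun x hx =>
      gradient_eq_zero_of_notMem_tsupport hx
  have e1 : ∫⁻ x, ‖f x‖ₑ ^ s = ENNReal.ofReal (∫ x, f x ^ s) := by
    rw [ofReal_integral_eq_lintegral_ofReal hi1
      (Eventually.of_forall fun x => Real.rpow_nonneg (h0 x) s)]
    refine lintegral_congr fun x => ?_
    rw [← ENNReal.ofReal_rpow_of_nonneg (h0 x) hs0.le, Real.enorm_of_nonneg (h0 x)]
  have e2 : ∫⁻ x, ‖fderiv ℝ f x‖ₑ = ENNReal.ofReal (∫ x, ‖gradient f x‖) := by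
    rw [ofReal_integral_norm_eq_lintegral_enorm hi2]
    refine lintegral_congr fun x => ?_
    rw [← ofReal_norm, ← ofReal_norm, norm_gradient]
  have hI : 0 ≤ ∫ x, ‖gradient f x‖ := integral_nonneg fun x => norm_nonneg _
  rw [e1, e2, ENNReal.ofReal_rpow_of_nonneg hI hs0.le, ← hK, ← ENNReal.ofReal_coe_nnreal,
    ← ENNReal.ofReal_mul (by positivity), ENNReal.ofReal_le_ofReal_iff (by positivity)] at h
  refine h.trans ?_
  gcongr
  linarith

lemma le_add_rpow_mul {X l : ℝ} (hp : 1 < p) (hX : 0 ≤ X) (hl : 0 < l) :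
    X ≤ l + X ^ p * l ^ (1 - p) := by
  by_cases h : X ≤ l
  · have : 0 ≤ X ^ p * l ^ (1 - p) := by positivity
    linarith
  · push Not at h
    have h1 : 1 ≤ (X / l) ^ (p - 1) :=
      Real.one_le_rpow ((one_le_div hl).2 h.le) (by linarith)
    have hX0 : 0 < X := hl.trans h
    have h2 : X ^ p * l ^ (1 - p) = X * (X / l) ^ (p - 1) := by
      rw [Real.div_rpow hX hl.le, show p = 1 + (p - 1) by ring, Real.rpow_add hX0, Real.rpow_one,
        show 1 - (1 + (p - 1)) = -(p - 1) by ring, Real.rpow_neg hl.le]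
      rw [show 1 + (p - 1) - 1 = p - 1 by ring]
      field_simp
    rw [h2]
    nlinarith

variable (E) in
/-- One step of the De Giorgi iteration. -/
lemma deGiorgi_step (hp : 1 < p) {s : ℝ} (hs : Real.HolderConjugate (finrank ℝ E) s) :
    ∃ K > 0, ∀ {Ω : Set E} {u : E → ℝ}, IsOpen Ω → IsPHarmonic p Ω u → (∀ x ∈ Ω, 0 < u x) →
    ∀ (x₀ : E) (a b k k' : ℝ), 0 < a → a < b → closedBall x₀ b ⊆ Ω → 0 < k → k' < k →
    volume.real {x | x ∈ closedBall x₀ a ∧ u x < k'} * ((k - k') ^ 2) ^ s ≤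
      K * (k ^ 2 / (b - a) * volume.real {x | x ∈ closedBall x₀ b ∧ u x < k}) ^ s := by
  obtain ⟨C₀, hC₀, hcut⟩ := exists_cutoff E
  obtain ⟨K, hK, hsob⟩ := sobolev_integral E hs
  have hs0 : 0 < s := hs.symm.pos
  have hp0 : 0 < p := by linarith
  set M := C₀ + 2 + 2 * (p ^ p * C₀ ^ p) with hM
  have hM0 : 0 < M := by positivity
  refine ⟨K * M ^ s, by positivity, ?_⟩
  intro Ω u hΩ hu hpos x₀ a b k k' ha hab hbΩ hk hkk
  obtain ⟨η, hη, hη0, hη1, hηa, hηb, hηg⟩ := hcut x₀ a b ha hab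
  have hba : 0 < b - a := by linarith
  have hts := tsupport_subset_closedBall hηb
  have hcη := hasCompactSupport_of_ball hηb
  have hKc : IsCompact (closedBall x₀ b) := isCompact_closedBall x₀ b
  have huc := hu.1.continuousOn
  have hgr := continuousOn_gradient hΩ hu.1
  set w : E → ℝ := fun x => max (k - u x) 0 with hw
  have hw0 : ∀ x, 0 ≤ w x := fun x => le_max_right _ _
  have hwk : ∀ x ∈ Ω, w x ≤ k := fun x hx => max_le (by linarith [hpos x hx]) hk.le
  have hwc : ContinuousOn w Ω := (continuousOn_const.sub huc).sup continuousOn_const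
  have hη' : ∀ x ∉ closedBall x₀ b, η x = 0 := fun x hx =>
    hηb x fun h => hx (ball_subset_closedBall h)
  have hgη' : ∀ x ∉ closedBall x₀ b, gradient η x = 0 := fun x hx =>
    gradient_eq_zero_of_notMem_tsupport fun h => hx (hts h)
  set A : Set E := {x | x ∈ closedBall x₀ b ∧ u x < k} with hA
  have measA : ∀ c t : ℝ, c ≤ b → MeasurableSet {x | x ∈ closedBall x₀ c ∧ u x < t} := fun c t hc => by
    have hsub : closedBall x₀ c ⊆ Ω := (closedBall_subset_closedBall hc).trans hbΩ
    have : {x | x ∈ closedBall x₀ c ∧ u x < t} = closedBall x₀ c ∩ (Ω ∩ u ⁻¹' Iio t) := by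
      ext x; simp only [mem_ofPred_eq, mem_inter_iff, mem_preimage, mem_Iio]
      exact ⟨fun h => ⟨h.1, hsub h.1, h.2⟩, fun h => ⟨h.1, h.2.2⟩⟩
    rw [this]
    exact isClosed_closedBall.measurableSet.inter (huc.isOpen_inter_preimage hΩ isOpen_Iio).measurableSet
  have finA : ∀ c t : ℝ, volume {x | x ∈ closedBall x₀ c ∧ u x < t} ≠ ∞ := fun c t =>
    ((measure_mono fun x hx => hx.1).trans_lt (isCompact_closedBall x₀ c).measure_lt_top).ne
  have mA : MeasurableSet A := measA b k le_rfl
  set f : E → ℝ := fun x => η x * w x ^ 2 with hf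
  have hf0 : ∀ x ∉ closedBall x₀ b, f x = 0 := fun x hx => by simp [hf, hη' x hx]
  have hw2 : ContDiffOn ℝ 1 (fun x => w x ^ 2) Ω := by
    have : ContDiff ℝ 1 fun s : ℝ => max (k - s) 0 ^ 2 := by
      rw [contDiff_one_iff_deriv]
      refine ⟨fun s => (hasDerivAt_sq_pos_part k s).differentiableAt, ?_⟩
      rw [show deriv (fun s : ℝ => max (k - s) 0 ^ 2) = fun s => -(2 * max (k - s) 0) from
        funext fun s => (hasDerivAt_sq_pos_part k s).deriv]
      fun_prop
    exact this.comp_contDiffOn hu.1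
  have hfc : ContDiff ℝ 1 f := contDiff_of_contDiffOn_of_eq_zero hΩ hKc.isClosed hbΩ
    (hη.contDiffOn.mul hw2) hf0
  have hfcs : HasCompactSupport f := HasCompactSupport.intro hKc hf0
  have hfgr : ∀ x ∈ Ω, gradient f x = (η x * -(2 * w x)) • gradient u x + (w x ^ 2) • gradient η x :=
    fun x hx => by
      have h1 := HasGradientAt.comp (hasDerivAt_sq_pos_part k (u x))
        (hasGradientAt_of_contDiffOn hΩ hu.1 hx)
      have h2 := hasGradientAt_of_contDiffOn isOpen_univ hη.contDiffOn (mem_univ x)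
      rw [(HasGradientAt.mul h2 h1).gradient, smul_smul]
  set l := k / (b - a) with hl
  have hl0 : 0 < l := by positivity
  have hpt : ∀ x, ‖gradient f x‖ ≤ A.indicator (fun _ => k ^ 2 / (b - a) * (C₀ + 2)) x +
      2 * l ^ (1 - p) * (η x ^ p * w x * ‖gradient u x‖ ^ p) := fun x => by
    have hnn : 0 ≤ 2 * l ^ (1 - p) * (η x ^ p * w x * ‖gradient u x‖ ^ p) := by
      have := hη0 x; have := hw0 x; positivity
    by_cases hx : x ∈ closedBall x₀ b
    · rw [hfgr x (hbΩ hx)]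
      by_cases hxA : x ∈ A
      · rw [indicator_of_mem hxA]
        have hwx := hwk x (hbΩ hx)
        have hw0x := hw0 x
        have hηx := hη0 x
        have n1 : ‖(η x * -(2 * w x)) • gradient u x‖ = 2 * w x * (η x * ‖gradient u x‖) := by
          rw [norm_smul, Real.norm_eq_abs, abs_mul, abs_neg, abs_of_nonneg hηx,
            abs_of_nonneg (by positivity)]; ring
        have n2 : ‖(w x ^ 2) • gradient η x‖ ≤ k ^ 2 * (C₀ / (b - a)) := by
          rw [norm_smul, Real.norm_eq_abs, abs_of_nonneg (by positivity)]
          have := hηg x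
          gcongr
        have n3 := le_add_rpow_mul hp (mul_nonneg hηx (norm_nonneg (gradient u x))) hl0
        rw [Real.mul_rpow hηx (norm_nonneg _)] at n3
        have n4 := mul_le_mul_of_nonneg_left n3 (by positivity : 0 ≤ 2 * w x)
        have n5 : 2 * w x * l ≤ 2 * k * l := by gcongr
        have n6 : k * l = k ^ 2 / (b - a) := by rw [hl]; ring
        refine (norm_add_le _ _).trans ?_
        rw [n1]
        have n7 : k ^ 2 * (C₀ / (b - a)) = k ^ 2 / (b - a) * C₀ := by ring
        have n8 : 2 * w x * (l + η x ^ p * ‖gradient u x‖ ^ p * l ^ (1 - p)) = 2 * w x * l +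
          2 * l ^ (1 - p) * (η x ^ p * w x * ‖gradient u x‖ ^ p) := by ring
        linarith
      · have : w x = 0 := by
          apply max_eq_right
          by_contra h
          exact hxA ⟨hx, by linarith⟩
        rw [indicator_of_notMem hxA, this]; simp
    · rw [gradient_eq_zero_of_notMem_tsupport (fun h => hx
        (closure_minimal (fun y hy => by by_contra h'; exact hy (hf0 y h')) hKc.isClosed h)),
        norm_zero]
      refine add_nonneg (indicator_nonneg (fun _ _ => by positivity) _) hnn
  have hi1 : Integrable fun x => η x ^ p * w x * ‖gradient u x‖ ^ p := by
    refine integrable_of_continuousOn_of_eq_zero hΩ hKc hbΩ ?_ fun x hx => by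
      simp [hη' x hx, Real.zero_rpow hp0.ne']
    exact ((hη.continuous.rpow_const fun _ => Or.inr hp0.le).continuousOn.mul hwc).mul
      (hgr.norm.rpow_const fun _ _ => Or.inr hp0.le)
  have hi2 : ∀ c : ℝ, Integrable (A.indicator fun _ : E => c) := fun c =>
    (integrable_indicator_iff mA).2 (integrableOn_const (finA b k))
  have hi3 : Integrable fun x => ‖gradient f x‖ := by
    refine (continuous_gradient hfc).norm.integrable_of_hasCompactSupport ?_
    exact HasCompactSupport.intro (K := tsupport f) hfcs fun x hx => by
      rw [gradient_eq_zero_of_notMem_tsupport hx, norm_zero]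
  have hI1 := integral_mono hi3 ((hi2 _).add (hi1.const_mul _)) hpt
  simp only [Pi.add_apply] at hI1
  rw [integral_add (hi2 _) (hi1.const_mul _), integral_const_mul, integral_indicator_const _ mA,
    smul_eq_mul] at hI1
  have hI2 := caccioppoli_truncated hp hΩ hu hη hη0 hcη (hts.trans hbΩ) k
  have hI3 : ∫ x, w x ^ (p + 1) * ‖gradient η x‖ ^ p ≤
      volume.real A * (k ^ (p + 1) * (C₀ / (b - a)) ^ p) := by
    rw [← smul_eq_mul (volume.real A), ← integral_indicator_const _ mA]
    refine integral_mono ?_ (hi2 _) fun x => ?_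
    · refine integrable_of_continuousOn_of_eq_zero hΩ hKc hbΩ ?_ fun x hx => by
        simp [hgη' x hx, Real.zero_rpow hp0.ne']
      exact (hwc.rpow_const fun _ _ => Or.inr (by linarith)).mul
        ((continuous_gradient hη).norm.rpow_const fun _ => Or.inr hp0.le).continuousOn
    · by_cases hx : x ∈ closedBall x₀ b
      · by_cases hxA : x ∈ A
        · rw [indicator_of_mem hxA]
          have := hwk x (hbΩ hx); have := hηg x; have := hw0 x
          gcongr
        · have : w x = 0 := by
            apply max_eq_right
            by_contra h
            exact hxA ⟨hx, by linarith⟩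
          rw [indicator_of_notMem hxA, this, Real.zero_rpow (by linarith)]; simp
      · rw [hgη' x hx, norm_zero, Real.zero_rpow hp0.ne', mul_zero]
        exact indicator_nonneg (fun _ _ => by positivity) _
  have hI4 : ∫ x, ‖gradient f x‖ ≤ M * (k ^ 2 / (b - a) * volume.real A) := by
    have e : l ^ (1 - p) * (k ^ (p + 1) * (C₀ / (b - a)) ^ p) = C₀ ^ p * (k ^ 2 / (b - a)) := by
      rw [hl, Real.div_rpow hk.le hba.le, Real.div_rpow hC₀.le hba.le, Real.rpow_sub hk,
        Real.rpow_sub hba, Real.rpow_add hk, Real.rpow_one, Real.rpow_one]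
      field_simp
    have h1 : 0 ≤ 2 * l ^ (1 - p) := by positivity
    have h2 := mul_le_mul_of_nonneg_left (hI2.trans (mul_le_mul_of_nonneg_left hI3
      (by positivity : 0 ≤ p ^ p))) h1
    have h3 : 2 * l ^ (1 - p) * (p ^ p * (volume.real A * (k ^ (p + 1) * (C₀ / (b - a)) ^ p))) =
      2 * p ^ p * volume.real A * (l ^ (1 - p) * (k ^ (p + 1) * (C₀ / (b - a)) ^ p)) := by ring
    rw [h3, e] at h2
    refine hI1.trans ?_
    rw [hM]
    linarith
  have hI5 := hsob f hfc hfcs fun x => mul_nonneg (hη0 x) (sq_nonneg _)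
  have hA' := measA a k' hab.le
  calc volume.real {x | x ∈ closedBall x₀ a ∧ u x < k'} * ((k - k') ^ 2) ^ s
      ≤ ∫ x, f x ^ s := by
        rw [← smul_eq_mul, ← integral_indicator_const _ hA']
        refine integral_mono ((integrable_indicator_iff hA').2 (integrableOn_const (finA a k'))) ?_
          fun x => ?_
        · refine (hfc.continuous.rpow_const fun _ => Or.inr
            hs0.le).integrable_of_hasCompactSupport ?_
          exact HasCompactSupport.intro hKc fun x hx => by
            rw [hf0 x hx, Real.zero_rpow hs0.ne']
        · by_cases hx : x ∈ {x | x ∈ closedBall x₀ a ∧ u x < k'}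
          · rw [indicator_of_mem hx]
            simp only [hf, hηa x hx.1, one_mul]
            have : k - k' ≤ w x := le_trans (by linarith [hx.2]) (le_max_left _ _)
            have : 0 < k - k' := by linarith
            gcongr
          · rw [indicator_of_notMem hx]
            exact Real.rpow_nonneg (mul_nonneg (hη0 x) (sq_nonneg _)) _
    _ ≤ K * (∫ x, ‖gradient f x‖) ^ s := hI5
    _ ≤ K * (M * (k ^ 2 / (b - a) * volume.real A)) ^ s := by
        have : 0 ≤ ∫ x, ‖gradient f x‖ := integral_nonneg fun x => norm_nonneg _
        gcongr
    _ = _ := by rw [Real.mul_rpow hM0.le (by positivity)]; ring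

end DeGiorgi

section Iteration

open Module (finrank)

lemma exists_threshold_iteration {s C : ℝ} (hs : 1 < s) (hC : 0 < C) : ∃ ν > 0, ∀ Y : ℕ → ℝ,
    (∀ j, 0 ≤ Y j) → Y 0 ≤ ν → (∀ j, Y (j + 1) ≤ C * (8 ^ j * Y j) ^ s) →
      Tendsto Y atTop (𝓝 0) := by
  have hs1 : 0 < s - 1 := by linarith
  set θ : ℝ := 8 ^ (-(s / (s - 1))) with hθ
  have hθ0 : 0 < θ := by positivity
  have hθ1 : θ < 1 := Real.rpow_lt_one_of_one_lt_of_neg (by norm_num)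
    (neg_lt_zero.2 (by positivity))
  have h8 : (8 * θ) ^ s = θ := by
    have : (8 : ℝ) * θ = 8 ^ (1 - s / (s - 1)) := by
      rw [hθ, Real.rpow_sub (by norm_num), Real.rpow_one, Real.rpow_neg (by norm_num)]; rfl
    rw [this, ← Real.rpow_mul (by norm_num), hθ]
    congr 1
    field_simp
    ring
  set ν : ℝ := (θ / C) ^ (1 / (s - 1)) with hν
  have hν0 : 0 < ν := by positivity
  have hνs : C * ν ^ s = θ * ν := by
    have h1 : ν ^ (s - 1) = θ / C := by
      rw [hν, ← Real.rpow_mul (by positivity), one_div_mul_cancel hs1.ne', Real.rpow_one]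
    rw [show s = (s - 1) + 1 by ring, Real.rpow_add_one hν0.ne', h1]
    field_simp
  refine ⟨ν, hν0, fun Y hY hY0 hstep => ?_⟩
  have hb : ∀ j, Y j ≤ ν * θ ^ j := fun j => by
    induction j with
    | zero => simpa using hY0
    | succ j ih =>
      calc Y (j + 1) ≤ C * (8 ^ j * Y j) ^ s := hstep j
        _ ≤ C * (8 ^ j * (ν * θ ^ j)) ^ s := by
          have := hY j
          gcongr
        _ = C * ν ^ s * ((8 * θ) ^ s) ^ j := by
          rw [show 8 ^ j * (ν * θ ^ j) = ν * (8 * θ) ^ j by rw [mul_pow]; ring,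
            Real.mul_rpow hν0.le (by positivity), ← Real.rpow_pow_comm (by positivity)]
          ring
        _ = ν * θ ^ (j + 1) := by rw [h8, hνs]; ring
  refine squeeze_zero hY hb ?_
  simpa using (tendsto_pow_atTop_nhds_zero_of_lt_one hθ0.le hθ1).const_mul ν

variable {E : Type*} [NormedAddCommGroup E] [InnerProductSpace ℝ E] [FiniteDimensional ℝ E]
  [MeasurableSpace E] [BorelSpace E] {p : ℝ} {Ω : Set E} {u : E → ℝ}

variable (E) in
/-- De Giorgi's lemma: a positive `p`-harmonic function which is large on most of a ball is bounded
below on a smaller ball. -/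
lemma deGiorgi (hp : 1 < p) (hd : 2 ≤ finrank ℝ E) :
    ∃ ν > 0, ∀ {Ω : Set E} {u : E → ℝ}, IsOpen Ω → IsPHarmonic p Ω u → (∀ x ∈ Ω, 0 < u x) →
    ∀ (x₀ : E) (r k : ℝ), 0 < r → 0 < k → closedBall x₀ (3 * r) ⊆ Ω →
    volume.real {x | x ∈ closedBall x₀ (3 * r) ∧ u x < k} ≤ ν * r ^ finrank ℝ E →
    ∀ x ∈ ball x₀ (2 * r), k / 2 ≤ u x := by
  set d := finrank ℝ E with hdd
  have hd1 : (1 : ℝ) < d := by exact_mod_cast hd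
  set s := Real.conjExponent d with hs
  have hconj : Real.HolderConjugate (finrank ℝ E) s := Real.HolderConjugate.conjExponent hd1
  have hs1 : 1 < s := hconj.symm.lt
  have hs0 : 0 < s := by linarith
  obtain ⟨K, hK, hstep⟩ := deGiorgi_step E hp hconj
  obtain ⟨ν, hν, hiter⟩ := exists_threshold_iteration hs1 (C := K * 32 ^ s) (by positivity)
  refine ⟨ν, hν, ?_⟩
  intro Ω u hΩ hu hpos x₀ r k hr hk hsub hmeas
  set b : ℕ → ℝ := fun j => 2 * r + r / 2 ^ j with hb
  set κ : ℕ → ℝ := fun j => k / 2 + k / 2 ^ (j + 1) with hκ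
  set A : ℕ → ℝ := fun j => volume.real {x | x ∈ closedBall x₀ (b j) ∧ u x < κ j} with hA
  have hA0 : ∀ j, 0 ≤ A j := fun j => measureReal_nonneg
  have hb3 : ∀ j, b j ≤ 3 * r := fun j => by
    have : r / 2 ^ j ≤ r := div_le_self hr.le (one_le_pow₀ one_le_two)
    simp only [hb]; linarith
  have hκk : ∀ j, κ j ≤ k := fun j => by
    have : k / 2 ^ (j + 1) ≤ k / 2 := by
      rw [pow_succ]
      exact div_le_div_of_nonneg_left hk.le (by norm_num)
        (by nlinarith [one_le_pow₀ (M₀ := ℝ) one_le_two (n := j)])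
    simp only [hκ]; linarith
  have hAs : ∀ j, A (j + 1) ≤ K * (32 * 8 ^ j / r * A j) ^ s := fun j => by
    have hbb : b j - b (j + 1) = r / 2 ^ (j + 1) := by
      simp only [hb, pow_succ]; field_simp; ring
    have hkk : κ j - κ (j + 1) = k / 2 ^ (j + 2) := by
      simp only [hκ, pow_succ]; field_simp; ring
    have hκ0 : 0 < κ j := by simp only [hκ]; positivity
    have h := hstep hΩ hu hpos x₀ (b (j + 1)) (b j) (κ j) (κ (j + 1))
      (by simp only [hb]; positivity)
      (by have : 0 < r / 2 ^ (j + 1) := by positivity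
          linarith)
      ((closedBall_subset_closedBall (hb3 j)).trans hsub) hκ0
      (by have : 0 < k / 2 ^ (j + 2) := by positivity
          linarith)
    rw [hbb, hkk] at h
    have h1 : A (j + 1) * ((k / 2 ^ (j + 2)) ^ 2) ^ s ≤
        K * (k ^ 2 / (r / 2 ^ (j + 1)) * A j) ^ s := by
      refine h.trans ?_
      have := hκk j
      have := hA0 j
      gcongr
    have h2 : k ^ 2 / (r / 2 ^ (j + 1)) * A j =
        (32 * 8 ^ j / r * A j) * (k / 2 ^ (j + 2)) ^ 2 := by
      have : (8 : ℝ) ^ j = 2 ^ j * 2 ^ j * 2 ^ j := by rw [← mul_pow, ← mul_pow]; norm_num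
      rw [this, pow_succ, pow_add]
      field_simp
      ring
    have h3 : 0 ≤ 32 * 8 ^ j / r * A j := by have := hA0 j; positivity
    rw [h2, Real.mul_rpow h3 (by positivity), ← mul_assoc] at h1
    exact le_of_mul_le_mul_right h1 (by positivity)
  have hrs : (r ^ (d - 1)) ^ s = r ^ d := by
    have h1 := hconj.sub_one_mul_conj
    rw [← Real.rpow_natCast, ← Real.rpow_mul hr.le, ← Real.rpow_natCast r d]
    congr 1
    rw [Nat.cast_sub (by omega), Nat.cast_one]
    exact h1
  have hrd : r ^ d = r ^ (d - 1) * r := by rw [← pow_succ]; congr 1; omega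
  have hlim := hiter (fun j => A j / r ^ d) (fun j => by have := hA0 j; positivity) (by
      rw [div_le_iff₀ (by positivity)]
      have h0 : {x | x ∈ closedBall x₀ (b 0) ∧ u x < κ 0} ⊆
          {x | x ∈ closedBall x₀ (3 * r) ∧ u x < k} := fun x hx =>
        ⟨closedBall_subset_closedBall (hb3 0) hx.1, hx.2.trans_le (hκk 0)⟩
      refine le_trans (measureReal_mono h0 ?_) hmeas
      · exact ((measure_mono fun x hx => hx.1).trans_lt
          (isCompact_closedBall x₀ (3 * r)).measure_lt_top).ne) fun j => by
    rw [div_le_iff₀ (by positivity)]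
    refine (hAs j).trans (le_of_eq ?_)
    have := hA0 j
    have e : 32 * 8 ^ j / r * A j = 32 * (8 ^ j * (A j / r ^ d)) * r ^ (d - 1) := by
      rw [hrd]; field_simp
    rw [e, Real.mul_rpow (by positivity) (by positivity), Real.mul_rpow (by positivity)
      (by positivity), hrs]
    ring
  intro x hx
  by_contra hlt
  push Not at hlt
  set U : Set E := ball x₀ (2 * r) ∩ u ⁻¹' Iio (k / 2) with hU
  have hballΩ : ball x₀ (2 * r) ⊆ Ω := (ball_subset_closedBall.trans
    (closedBall_subset_closedBall (by linarith))).trans hsub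
  have hUo : IsOpen U := (hu.1.continuousOn.mono hballΩ).isOpen_inter_preimage isOpen_ball isOpen_Iio
  have hUpos : 0 < volume U := hUo.measure_pos volume ⟨x, hx, hlt⟩
  have hUfin : volume U ≠ ∞ := ((measure_mono inter_subset_left).trans_lt measure_ball_lt_top).ne
  have hUr : 0 < volume.real U := ENNReal.toReal_pos hUpos.ne' hUfin
  have hle : ∀ j, volume.real U / r ^ d ≤ A j / r ^ d := fun j => by
    gcongr
    refine measureReal_mono (fun y hy => ⟨?_, ?_⟩) ?_
    · refine closedBall_subset_closedBall ?_ (ball_subset_closedBall hy.1)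
      have : 0 < r / 2 ^ j := by positivity
      simp only [hb]; linarith
    · have : 0 < k / 2 ^ (j + 1) := by positivity
      have h : u y < k / 2 := hy.2
      simp only [hκ]; linarith
    · exact ((measure_mono fun x hx => hx.1).trans_lt
          (isCompact_closedBall x₀ (b j)).measure_lt_top).ne
  have := ge_of_tendsto' hlim hle
  have : 0 < volume.real U / r ^ d := by positivity
  linarith

end Iteration

section Translation

variable {E : Type*} [NormedAddCommGroup E] [InnerProductSpace ℝ E] [FiniteDimensional ℝ E]
  [MeasurableSpace E] [BorelSpace E]

lemma lintegral_translate_sub_le {Ω C S : Set E} (hΩ : IsOpen Ω) {v : E → ℝ}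
    (hv : ContDiffOn ℝ 1 v Ω) (hC : MeasurableSet C) (hCΩ : C ⊆ Ω) (h : E)
    (hS : ∀ x ∈ S, ∀ t ∈ Icc (0 : ℝ) 1, x + t • h ∈ C) :
    ∫⁻ x in S, ‖v (x + h) - v x‖ₑ ≤ ‖h‖ₑ * ∫⁻ x in C, ‖gradient v x‖ₑ := by
  set G : E → ℝ≥0∞ := C.indicator fun x => ‖gradient v x‖ₑ with hG
  have hGm : Measurable G := by
    refine Measurable.indicator ?_ hC
    have : (fun x => ‖gradient v x‖ₑ) = fun x => ‖fderiv ℝ v x‖ₑ := by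
      ext x; rw [← ofReal_norm, ← ofReal_norm, norm_gradient]
    rw [this]
    exact (measurable_fderiv ℝ v).enorm
  have hG2 : Measurable fun z : E × ℝ => G (z.1 + z.2 • h) :=
    hGm.comp (measurable_fst.add (measurable_snd.smul_const h))
  have hpt : ∀ x ∈ S, ‖v (x + h) - v x‖ₑ ≤ ‖h‖ₑ * ∫⁻ t in Ioc (0 : ℝ) 1, G (x + t • h) :=
      fun x hx => by
    have hline : ∀ t : ℝ, HasDerivAt (fun t : ℝ => x + t • h) h t := fun t => by
      have := ((hasDerivAt_id t).smul_const h).const_add x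
      simpa using this
    have hder : ∀ t ∈ uIcc (0 : ℝ) 1, HasDerivAt (fun t : ℝ => v (x + t • h))
        (⟪gradient v (x + t • h), h⟫) t := fun t ht => by
      rw [uIcc_of_le zero_le_one] at ht
      have h1 := (hasGradientAt_of_contDiffOn hΩ hv (hCΩ (hS x hx t ht))).hasFDerivAt
      have := h1.comp_hasDerivAt t (hline t)
      simpa [Function.comp_def] using this
    have hcont : ContinuousOn (fun t : ℝ => ⟪gradient v (x + t • h), h⟫) (uIcc 0 1) := by
      refine ContinuousOn.inner ((continuousOn_gradient hΩ hv).comp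
        (Continuous.continuousOn (by fun_prop)) fun t ht => ?_) continuousOn_const
      rw [uIcc_of_le zero_le_one] at ht
      exact hCΩ (hS x hx t ht)
    have := intervalIntegral.integral_eq_sub_of_hasDerivAt hder hcont.intervalIntegrable
    simp only [one_smul, zero_smul, add_zero] at this
    rw [← this, intervalIntegral.integral_of_le zero_le_one]
    refine (enorm_integral_le_lintegral_enorm _).trans ?_
    rw [← lintegral_const_mul' _ _ enorm_ne_top]
    refine setLIntegral_mono' measurableSet_Ioc fun t ht => ?_
    rw [hG, indicator_of_mem (hS x hx t (Ioc_subset_Icc_self ht)), mul_comm, ← ofReal_norm,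
      ← ofReal_norm, ← ofReal_norm, ← ENNReal.ofReal_mul (norm_nonneg _)]
    exact ENNReal.ofReal_le_ofReal (norm_inner_le_norm _ _)
  calc ∫⁻ x in S, ‖v (x + h) - v x‖ₑ
      ≤ ∫⁻ x in S, ‖h‖ₑ * ∫⁻ t in Ioc (0 : ℝ) 1, G (x + t • h) :=
        setLIntegral_mono (hG2.lintegral_prod_right'.const_mul _) hpt
    _ ≤ ∫⁻ x, ‖h‖ₑ * ∫⁻ t in Ioc (0 : ℝ) 1, G (x + t • h) := setLIntegral_le_lintegral _ _
    _ = ‖h‖ₑ * ∫⁻ x, ∫⁻ t in Ioc (0 : ℝ) 1, G (x + t • h) := lintegral_const_mul' _ _ enorm_ne_top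
    _ = ‖h‖ₑ * ∫⁻ t in Ioc (0 : ℝ) 1, ∫⁻ x, G (x + t • h) := by
        rw [lintegral_lintegral_swap hG2.aemeasurable]
    _ = ‖h‖ₑ * ∫⁻ x, G x := by
        simp_rw [lintegral_add_right_eq_self G]
        simp
    _ = _ := by rw [hG, lintegral_indicator hC]

/-- A Poincaré-type inequality separating two subsets of a ball. -/
lemma poincare_sets {v : E → ℝ} {x₀ : E} {R : ℝ} (hv : ContDiffOn ℝ 1 v (ball x₀ R))
    {X Y : Set E} (hX : X ⊆ ball x₀ R) (hY : Y ⊆ ball x₀ R) (mX : MeasurableSet X)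
    (mY : MeasurableSet Y) {L : ℝ} (hL : ∀ x ∈ X, ∀ y ∈ Y, L ≤ |v y - v x|) :
    ENNReal.ofReal L * (volume X * volume Y) ≤ volume (ball (0 : E) (2 * R)) *
      (ENNReal.ofReal (2 * R) * ∫⁻ x in ball x₀ R, ‖gradient v x‖ₑ) := by
  have e1 : volume X * volume Y = ∫⁻ h : E, volume (X ∩ (fun x => x + h) ⁻¹' Y) := by
    have hm : Measurable (Function.uncurry fun (x h : E) =>
        X.indicator (fun _ => (1 : ℝ≥0∞)) x * Y.indicator (fun _ => (1 : ℝ≥0∞)) (x + h)) := by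
      have h1 : Measurable (X.indicator fun _ => (1 : ℝ≥0∞)) := measurable_const.indicator mX
      have h2 : Measurable (Y.indicator fun _ => (1 : ℝ≥0∞)) := measurable_const.indicator mY
      exact (h1.comp measurable_fst).mul (h2.comp (measurable_fst.add measurable_snd))
    have h1 : ∀ h, volume (X ∩ (fun x => x + h) ⁻¹' Y) = ∫⁻ x, X.indicator (fun _ => (1 : ℝ≥0∞)) x *
        Y.indicator (fun _ => (1 : ℝ≥0∞)) (x + h) := fun h => by
      have mm : MeasurableSet (X ∩ (fun x => x + h) ⁻¹' Y) := mX.inter ((measurable_add_const h) mY)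
      rw [← lintegral_indicator_one mm]
      refine lintegral_congr fun x => ?_
      by_cases hx : x ∈ X <;> by_cases hy : x + h ∈ Y <;> simp [hx, hy]
    simp_rw [h1]
    rw [← lintegral_lintegral_swap hm.aemeasurable]
    have h2 : ∀ x, ∫⁻ h, X.indicator (fun _ => (1 : ℝ≥0∞)) x *
        Y.indicator (fun _ => (1 : ℝ≥0∞)) (x + h) =
        X.indicator (fun _ => (1 : ℝ≥0∞)) x * volume Y := fun x => by
      rw [lintegral_const_mul' _ _ (by by_cases hx : x ∈ X <;> simp [hx]),
        lintegral_add_left_eq_self (Y.indicator fun _ => (1 : ℝ≥0∞)) x]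
      congr 1
      exact lintegral_indicator_one mY
    simp_rw [h2]
    rw [lintegral_mul_const _ (measurable_const.indicator mX)]
    congr 1
    exact (lintegral_indicator_one mX).symm
  rw [e1, ← lintegral_const_mul' _ _ ENNReal.ofReal_ne_top]
  calc ∫⁻ h : E, ENNReal.ofReal L * volume (X ∩ (fun x => x + h) ⁻¹' Y)
      ≤ ∫⁻ h : E, (ball (0 : E) (2 * R)).indicator (fun _ =>
        ENNReal.ofReal (2 * R) * ∫⁻ x in ball x₀ R, ‖gradient v x‖ₑ) h := by
        refine lintegral_mono fun h => ?_
        by_cases hh : h ∈ ball (0 : E) (2 * R)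
        · rw [indicator_of_mem hh]
          set S := X ∩ (fun x => x + h) ⁻¹' Y with hS
          have h1 := lintegral_translate_sub_le isOpen_ball hv measurableSet_ball Subset.rfl h
            (S := S) fun x hx t ht => by
              have : x + t • h = (1 - t) • x + t • (x + h) := by
                rw [smul_add, sub_smul, one_smul]; abel
              rw [this]
              exact (convex_ball x₀ R) (hX hx.1) (hY hx.2) (by linarith [ht.2]) ht.1 (by ring)
          have h2 : ENNReal.ofReal L * volume S ≤ ∫⁻ x in S, ‖v (x + h) - v x‖ₑ := by
            rw [← setLIntegral_const]
            refine setLIntegral_mono' (mX.inter ((measurable_add_const h) mY)) fun x hx => ?_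
            rw [← ofReal_norm]
            exact ENNReal.ofReal_le_ofReal (hL x hx.1 _ hx.2)
          refine h2.trans (h1.trans ?_)
          gcongr
          rw [← ofReal_norm]
          refine ENNReal.ofReal_le_ofReal ?_
          rw [mem_ball_zero_iff] at hh
          exact hh.le
        · have : X ∩ (fun x => x + h) ⁻¹' Y = ∅ := by
            rw [eq_empty_iff_forall_notMem]
            rintro x ⟨hx1, hx2⟩
            apply hh
            rw [mem_ball_zero_iff]
            have h1 := mem_ball_iff_norm.1 (hX hx1)
            have h2 := mem_ball_iff_norm.1 (hY hx2)
            have : h = (x + h - x₀) - (x - x₀) := by abel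
            rw [this]
            exact (norm_sub_le _ _).trans_lt (by linarith)
          rw [this]; simp
    _ = _ := by rw [lintegral_indicator_const measurableSet_ball, mul_comm]

end Translation

section Growth

open Module (finrank)

variable {E : Type*} [NormedAddCommGroup E] [InnerProductSpace ℝ E] [FiniteDimensional ℝ E]
  [MeasurableSpace E] [BorelSpace E] {p : ℝ} {Ω : Set E} {u : E → ℝ}

lemma volume_ball_eq (x : E) {R : ℝ} (hR : 0 < R) :
    volume (ball x R) = ENNReal.ofReal (R ^ finrank ℝ E * volume.real (ball (0 : E) 1)) := by
  rw [Measure.addHaar_ball_of_pos _ _ hR, ENNReal.ofReal_mul (by positivity), Measure.real,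
    ENNReal.ofReal_toReal measure_ball_lt_top.ne]

variable (E) in
lemma volume_real_ball_pos : 0 < volume.real (ball (0 : E) 1) :=
  ENNReal.toReal_pos (measure_ball_pos volume 0 one_pos).ne' measure_ball_lt_top.ne

omit [MeasurableSpace E] [BorelSpace E] in
lemma hasGradientAt_log (hΩ : IsOpen Ω) (hu : ContDiffOn ℝ 1 u Ω) {x : E} (hx : x ∈ Ω)
    (hpos : 0 < u x) : HasGradientAt (fun y => Real.log (u y)) ((u x)⁻¹ • gradient u x) x :=
  HasGradientAt.comp (Real.hasDerivAt_log hpos.ne') (hasGradientAt_of_contDiffOn hΩ hu hx)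

variable (E) in
lemma lintegral_gradient_log_le (hp : 1 < p) : ∃ C > 0, ∀ {u : E → ℝ} {x₀ : E} {r : ℝ}, 0 < r →
    IsPHarmonic p (ball x₀ (4 * r)) u → (∀ x ∈ ball x₀ (4 * r), 0 < u x) →
    ∫⁻ x in ball x₀ (7 / 2 * r), ‖gradient (fun y => Real.log (u y)) x‖ₑ ≤
      ENNReal.ofReal (C * (r ^ finrank ℝ E / r)) := by
  obtain ⟨C₀, hC₀, hcut⟩ := exists_cutoff E
  obtain ⟨C, hC, hlog⟩ := caccioppoli_log (E := E) hp
  have hp0 : 0 < p := by linarith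
  set d := finrank ℝ E with hd
  set ω := volume.real (ball (0 : E) 1) with hω
  have hω0 : 0 < ω := volume_real_ball_pos E
  refine ⟨(7 / 2) ^ d * ω + C * ((15 / 4) ^ d * ω * (4 * C₀) ^ p), by positivity, ?_⟩
  intro u x₀ r hr hu hpos
  obtain ⟨η, hη, hη0, hη1, hηa, hηb, hηg⟩ := hcut x₀ (7 / 2 * r) (15 / 4 * r) (by positivity)
    (by linarith)
  have hΩ : IsOpen (ball x₀ (4 * r)) := isOpen_ball
  have hts := tsupport_subset_closedBall hηb
  have hKΩ : closedBall x₀ (15 / 4 * r) ⊆ ball x₀ (4 * r) := closedBall_subset_ball (by linarith)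
  have hKc : IsCompact (closedBall x₀ (15 / 4 * r)) := isCompact_closedBall _ _
  have h1 := hlog hΩ hu hpos hη hη0 (hasCompactSupport_of_ball hηb) (hts.trans hKΩ)
  have h2 : ∫ x, ‖gradient η x‖ ^ p ≤
      ((15 / 4 * r) ^ d * ω) * (C₀ / (15 / 4 * r - 7 / 2 * r)) ^ p := by
    rw [← Measure.addHaar_real_closedBall volume x₀ (by positivity), ← smul_eq_mul,
      ← integral_indicator_const _ isClosed_closedBall.measurableSet]
    refine integral_mono ?_ ((integrable_indicator_iff isClosed_closedBall.measurableSet).2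
      (integrableOn_const hKc.measure_lt_top.ne)) fun x => ?_
    · refine ((continuous_gradient hη).norm.rpow_const fun _ => Or.inr
        hp0.le).integrable_of_hasCompactSupport (HasCompactSupport.intro hKc fun x hx => ?_)
      rw [gradient_eq_zero_of_notMem_tsupport (fun h => hx (hts h)), norm_zero,
        Real.zero_rpow hp0.ne']
    · by_cases hx : x ∈ closedBall x₀ (15 / 4 * r)
      · rw [indicator_of_mem hx]
        have := hηg x
        gcongr
      · rw [indicator_of_notMem hx, gradient_eq_zero_of_notMem_tsupport (fun h => hx (hts h)),
          norm_zero, Real.zero_rpow hp0.ne']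
  set F : E → ℝ := fun x => η x ^ p * u x ^ (-p) * ‖gradient u x‖ ^ p with hF
  have hF0 : ∀ x, 0 ≤ F x := fun x => by
    by_cases hx : x ∈ ball x₀ (4 * r)
    · have := hpos x hx; have := hη0 x; simp only [hF]; positivity
    · have : η x = 0 := hηb x fun h => hx (ball_subset_ball (by linarith) h)
      simp [hF, this, Real.zero_rpow hp0.ne']
  have hFi : Integrable F := by
    refine integrable_of_continuousOn_of_eq_zero hΩ hKc hKΩ ?_ fun x hx => ?_
    · exact ((hη.continuous.rpow_const fun _ => Or.inr hp0.le).continuousOn.mul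
        (hu.1.continuousOn.rpow_const fun x hx => Or.inl (hpos x hx).ne')).mul
        ((continuousOn_gradient hΩ hu.1).norm.rpow_const fun _ _ => Or.inr hp0.le)
    · simp [hF, hηb x (fun h => hx (ball_subset_closedBall h)), Real.zero_rpow hp0.ne']
  have hl : 0 < 1 / r := by positivity
  calc ∫⁻ x in ball x₀ (7 / 2 * r), ‖gradient (fun y => Real.log (u y)) x‖ₑ
      ≤ ∫⁻ x in ball x₀ (7 / 2 * r), (ENNReal.ofReal (1 / r) +
          ENNReal.ofReal ((1 / r) ^ (1 - p) * F x)) := by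
        refine setLIntegral_mono' measurableSet_ball fun x hx => ?_
        have hx4 : x ∈ ball x₀ (4 * r) := ball_subset_ball (by linarith) hx
        have hux := hpos x hx4
        rw [(hasGradientAt_log hΩ hu.1 hx4 hux).gradient, ← ofReal_norm, ← ENNReal.ofReal_add hl.le
          (mul_nonneg (by positivity) (hF0 x))]
        refine ENNReal.ofReal_le_ofReal ?_
        have := le_add_rpow_mul hp (norm_nonneg ((u x)⁻¹ • gradient u x)) hl
        refine this.trans (le_of_eq ?_)
        rw [hF]
        simp only [hηa x (ball_subset_closedBall hx), Real.one_rpow, one_mul]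
        rw [norm_smul, norm_inv, Real.norm_eq_abs, abs_of_pos hux, Real.mul_rpow (by positivity)
          (norm_nonneg _), Real.inv_rpow hux.le, Real.rpow_neg hux.le]
        ring
    _ ≤ ENNReal.ofReal (1 / r) * volume (ball x₀ (7 / 2 * r)) +
          ENNReal.ofReal (∫ x, (1 / r) ^ (1 - p) * F x) := by
        rw [lintegral_add_left measurable_const, setLIntegral_const]
        gcongr
        rw [ofReal_integral_eq_lintegral_ofReal (hFi.const_mul _)
          (Eventually.of_forall fun x => mul_nonneg (by positivity) (hF0 x))]
        exact setLIntegral_le_lintegral _ _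
    _ ≤ _ := by
        rw [volume_ball_eq _ (by positivity), ← ENNReal.ofReal_mul hl.le, ← ENNReal.ofReal_add
          (by positivity) (integral_nonneg fun x => mul_nonneg (by positivity) (hF0 x))]
        refine ENNReal.ofReal_le_ofReal ?_
        rw [integral_const_mul, ← hd, ← hω]
        have h3 : (1 / r) ^ (1 - p) * ∫ x, F x ≤ (1 / r) ^ (1 - p) *
            (C * (((15 / 4 * r) ^ d * ω) * (C₀ / (15 / 4 * r - 7 / 2 * r)) ^ p)) := by
          refine mul_le_mul_of_nonneg_left (h1.trans ?_) (by positivity)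
          gcongr
        have h4 : (1 / r) ^ (1 - p) * (C * (((15 / 4 * r) ^ d * ω) *
            (C₀ / (15 / 4 * r - 7 / 2 * r)) ^ p)) =
            C * ((15 / 4) ^ d * ω * (4 * C₀) ^ p) * (r ^ d / r) := by
          have e1 : C₀ / (15 / 4 * r - 7 / 2 * r) = (4 * C₀) * (1 / r) := by field_simp; ring
          rw [e1, Real.mul_rpow (by positivity) (by positivity), Real.rpow_sub hl, Real.rpow_one,
            mul_pow]
          field_simp
        have h5 : 1 / r * ((7 / 2 * r) ^ d * ω) = (7 / 2) ^ d * ω * (r ^ d / r) := by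
          rw [mul_pow]; ring
        linarith

variable (E) in
lemma growth_of_pos (hp : 1 < p) (hd : 2 ≤ finrank ℝ E) : ∃ c > 0, c < 1 ∧
    ∀ {u : E → ℝ} {x₀ : E} {r k : ℝ}, 0 < r →
    IsPHarmonic p (ball x₀ (4 * r)) u → (∀ x ∈ ball x₀ (4 * r), 0 < u x) → 0 < k →
    volume.real (ball x₀ r) / 2 ≤ volume.real {x | x ∈ ball x₀ r ∧ k ≤ u x} →
    ∀ x ∈ ball x₀ (2 * r), c * k ≤ u x := by
  obtain ⟨ν, hν, hDG⟩ := deGiorgi E hp hd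
  obtain ⟨C, hC, hlog⟩ := lintegral_gradient_log_le E hp
  set d := finrank ℝ E with hdd
  set ω := volume.real (ball (0 : E) 1) with hω
  have hω0 : 0 < ω := volume_real_ball_pos E
  set L := 2 * 7 ^ d * 7 * C / ν + 1 with hL
  have hL0 : 0 < L := by positivity
  set θ := Real.exp (-L) with hθ
  have hθ0 : 0 < θ := Real.exp_pos _
  have hθ1 : θ < 1 := Real.exp_lt_one_iff.2 (by linarith)
  refine ⟨θ / 2, by positivity, by linarith, ?_⟩
  intro u x₀ r k hr hu hpos hk hmeas x hx
  have hΩ : IsOpen (ball x₀ (4 * r)) := isOpen_ball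
  have hsub : closedBall x₀ (3 * r) ⊆ ball x₀ (4 * r) := closedBall_subset_ball (by linarith)
  have hco := hu.1.continuousOn
  set X : Set E := {x | x ∈ ball x₀ r ∧ k ≤ u x} with hX
  set Y : Set E := {x | x ∈ closedBall x₀ (3 * r) ∧ u x < θ * k} with hY
  have mX : MeasurableSet X := by
    have : X = ball x₀ r \ (ball x₀ (4 * r) ∩ u ⁻¹' Iio k) := by
      ext y
      simp only [hX, mem_ofPred_eq, Set.mem_sdiff, mem_inter_iff, mem_preimage, mem_Iio, not_and, not_lt]
      exact ⟨fun h => ⟨h.1, fun _ => h.2⟩, fun h => ⟨h.1, h.2 (ball_subset_ball (by linarith) h.1)⟩⟩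
    rw [this]
    exact measurableSet_ball.diff (hco.isOpen_inter_preimage hΩ isOpen_Iio).measurableSet
  have mY : MeasurableSet Y := by
    have : Y = closedBall x₀ (3 * r) ∩ (ball x₀ (4 * r) ∩ u ⁻¹' Iio (θ * k)) := by
      ext y
      simp only [hY, mem_ofPred_eq, mem_inter_iff, mem_preimage, mem_Iio]
      exact ⟨fun h => ⟨h.1, hsub h.1, h.2⟩, fun h => ⟨h.1, h.2.2⟩⟩
    rw [this]
    exact isClosed_closedBall.measurableSet.inter
      (hco.isOpen_inter_preimage hΩ isOpen_Iio).measurableSet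
  have finX : volume X ≠ ∞ := ((measure_mono fun y hy => hy.1).trans_lt
    (measure_ball_lt_top (x := x₀) (r := r))).ne
  have finY : volume Y ≠ ∞ := ((measure_mono fun y hy => hy.1).trans_lt
    (isCompact_closedBall x₀ (3 * r)).measure_lt_top).ne
  have hv : ContDiffOn ℝ 1 (fun y => Real.log (u y)) (ball x₀ (4 * r)) :=
    hu.1.log fun y hy => (hpos y hy).ne'
  have hpc := poincare_sets (R := 7 / 2 * r) (L := L)
    (hv.mono (ball_subset_ball (by linarith))) (X := X) (Y := Y)
    (fun y hy => ball_subset_ball (by linarith) hy.1)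
    (fun y hy => closedBall_subset_ball (by linarith) hy.1) mX mY fun y hy z hz => by
      have h1 : Real.log k ≤ Real.log (u y) := Real.log_le_log hk hy.2
      have hz4 := hpos z (hsub hz.1)
      have h2 : Real.log (u z) ≤ Real.log (θ * k) := Real.log_le_log hz4 hz.2.le
      rw [Real.log_mul hθ0.ne' hk.ne', hθ, Real.log_exp] at h2
      rw [abs_sub_comm]
      exact le_trans (by linarith) (le_abs_self _)
  have hpc2 := hpc.trans (mul_le_mul_right (mul_le_mul_right (hlog hr hu hpos) _) _)
  rw [volume_ball_eq _ (by positivity), ← ENNReal.ofReal_toReal finX, ← ENNReal.ofReal_toReal finY,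
    ← ENNReal.ofReal_mul ENNReal.toReal_nonneg, ← ENNReal.ofReal_mul hL0.le,
    ← ENNReal.ofReal_mul (by positivity), ← ENNReal.ofReal_mul (by positivity),
    ENNReal.ofReal_le_ofReal_iff (by positivity)] at hpc2
  change L * (volume.real X * volume.real Y) ≤ _ at hpc2
  rw [← hdd, ← hω] at hpc2
  have hXm : r ^ d * ω / 2 ≤ volume.real X := by
    refine le_trans (le_of_eq ?_) hmeas
    rw [Measure.real, volume_ball_eq _ hr, ENNReal.toReal_ofReal (by positivity)]
  have hYm : volume.real Y ≤ ν * r ^ d := by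
    have h0 : 0 ≤ volume.real Y := measureReal_nonneg
    have h1 : L * (r ^ d * ω / 2 * volume.real Y) ≤ L * (volume.real X * volume.real Y) := by gcongr
    have h2 := h1.trans hpc2
    have h3 : (2 * (7 / 2 * r)) ^ d * ω * (2 * (7 / 2 * r) * (C * (r ^ d / r))) =
        (r ^ d * ω / 2) * ((2 * 7 ^ d * 7 * C) * r ^ d) := by
      rw [show 2 * (7 / 2 * r) = 7 * r by ring, mul_pow]; field_simp
    have h4 : L * (r ^ d * ω / 2 * volume.real Y) = (r ^ d * ω / 2) * (L * volume.real Y) := by ring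
    rw [h3, h4] at h2
    have h5 := le_of_mul_le_mul_left h2 (by positivity)
    have h6 : 2 * 7 ^ d * 7 * C = (L - 1) * ν := by rw [hL]; field_simp; ring
    rw [h6] at h5
    have h7 : (L - 1) * ν * r ^ d ≤ L * (ν * r ^ d) := by
      have : 0 ≤ ν * r ^ d := by positivity
      linarith
    exact le_of_mul_le_mul_left (h5.trans h7) hL0
  have := hDG hΩ hu hpos x₀ r (θ * k) hr (by positivity) hsub hYm x hx
  linarith

variable (E) in
/-- Growth lemma: a nonnegative `p`-harmonic function that is at least `k` on half of a ball is at
least `c * k` on the doubled ball. -/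
lemma growth (hp : 1 < p) (hd : 2 ≤ finrank ℝ E) : ∃ c > 0, c < 1 ∧
    ∀ {u : E → ℝ} {x₀ : E} {r k : ℝ}, 0 < r →
    IsPHarmonic p (ball x₀ (4 * r)) u → (∀ x ∈ ball x₀ (4 * r), 0 ≤ u x) → 0 < k →
    volume.real (ball x₀ r) / 2 ≤ volume.real {x | x ∈ ball x₀ r ∧ k ≤ u x} →
    ∀ x ∈ ball x₀ (2 * r), c * k ≤ u x := by
  obtain ⟨c, hc0, hc1, h⟩ := growth_of_pos E hp hd
  refine ⟨c, hc0, hc1, fun {u x₀ r k} hr hu hpos hk hmeas x hx => ?_⟩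
  refine le_of_forall_pos_le_add fun ε hε => ?_
  refine h hr (hu.add_const ε) (fun y hy => by linarith [hpos y hy]) hk (hmeas.trans ?_) x hx
  exact measureReal_mono (fun y hy => ⟨hy.1, by linarith [hy.2]⟩)
    ((measure_mono fun y hy => hy.1).trans_lt (measure_ball_lt_top (x := x₀) (r := r))).ne

end Growth

section Sphere

open Module (finrank)

variable {E : Type*} [NormedAddCommGroup E] [InnerProductSpace ℝ E] [FiniteDimensional ℝ E]

lemma exists_unit_orthogonal (hd : 2 ≤ finrank ℝ E) (x : E) : ∃ e : E, ‖e‖ = 1 ∧ ⟪x, e⟫ = 0 := by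
  have h1 := Submodule.finrank_add_finrank_orthogonal (ℝ ∙ x)
  have h2 : finrank ℝ (ℝ ∙ x) ≤ 1 := by
    simpa using finrank_span_le_card (R := ℝ) ({x} : Set E)
  have h3 : 0 < finrank ℝ (ℝ ∙ x)ᗮ := by omega
  have := Module.nontrivial_of_finrank_pos h3
  obtain ⟨w, hw⟩ := exists_ne (0 : (ℝ ∙ x)ᗮ)
  have hw0 : (w : E) ≠ 0 := fun h => hw (Subtype.ext h)
  refine ⟨(‖(w : E)‖)⁻¹ • (w : E), norm_smul_inv_norm (𝕜 := ℝ) hw0, ?_⟩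
  rw [inner_smul_right, Submodule.mem_orthogonal_singleton_iff_inner_right.1 w.2, mul_zero]

lemma exists_angle_decomposition (hd : 2 ≤ finrank ℝ E) {r : ℝ} (hr : 0 < r) {x y : E}
    (hx : ‖x‖ = r) (hy : ‖y‖ = r) : ∃ (e : E) (θ : ℝ), ‖e‖ = 1 ∧ ⟪x, e⟫ = 0 ∧ 0 ≤ θ ∧
      θ ≤ Real.pi ∧ y = Real.cos θ • x + (Real.sin θ * r) • e := by
  set c := ⟪x, y⟫ / r ^ 2 with hc
  set w := y - c • x with hw
  have hxx : ⟪x, x⟫ = r ^ 2 := by rw [real_inner_self_eq_norm_sq, hx]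
  have hyy : ⟪y, y⟫ = r ^ 2 := by rw [real_inner_self_eq_norm_sq, hy]
  have hxy : ⟪x, y⟫ = c * r ^ 2 := by rw [hc]; field_simp
  have hxw : ⟪x, w⟫ = 0 := by
    rw [hw, inner_sub_right, inner_smul_right, hxx, hxy]; ring
  have hww : ‖w‖ ^ 2 = (1 - c ^ 2) * r ^ 2 := by
    rw [← real_inner_self_eq_norm_sq, hw, inner_sub_left, inner_sub_right, inner_sub_right,
      inner_smul_right, inner_smul_left, inner_smul_left, inner_smul_right, hxx, hyy,
      real_inner_comm, hxy]
    simp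
    ring
  have hc2 : c ^ 2 ≤ 1 := by
    have h1 : 0 ≤ (1 - c ^ 2) * r ^ 2 := hww ▸ sq_nonneg _
    have := nonneg_of_mul_nonneg_left h1 (by positivity)
    linarith
  have hcm : -1 ≤ c := by nlinarith
  have hcM : c ≤ 1 := by nlinarith
  have hs : ‖w‖ = Real.sin (Real.arccos c) * r := by
    rw [Real.sin_arccos, ← Real.sqrt_sq (norm_nonneg w), hww, Real.sqrt_mul' _ (by positivity),
      Real.sqrt_sq hr.le]
  have hyw : y = c • x + w := by rw [hw]; abel
  by_cases hw0 : w = 0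
  · obtain ⟨e, he, hxe⟩ := exists_unit_orthogonal hd x
    refine ⟨e, Real.arccos c, he, hxe, Real.arccos_nonneg _, Real.arccos_le_pi _, ?_⟩
    rw [← hs, hw0, norm_zero, zero_smul, Real.cos_arccos hcm hcM]
    rw [hw0] at hyw; exact hyw
  · refine ⟨(‖w‖)⁻¹ • w, Real.arccos c, norm_smul_inv_norm (𝕜 := ℝ) hw0, ?_,
      Real.arccos_nonneg _, Real.arccos_le_pi _, ?_⟩
    · rw [inner_smul_right, hxw, mul_zero]
    · rw [← hs, smul_smul, mul_inv_cancel₀ (norm_ne_zero_iff.2 hw0), one_smul,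
        Real.cos_arccos hcm hcM]
      exact hyw

/-- Points of a sphere are joined by a chain of controlled length along a great circle. -/
lemma exists_sphere_chain (hd : 2 ≤ finrank ℝ E) {r : ℝ} (hr : 0 < r) {x y : E}
    (hx : ‖x‖ = r) (hy : ‖y‖ = r) : ∃ z : ℕ → E, z 0 = x ∧ z 128 = y ∧ (∀ i, ‖z i‖ = r) ∧
      ∀ i, ‖z (i + 1) - z i‖ ≤ r / 32 := by
  obtain ⟨e, θ, he, hxe, hθ0, hθπ, hyθ⟩ := exists_angle_decomposition hd hr hx hy
  set z : ℕ → E := fun i => Real.cos (i * (θ / 128)) • x + (Real.sin (i * (θ / 128)) * r) • e with hz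
  have hn : ∀ a b : ℝ, ‖a • x + (b * r) • e‖ ^ 2 = (a ^ 2 + b ^ 2) * r ^ 2 := fun a b => by
    rw [norm_add_sq_real, inner_smul_left, inner_smul_right, hxe, norm_smul, norm_smul, he, hx,
      mul_pow, Real.norm_eq_abs, sq_abs, Real.norm_eq_abs, mul_one, sq_abs]
    simp
    ring
  refine ⟨z, by simp [hz], ?_, fun i => ?_, fun i => ?_⟩
  · rw [hyθ, hz]
    have : ((128 : ℕ) : ℝ) * (θ / 128) = θ := by push_cast; ring
    simp only [this]
  · have h := hn (Real.cos (i * (θ / 128))) (Real.sin (i * (θ / 128)))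
    rw [Real.cos_sq_add_sin_sq, one_mul] at h
    exact (sq_eq_sq₀ (norm_nonneg _) hr.le).1 h
  · set a := ((i + 1 : ℕ) : ℝ) * (θ / 128) with ha
    set b := (i : ℝ) * (θ / 128) with hb
    have hab : a - b = θ / 128 := by rw [ha, hb]; push_cast; ring
    have h1 : z (i + 1) - z i = (Real.cos a - Real.cos b) • x +
        ((Real.sin a - Real.sin b) * r) • e := by
      simp only [hz, ← ha, ← hb, sub_smul, sub_mul]; abel
    have h2 := hn (Real.cos a - Real.cos b) (Real.sin a - Real.sin b)
    rw [← h1] at h2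
    have h3 : (Real.cos a - Real.cos b) ^ 2 + (Real.sin a - Real.sin b) ^ 2 ≤ (1 / 32) ^ 2 := by
      have h4 := Real.cos_sub a b
      have h5 := Real.one_sub_sq_div_two_le_cos (x := a - b)
      have h6 := Real.cos_sq_add_sin_sq a
      have h7 := Real.cos_sq_add_sin_sq b
      have h8 : (a - b) ^ 2 ≤ (1 / 32) ^ 2 := by
        rw [hab]
        have : θ / 128 ≤ 1 / 32 := by linarith [Real.pi_le_four]
        gcongr
      nlinarith
    have h4 : ‖z (i + 1) - z i‖ ^ 2 ≤ (r / 32) ^ 2 := by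
      rw [h2]
      calc _ ≤ (1 / 32) ^ 2 * r ^ 2 := by gcongr
        _ = _ := by ring
    exact (sq_le_sq₀ (norm_nonneg _) (by positivity)).1 h4

end Sphere

section Harnack

open Module (finrank)

variable {E : Type*} [NormedAddCommGroup E] [InnerProductSpace ℝ E] [FiniteDimensional ℝ E]
  [MeasurableSpace E] [BorelSpace E] {p : ℝ} {Ω : Set E} {u : E → ℝ}

lemma half_volume_or {x : E} {s : ℝ} (P Q : E → Prop) (h : ∀ y ∈ ball x s, P y ∨ Q y) :
    volume.real (ball x s) / 2 ≤ volume.real {y | y ∈ ball x s ∧ P y} ∨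
      volume.real (ball x s) / 2 ≤ volume.real {y | y ∈ ball x s ∧ Q y} := by
  by_contra! hcon
  have hfin : ∀ R : E → Prop, volume {y | y ∈ ball x s ∧ R y} ≠ ∞ := fun R =>
    ((measure_mono fun y hy => hy.1).trans_lt (measure_ball_lt_top (x := x) (r := s))).ne
  have hsub : ball x s ⊆ {y | y ∈ ball x s ∧ P y} ∪ {y | y ∈ ball x s ∧ Q y} := fun y hy =>
    (h y hy).imp (fun h => ⟨hy, h⟩) (fun h => ⟨hy, h⟩)
  have h1 := measureReal_mono hsub (measure_union_ne_top (hfin P) (hfin Q))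
  have h2 := h1.trans (measureReal_union_le _ _)
  linarith [hcon.1, hcon.2]

lemma IsPHarmonic.sub_const (h : IsPHarmonic p Ω u) (m : ℝ) : IsPHarmonic p Ω (fun x => u x - m) := by
  simpa [sub_eq_add_neg] using h.add_const (-m)

lemma IsPHarmonic.const_sub (h : IsPHarmonic p Ω u) (m : ℝ) : IsPHarmonic p Ω (fun x => m - u x) := by
  simpa [sub_eq_neg_add] using h.neg.add_const m

variable (E) in
lemma oscillation_decay (hp : 1 < p) (hd : 2 ≤ finrank ℝ E) : ∃ θ > 0, θ < 1 ∧
    ∀ (n : ℕ) {u : E → ℝ} {x : E} {R m M : ℝ}, 0 < R → IsPHarmonic p (ball x R) u →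
    (∀ y ∈ ball x R, m ≤ u y) → (∀ y ∈ ball x R, u y ≤ M) →
    ∀ y ∈ ball x (R / 2 ^ n), |u y - u x| ≤ θ ^ n * (M - m) := by
  obtain ⟨c, hc0, hc1, hgrow⟩ := growth E hp hd
  refine ⟨1 - c / 2, by linarith, by linarith, fun n => ?_⟩
  induction n with
  | zero =>
    intro u x R m M hR hu hm hM y hy
    rw [pow_zero, div_one] at hy
    have hx : x ∈ ball x R := mem_ball_self hR
    rw [pow_zero, one_mul, abs_le]
    constructor <;> linarith [hm y hy, hM y hy, hm x hx, hM x hx]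
  | succ n ih =>
    intro u x R m M hR hu hm hM y hy
    have hR4 : 4 * (R / 4) = R := by ring
    have hR2 : 2 * (R / 4) = R / 2 := by ring
    have hsub : ball x (R / 2) ⊆ ball x R := ball_subset_ball (by linarith)
    have hy' : y ∈ ball x (R / 2 / 2 ^ n) := by
      rwa [div_div, ← pow_succ']
    have hθ0 : 0 ≤ (1 - c / 2) ^ n := pow_nonneg (by linarith) _
    have hxb : x ∈ ball x R := mem_ball_self hR
    rcases eq_or_lt_of_le ((hm x hxb).trans (hM x hxb)) with hmM | hmM
    · have hyb : y ∈ ball x R := ball_subset_ball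
        (div_le_self hR.le (one_le_pow₀ one_le_two)) hy
      have e1 : u y = u x := le_antisymm ((hM y hyb).trans (hmM ▸ hm x hxb))
        ((hM x hxb).trans (hmM ▸ hm y hyb))
      rw [e1, hmM]; simp
    · have hk : 0 < (M - m) / 2 := by linarith
      rcases half_volume_or (x := x) (s := R / 4) (fun z => (M - m) / 2 ≤ u z - m)
        (fun z => (M - m) / 2 ≤ M - u z) (fun z _ => by
          by_cases h : (M - m) / 2 ≤ u z - m
          · exact Or.inl h
          · exact Or.inr (by linarith)) with h | h
      · have hg := hgrow (u := fun z => u z - m) (by positivity : 0 < R / 4)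
          (by rw [hR4]; exact hu.sub_const m) (by rw [hR4]; intro z hz; linarith [hm z hz]) hk h
        rw [hR2] at hg
        have := ih (half_pos hR) (hu.mono hsub) (m := m + c * ((M - m) / 2)) (M := M)
          (fun z hz => by linarith [hg z hz]) (fun z hz => hM z (hsub hz)) y hy'
        rw [pow_succ, mul_assoc]
        refine this.trans (mul_le_mul_of_nonneg_left (le_of_eq ?_) hθ0)
        ring
      · have hg := hgrow (u := fun z => M - u z) (by positivity : 0 < R / 4)
          (by rw [hR4]; exact hu.const_sub M) (by rw [hR4]; intro z hz; linarith [hM z hz]) hk h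
        rw [hR2] at hg
        have := ih (half_pos hR) (hu.mono hsub) (m := m) (M := M - c * ((M - m) / 2))
          (fun z hz => hm z (hsub hz)) (fun z hz => by linarith [hg z hz]) y hy'
        rw [pow_succ, mul_assoc]
        refine this.trans (mul_le_mul_of_nonneg_left (le_of_eq ?_) hθ0)
        ring

variable (E) in
/-- The Harnack inequality on balls. -/
lemma harnack_ball (hp : 1 < p) (hd : 2 ≤ finrank ℝ E) : ∃ C ≥ 1, ∀ {u : E → ℝ} {x : E} {ρ : ℝ},
    0 < ρ → IsPHarmonic p (ball x (16 * ρ)) u → (∀ y ∈ ball x (16 * ρ), 0 ≤ u y) →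
    ∀ y ∈ ball x ρ, u x ≤ C * u y := by
  obtain ⟨c, hc0, hc1, hgrow⟩ := growth E hp hd
  have hfull : ∀ {u : E → ℝ} {x₀ : E} {r k : ℝ}, 0 < r →
      IsPHarmonic p (ball x₀ (4 * r)) u → (∀ x ∈ ball x₀ (4 * r), 0 ≤ u x) → 0 < k →
      (∀ x ∈ ball x₀ r, k ≤ u x) → ∀ x ∈ ball x₀ (2 * r), c * k ≤ u x := by
    intro u x₀ r k hr hu h0 hk hkb
    refine hgrow hr hu h0 hk ?_
    have : {x | x ∈ ball x₀ r ∧ k ≤ u x} = ball x₀ r := by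
      ext y; exact ⟨fun h => h.1, fun h => ⟨h, hkb y h⟩⟩
    rw [this]
    have : 0 ≤ volume.real (ball x₀ r) := measureReal_nonneg
    linarith
  obtain ⟨l, hl⟩ : ∃ l : ℕ, (1 / 2 : ℝ) ^ l < c := exists_pow_lt_of_lt_one hc0 (by norm_num)
  have hl0 : 0 < l := by
    rcases Nat.eq_zero_or_pos l with h | h
    · rw [h, pow_zero] at hl; linarith
    · exact h
  have hl1 : (1 : ℝ) ≤ l := by exact_mod_cast hl0
  set ε := c / (4 * l) with hε
  have hε0 : 0 < ε := by positivity
  have hε1 : ε < 1 := by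
    rw [hε, div_lt_one (by positivity)]; linarith
  have hlε : l * ε = c / 4 := by rw [hε]; field_simp
  have hbern : 1 - c / 4 ≤ (1 - ε) ^ l := by
    have := one_add_mul_le_pow (a := -ε) (by linarith) l
    rw [← sub_eq_add_neg] at this
    linarith
  set C := 2 / (c ^ 2 * (ε / 4) ^ l) with hC
  have hCpos : 0 < C := by positivity
  have hC1 : 1 ≤ C := by
    rw [hC, le_div_iff₀ (by positivity)]
    have h1 : c ^ 2 ≤ 1 := pow_le_one₀ hc0.le hc1.le
    have h2 : (ε / 4) ^ l ≤ 1 := pow_le_one₀ (by positivity) (by linarith)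
    have h3 : c ^ 2 * (ε / 4) ^ l ≤ 1 := mul_le_one₀ h1 (by positivity) h2
    linarith
  refine ⟨C, hC1, ?_⟩
  intro u x ρ hρ hu hu0 y hy
  have hsub9 : ∀ z ∈ closedBall x ρ, ∀ t ≤ 8 * ρ, ball z t ⊆ ball x (16 * ρ) := fun z hz t ht =>
    ball_subset_ball' (by rw [mem_closedBall] at hz; linarith)
  have hco : ContinuousOn u (closedBall x ρ) := hu.1.continuousOn.mono
    (closedBall_subset_ball (by linarith))
  obtain ⟨X, hX, hmax⟩ := (isCompact_closedBall x ρ).exists_isMaxOn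
    (nonempty_closedBall.2 hρ.le)
    (hco.mul ((continuousOn_const (c := ρ)).sub ((continuous_dist.comp
      (continuous_id.prodMk continuous_const)).continuousOn (s := closedBall x ρ)) |>.pow l)
      : ContinuousOn (fun z => u z * (ρ - dist z x) ^ l) (closedBall x ρ))
  set D := ρ - dist X x with hD
  set N := u X with hN
  have hXd := mem_closedBall.1 hX
  have hux : u x * ρ ^ l ≤ N * D ^ l := by
    have := hmax (mem_closedBall_self hρ.le)
    simpa using this
  have hyΩ : y ∈ ball x (16 * ρ) := ball_subset_ball (by linarith) hy
  rcases le_or_gt (u x) 0 with hux0 | hux0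
  · exact hux0.trans (mul_nonneg hCpos.le (hu0 y hyΩ))
  have hD0' : 0 ≤ D := by linarith
  have hND : 0 < N * D ^ l := (by positivity : 0 < u x * ρ ^ l).trans_le hux
  have hD0 : 0 < D := by
    rcases eq_or_lt_of_le hD0' with h | h
    · rw [← h, zero_pow hl0.ne', mul_zero] at hND; exact absurd hND (lt_irrefl 0)
    · exact h
  have hN0 : 0 < N := pos_of_mul_pos_left hND (by positivity)
  have hDρ : D ≤ ρ := by linarith [dist_nonneg (x := X) (y := x)]
  set s := ε * D / 4 with hs
  have hs0 : 0 < s := by positivity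
  have h4s : 4 * s = ε * D := by rw [hs]; ring
  have hεD : ε * D ≤ D := mul_le_of_le_one_left hD0' hε1.le
  have hε1' : 0 < (1 - ε) ^ l := pow_pos (by linarith) _
  set M := N / (1 - ε) ^ l with hM
  have hMu : ∀ z ∈ ball X (4 * s), u z ≤ M := fun z hz => by
    rw [h4s, mem_ball] at hz
    have htri := dist_triangle z X x
    have hz1 : z ∈ closedBall x ρ := by rw [mem_closedBall]; linarith
    have h1 : u z * (ρ - dist z x) ^ l ≤ N * D ^ l := hmax hz1
    have h2 : (1 - ε) * D ≤ ρ - dist z x := by linarith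
    have h3 : ((1 - ε) * D) ^ l ≤ (ρ - dist z x) ^ l :=
      pow_le_pow_left₀ (mul_nonneg (by linarith) hD0') h2 l
    have huz : 0 ≤ u z := hu0 z (closedBall_subset_ball (by linarith) hz1)
    have h4 := (mul_le_mul_of_nonneg_left h3 huz).trans h1
    rw [mul_pow, ← mul_assoc] at h4
    rw [hM, le_div_iff₀ hε1']
    exact le_of_mul_le_mul_right h4 (by positivity)
  have hball : ball X (4 * s) ⊆ ball x (16 * ρ) := hsub9 X hX _ (by linarith)
  have hMN : M - N < c * (N / 2) := by
    have h1 : M ≤ N / (1 - c / 4) := by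
      rw [hM]; exact div_le_div_of_nonneg_left hN0.le (by linarith) hbern
    have h2 : N / (1 - c / 4) < N + c * (N / 2) := by
      rw [div_lt_iff₀ (by linarith)]
      nlinarith [mul_pos hN0 hc0, mul_pos (mul_pos hN0 hc0) (by linarith : 0 < 1 - c)]
    linarith
  have hNM : N ≤ M := hMu X (mem_ball_self (by positivity))
  have hhalf : volume.real (ball X s) / 2 ≤ volume.real {z | z ∈ ball X s ∧ N / 2 ≤ u z} := by
    rcases half_volume_or (x := X) (s := s) (fun z => N / 2 ≤ u z) (fun z => N / 2 ≤ M - u z)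
      (fun z _ => by
        by_cases h : N / 2 ≤ u z
        · exact Or.inl h
        · exact Or.inr (by linarith)) with h | h
    · exact h
    · have := hgrow (u := fun z => M - u z) hs0 ((hu.mono hball).const_sub M)
        (fun z hz => by linarith [hMu z hz]) (by positivity) h X (mem_ball_self (by positivity))
      linarith
  have hexp : ∀ n : ℕ, 4 * (2 ^ n * s) ≤ 8 * ρ →
      ∀ z ∈ ball X (2 * (2 ^ n * s)), c ^ (n + 1) * (N / 2) ≤ u z := fun n => by
    induction n with
    | zero =>
      intro _
      have := hgrow hs0 (hu.mono hball) (fun z hz => hu0 z (hball hz)) (by positivity) hhalf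
      simpa using this
    | succ n ih =>
      intro hn
      have h0 : 0 < 2 ^ n * s := by positivity
      have e : 2 * (2 ^ n * s) = 2 ^ (n + 1) * s := by rw [pow_succ]; ring
      have h1 := ih (by rw [← e] at hn; linarith)
      rw [e] at h1
      have hb := hsub9 X hX _ hn
      have := hfull (by positivity : 0 < 2 ^ (n + 1) * s) (hu.mono hb)
        (fun z hz => hu0 z (hb hz)) (by positivity) h1
      rw [pow_succ' c (n + 1), mul_assoc]
      exact this
  have hsρ : 1 ≤ ρ / s := by rw [one_le_div hs0]; linarith
  obtain ⟨n, hn1, hn2⟩ := exists_nat_pow_near hsρ one_lt_two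
  rw [le_div_iff₀ hs0] at hn1
  rw [div_lt_iff₀ hs0] at hn2
  have hfin := hexp (n + 1) (by rw [pow_succ]; linarith) y (by
    have h1 := dist_triangle y x X
    rw [dist_comm x X] at h1
    have h2 := mem_ball.1 hy
    rw [mem_ball]; linarith)
  have hcn : (s / ρ) ^ l ≤ c ^ n := by
    calc (s / ρ) ^ l ≤ ((1 / 2) ^ n) ^ l := by
          gcongr
          rw [one_div, inv_pow, div_le_iff₀ hρ, ← div_eq_inv_mul, le_div_iff₀ (by positivity)]
          linarith
      _ = ((1 / 2) ^ l) ^ n := by rw [← pow_mul, ← pow_mul, mul_comm]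
      _ ≤ c ^ n := by gcongr
  have h1 : c ^ 2 * (s / ρ) ^ l * (N / 2) ≤ u y := by
    refine le_trans ?_ hfin
    rw [show n + 1 + 1 = 2 + n by ring, pow_add]
    gcongr
  have h2 : s / ρ = ε / 4 * (D / ρ) := by rw [hs]; ring
  rw [h2, mul_pow] at h1
  have h3 : u x ≤ N * (D / ρ) ^ l := by
    rw [div_pow, ← mul_div_assoc, le_div_iff₀ (by positivity)]
    exact hux
  rw [hC, div_mul_eq_mul_div, le_div_iff₀ (by positivity)]
  have h4 := mul_le_mul_of_nonneg_left h3 (by positivity : 0 ≤ c ^ 2 * (ε / 4) ^ l)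
  linarith

variable (E) in
/-- The Harnack inequality on spheres around an isolated singularity. -/
lemma harnack_sphere (hp : 1 < p) (hd : 2 ≤ finrank ℝ E) : ∃ C ≥ 1, ∀ {u : E → ℝ} {R : ℝ},
    IsPHarmonic p (ball (0 : E) R \ {0}) u → (∀ y ∈ ball (0 : E) R \ {0}, 0 ≤ u y) →
    ∀ {x y : E}, 0 < ‖x‖ → ‖x‖ = ‖y‖ → 2 * ‖x‖ ≤ R → u x ≤ C * u y := by
  obtain ⟨C, hC, h⟩ := harnack_ball E hp hd
  refine ⟨C ^ 128, one_le_pow₀ hC, ?_⟩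
  intro u R hu hu0 x y hx0 hxy hxR
  obtain ⟨z, hz0, hz1, hzr, hzd⟩ := exists_sphere_chain hd hx0 rfl hxy.symm
  have key : ∀ n : ℕ, u x ≤ C ^ n * u (z n) := fun n => by
    induction n with
    | zero => simp [hz0]
    | succ n ih =>
      have hsub : ball (z n) (16 * (‖x‖ / 16)) ⊆ ball (0 : E) R \ {0} := fun w hw => by
        rw [mem_ball_iff_norm] at hw
        have e : 16 * (‖x‖ / 16) = ‖x‖ := by ring
        rw [e] at hw
        refine ⟨?_, ?_⟩
        · rw [mem_ball_zero_iff]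
          have := norm_add_le (w - z n) (z n)
          rw [sub_add_cancel, hzr] at this
          linarith
        · rintro (rfl : w = 0)
          rw [zero_sub, norm_neg, hzr] at hw
          exact lt_irrefl _ hw
      have := h (by positivity : 0 < ‖x‖ / 16) (hu.mono hsub) (fun w hw => hu0 w (hsub hw))
        (z (n + 1)) (by rw [mem_ball_iff_norm]; linarith [hzd n])
      calc u x ≤ C ^ n * u (z n) := ih
        _ ≤ C ^ n * (C * u (z (n + 1))) := by gcongr
        _ = _ := by ring
  have := key 128
  rwa [hz1] at this

end Harnack

section Comparison

open Module (finrank)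

variable {E : Type*} [NormedAddCommGroup E] [InnerProductSpace ℝ E] [FiniteDimensional ℝ E]
  [MeasurableSpace E] [BorelSpace E] {p : ℝ} {Ω : Set E} {u : E → ℝ}

lemma contDiff_sq_pos_part (k : ℝ) : ContDiff ℝ 1 fun s : ℝ => max (k - s) 0 ^ 2 := by
  rw [contDiff_one_iff_deriv]
  refine ⟨fun s => (hasDerivAt_sq_pos_part k s).differentiableAt, ?_⟩
  rw [show deriv (fun s : ℝ => max (k - s) 0 ^ 2) = fun s => -(2 * max (k - s) 0) from
    funext fun s => (hasDerivAt_sq_pos_part k s).deriv]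
  fun_prop

omit [MeasurableSpace E] [BorelSpace E] in
lemma eq_zero_of_gradient_eq_zero [Nontrivial E] {f : E → ℝ} (hf : ContDiff ℝ 1 f)
    (hc : HasCompactSupport f) (h : ∀ x, gradient f x = 0) (x : E) : f x = 0 := by
  have hne : NoncompactSpace E := NormedSpace.noncompactSpace ℝ E
  have hfd : ∀ x, fderiv ℝ f x = 0 := fun x => by
    rw [← norm_eq_zero, ← norm_gradient, h x, norm_zero]
  have hex : ∃ y, y ∉ tsupport f := by
    by_contra! hall
    exact noncompact_univ E (by rwa [HasCompactSupport, eq_univ_of_forall hall] at hc)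
  obtain ⟨y, hy⟩ := hex
  rw [is_const_of_fderiv_eq_zero (hf.differentiable (by simp)) hfd x y,
    image_eq_zero_of_notMem_tsupport hy]

/-- The comparison principle. -/
lemma comparison [Nontrivial E] (hp : 1 < p) {D : Set E} {w : E → ℝ} (hΩ : IsOpen Ω) (hD : IsOpen D)
    (hDc : IsCompact (closure D)) (hDΩ : closure D ⊆ Ω) (hu : IsPHarmonic p Ω u)
    (hw : IsPHarmonic p Ω w) (h : ∀ x ∈ frontier D, u x ≤ w x) : ∀ x ∈ D, u x ≤ w x := by
  classical
  intro x₀ hx₀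
  by_contra! hlt
  set ε := (u x₀ - w x₀) / 2 with hε
  have hε0 : 0 < ε := by rw [hε]; linarith
  set m : E → ℝ := fun x => max (-ε - (w x - u x)) 0 with hm
  set ψ : E → ℝ := fun x => if x ∈ D then m x ^ 2 else 0 with hψ
  set K := {x ∈ closure D | ε ≤ u x - w x} with hK
  have hcl : IsClosed K := by
    have := ((hu.1.continuousOn.sub hw.1.continuousOn).mono hDΩ).preimage_isClosed_of_isClosed
      isClosed_closure (isClosed_Ici (a := ε))
    exact this
  have hKc : IsCompact K := hDc.of_isClosed_subset hcl fun x hx => hx.1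
  have hKD : K ⊆ D := fun x hx => by
    by_contra hxD
    have : x ∈ frontier D := ⟨hx.1, by rwa [hD.interior_eq]⟩
    linarith [h x this, hx.2]
  have hDO : D ⊆ Ω := subset_closure.trans hDΩ
  have hm0 : ∀ x ∈ D, x ∉ K → m x = 0 := fun x hxD hxK => by
    have : u x - w x < ε := by
      by_contra! hh
      exact hxK ⟨subset_closure hxD, hh⟩
    exact max_eq_right (by linarith)
  have hψ0 : ∀ x ∉ K, ψ x = 0 := fun x hx => by
    by_cases hxD : x ∈ D
    · simp only [hψ, if_pos hxD, hm0 x hxD hx]; simp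
    · simp only [hψ, if_neg hxD]
  have hψD : ContDiffOn ℝ 1 ψ D := by
    have : ContDiffOn ℝ 1 (fun x => m x ^ 2) D :=
      (contDiff_sq_pos_part (-ε)).comp_contDiffOn ((hw.1.sub hu.1).mono hDO)
    exact this.congr fun x hx => by simp only [hψ, if_pos hx]
  have hψc : ContDiff ℝ 1 ψ := contDiff_of_contDiffOn_of_eq_zero hD hcl hKD hψD hψ0
  have hts : tsupport ψ ⊆ K := closure_minimal (fun x hx => by
    by_contra hh; exact hx (hψ0 x hh)) hcl
  have hcs : HasCompactSupport ψ := hKc.of_isClosed_subset (isClosed_tsupport ψ) hts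
  have hgrad : ∀ x ∈ D, gradient ψ x = (2 * m x) • (gradient u x - gradient w x) := fun x hx => by
    have h1 := HasGradientAt.comp (f := fun x => w x - u x)
      (hasDerivAt_sq_pos_part (-ε) (w x - u x)) (HasGradientAt.sub (hasGradientAt_of_contDiffOn hΩ hw.1 (hDO hx))
        (hasGradientAt_of_contDiffOn hΩ hu.1 (hDO hx)))
    have h2 : ψ =ᶠ[𝓝 x] fun x => m x ^ 2 := by
      filter_upwards [hD.mem_nhds hx] with y hy
      simp only [hψ, if_pos hy]
    rw [h2.gradient_eq, h1.gradient, neg_smul, ← smul_neg, neg_sub]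
  have hg0 : ∀ x ∉ K, gradient ψ x = 0 := fun x hx =>
    gradient_eq_zero_of_notMem_tsupport fun hh => hx (hts hh)
  have hA : ∀ {v : E → ℝ}, IsPHarmonic p Ω v →
      ContinuousOn (fun x => ⟪pflux p (gradient v x), gradient ψ x⟫) Ω := fun hv =>
    ((continuous_pflux hp).comp_continuousOn (continuousOn_gradient hΩ hv.1)).inner
      (continuous_gradient hψc).continuousOn
  have hI : ∀ {v : E → ℝ}, IsPHarmonic p Ω v →
      Integrable fun x => ⟪pflux p (gradient v x), gradient ψ x⟫ := fun hv =>
    integrable_of_continuousOn_of_eq_zero hΩ hKc (hKD.trans hDO) (hA hv) fun x hx => by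
      rw [hg0 x hx, inner_zero_right]
  set F : E → ℝ := fun x => ⟪pflux p (gradient u x), gradient ψ x⟫ -
    ⟪pflux p (gradient w x), gradient ψ x⟫ with hF
  have hFD : ∀ x ∈ D, F x = 2 * m x * ⟪pflux p (gradient u x) - pflux p (gradient w x),
      gradient u x - gradient w x⟫ := fun x hx => by
    simp only [hF]
    rw [← inner_sub_left, hgrad x hx, inner_smul_right]
  have hF0 : ∀ x ∉ K, F x = 0 := fun x hx => by
    simp only [hF]
    rw [hg0 x hx, inner_zero_right, inner_zero_right, sub_zero]
  have hm_nonneg : ∀ x, 0 ≤ m x := fun x => le_max_right _ _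
  have hFnn : 0 ≤ F := fun x => by
    by_cases hx : x ∈ K
    · rw [hFD x (hKD hx)]
      exact mul_nonneg (by linarith [hm_nonneg x]) (pflux_mono hp _ _)
    · rw [hF0 x hx]; rfl
  have hFint : ∫ x, F x = 0 := by
    rw [hF, integral_sub (hI hu) (hI hw), hu.2 ψ hψc hcs (hts.trans (hKD.trans hDO)),
      hw.2 ψ hψc hcs (hts.trans (hKD.trans hDO)), sub_zero]
  have hFcont : Continuous F := continuous_of_continuousOn_of_eq_zero hΩ hcl (hKD.trans hDO)
    ((hA hu).sub (hA hw)) hF0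
  have hFz : F = 0 := Continuous.ae_eq_iff_eq volume hFcont continuous_zero |>.1
    ((integral_eq_zero_iff_of_nonneg hFnn ((hI hu).sub (hI hw))).1 hFint)
  have hgz : ∀ x, gradient ψ x = 0 := fun x => by
    by_cases hx : x ∈ K
    · rw [hgrad x (hKD hx)]
      by_cases heq : gradient u x = gradient w x
      · rw [heq, sub_self, smul_zero]
      · have h1 := hFD x (hKD hx)
        rw [hFz, Pi.zero_apply] at h1
        have h2 := pflux_strictMono hp heq
        have : 2 * m x = 0 := by
          rcases mul_eq_zero.1 h1.symm with h3 | h3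
          · exact h3
          · linarith
        rw [this, zero_smul]
    · exact hg0 x hx
  have hz := eq_zero_of_gradient_eq_zero hψc hcs hgz x₀
  simp only [hψ, if_pos hx₀] at hz
  have : m x₀ = 0 := by simpa using hz
  have h3 : -ε - (w x₀ - u x₀) ≤ m x₀ := le_max_left _ _
  linarith

end Comparison

section Fundamental

open Module (finrank)

/-- The radial profile of the fundamental solution, normalized to have derivative `-r ^ (-κ - 1)`. -/
def profile (κ r : ℝ) : ℝ := if κ = 0 then -Real.log r else r ^ (-κ) / κ

lemma hasDerivAt_profile (κ : ℝ) {r : ℝ} (hr : 0 < r) :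
    HasDerivAt (profile κ) (-r ^ (-κ - 1)) r := by
  by_cases hκ : κ = 0
  · have : profile κ = fun r => -Real.log r := by ext r; simp [profile, hκ]
    rw [this, hκ, neg_zero, zero_sub, Real.rpow_neg_one]
    exact (Real.hasDerivAt_log hr.ne').neg
  · have : profile κ = fun r => r ^ (-κ) / κ := by ext r; simp [profile, hκ]
    rw [this]
    have h := (Real.hasDerivAt_rpow_const (p := -κ) (Or.inl hr.ne')).div_const κ
    rwa [neg_mul, neg_div, mul_div_cancel_left₀ _ hκ] at h

lemma contDiffOn_profile (κ : ℝ) : ContDiffOn ℝ 1 (profile κ) (Ioi 0) := by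
  by_cases hκ : κ = 0
  · have : profile κ = fun r => -Real.log r := by ext r; simp [profile, hκ]
    rw [this]
    exact (contDiffOn_id.log fun x hx => (mem_Ioi.1 hx).ne').neg
  · have : profile κ = fun r => r ^ (-κ) / κ := by ext r; simp [profile, hκ]
    rw [this]
    exact (contDiffOn_id.rpow_const_of_ne fun x hx => (mem_Ioi.1 hx).ne').div_const κ

lemma profile_strictAntiOn (κ : ℝ) : StrictAntiOn (profile κ) (Ioi 0) := by
  refine strictAntiOn_of_deriv_neg (convex_Ioi 0) (contDiffOn_profile κ).continuousOn fun r hr => ?_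
  rw [interior_Ioi] at hr
  rw [(hasDerivAt_profile κ hr).deriv]
  exact neg_neg_of_pos (Real.rpow_pos_of_pos hr _)

lemma tendsto_profile {κ : ℝ} (hκ : 0 ≤ κ) : Tendsto (profile κ) (𝓝[>] 0) atTop := by
  by_cases h : κ = 0
  · have : profile κ = fun r => -Real.log r := by ext r; simp [profile, h]
    rw [this]
    exact tendsto_neg_atBot_atTop.comp Real.tendsto_log_nhdsGT_zero
  · have h0 : 0 < κ := lt_of_le_of_ne hκ (Ne.symm h)
    have : profile κ = fun r => r ^ (-κ) / κ := by ext r; simp [profile, h]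
    rw [this]
    exact (tendsto_rpow_neg_nhdsGT_zero (by linarith)).atTop_div_const h0

variable {E : Type*} [NormedAddCommGroup E] [InnerProductSpace ℝ E] [FiniteDimensional ℝ E]

lemma hasGradientAt_norm {x : E} (hx : x ≠ 0) : HasGradientAt (fun y => ‖y‖) (‖x‖⁻¹ • x) x := by
  have h0 : (0 : ℝ) < ‖x‖ := norm_pos_iff.2 hx
  have h := HasGradientAt.comp (f := fun y => ‖y - 0‖ ^ 2) (x := x) (g := Real.sqrt)
    (Real.hasDerivAt_sqrt (by simpa using hx)) (hasGradientAt_norm_sub_sq 0 x)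
  simp only [sub_zero, Real.sqrt_sq (norm_nonneg _)] at h
  convert h using 1
  rw [smul_smul]
  congr 1
  field_simp

lemma hasGradientAt_profile_norm (κ : ℝ) {x : E} (hx : x ≠ 0) :
    HasGradientAt (fun y => profile κ ‖y‖) (-(‖x‖ ^ (-κ - 2) • x)) x := by
  have h0 : 0 < ‖x‖ := norm_pos_iff.2 hx
  convert HasGradientAt.comp (hasDerivAt_profile κ h0) (hasGradientAt_norm hx) using 1
  rw [smul_smul, ← neg_smul, neg_mul, ← Real.rpow_neg_one, ← Real.rpow_add h0]
  ring_nf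

omit [FiniteDimensional ℝ E] in
lemma contDiffOn_profile_norm (κ : ℝ) : ContDiffOn ℝ 1 (fun y : E => profile κ ‖y‖) {0}ᶜ :=
  (contDiffOn_profile κ).comp (fun _ hx => (contDiffAt_norm ℝ hx).contDiffWithinAt)
    fun _ hx => norm_pos_iff.2 hx

lemma norm_gradient_profile (κ : ℝ) {x : E} (hx : x ≠ 0) :
    ‖gradient (fun y => profile κ ‖y‖) x‖ = ‖x‖ ^ (-κ - 1) := by
  have h0 : 0 < ‖x‖ := norm_pos_iff.2 hx
  rw [(hasGradientAt_profile_norm κ hx).gradient, norm_neg, norm_smul, Real.norm_of_nonneg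
    (Real.rpow_nonneg h0.le _)]
  nth_rw 2 [← Real.rpow_one ‖x‖]
  rw [← Real.rpow_add h0]
  ring_nf

lemma pflux_gradient_profile {p κ : ℝ} {x : E} (hx : x ≠ 0)
    (hκ : κ * (p - 1) = finrank ℝ E - p) :
    pflux p (gradient (fun y => profile κ ‖y‖) x) = -(‖x‖ ^ (-(finrank ℝ E : ℝ)) • x) := by
  have h0 : 0 < ‖x‖ := norm_pos_iff.2 hx
  rw [(hasGradientAt_profile_norm κ hx).gradient, pflux_neg,
    pflux_smul (Real.rpow_pos_of_pos h0 _), pflux, smul_smul, ← Real.rpow_mul h0.le,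
    ← Real.rpow_add h0]
  congr 3
  linarith

variable [MeasurableSpace E] [BorelSpace E]

lemma integral_fderiv_eq_zero {f : E → ℝ} (hf : ContDiff ℝ 1 f) (hc : HasCompactSupport f) (e : E) :
    ∫ x, fderiv ℝ f x e = 0 := by
  have hi : Integrable fun x => fderiv ℝ f x e :=
    ((hf.continuous_fderiv (by simp)).clm_apply continuous_const).integrable_of_hasCompactSupport
      (hc.fderiv_apply (𝕜 := ℝ) e)
  have := integral_mul_fderiv_eq_neg_fderiv_mul_of_integrable (μ := (volume : Measure E))
    (f := fun _ => (1 : ℝ)) (g := f) (v := e) (by simp) (by simpa using hi)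
    (by simpa using hf.continuous.integrable_of_hasCompactSupport hc) (by simp)
    fun x _ => hf.differentiable (by simp) x
  simpa using this

lemma integral_inner_gradient_self {h : E → ℝ} (hh : ContDiff ℝ 1 h) (hc : HasCompactSupport h) :
    ∫ x, (⟪x, gradient h x⟫ + finrank ℝ E * h x) = 0 := by
  set b := stdOrthonormalBasis ℝ E with hb
  have hf : ∀ i, ContDiff ℝ 1 fun x => ⟪b i, x⟫ * h x := fun i =>
    (contDiff_const.inner ℝ contDiff_id).mul hh
  have hfc : ∀ i, HasCompactSupport fun x => ⟪b i, x⟫ * h x := fun i => hc.mul_left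
  have hd : ∀ i x, fderiv ℝ (fun x => ⟪b i, x⟫ * h x) x (b i) =
      ⟪x, b i⟫ * ⟪b i, gradient h x⟫ + h x := fun i x => by
    have h1 : HasFDerivAt (fun x => ⟪b i, x⟫) (innerSL ℝ (b i)) x := (innerSL ℝ (b i)).hasFDerivAt
    have h2 := (hh.differentiable (by simp) x).hasFDerivAt
    have h3 := (h1.mul h2).fderiv
    simp only [Pi.mul_def] at h3
    rw [h3, inner_gradient_eq_fderiv]
    simp [real_inner_comm]
  have hi : ∀ i ∈ Finset.univ, Integrable fun x => fderiv ℝ (fun x => ⟪b i, x⟫ * h x) x (b i) :=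
    fun i _ => (((hf i).continuous_fderiv (by simp)).clm_apply
      continuous_const).integrable_of_hasCompactSupport ((hfc i).fderiv_apply (𝕜 := ℝ) (b i))
  have hsum := integral_finsetSum Finset.univ hi
  rw [Finset.sum_eq_zero fun i _ => integral_fderiv_eq_zero (hf i) (hfc i) (b i)] at hsum
  rw [← hsum]
  congr 1
  ext x
  simp only [hd]
  rw [Finset.sum_add_distrib, b.sum_inner_mul_inner]
  simp

lemma isPHarmonic_profile {p κ : ℝ} (hκ : κ * (p - 1) = finrank ℝ E - p) :
    IsPHarmonic p {0}ᶜ fun x : E => profile κ ‖x‖ := by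
  refine ⟨contDiffOn_profile_norm κ, fun φ hφ hc hs => ?_⟩
  set d : ℝ := (finrank ℝ E : ℝ) with hd
  set h : E → ℝ := fun x => ‖x‖ ^ (-d) * φ x with hh
  have hΩ : IsOpen ({0}ᶜ : Set E) := isOpen_compl_singleton
  have hn : ContDiffOn ℝ 1 (fun x : E => ‖x‖ ^ (-d)) {0}ᶜ := fun x hx =>
    ((contDiffAt_norm ℝ hx).rpow_const_of_ne (norm_ne_zero_iff.2 hx)).contDiffWithinAt
  have hh0 : ∀ x ∉ tsupport φ, h x = 0 := fun x hx => by
    simp [hh, image_eq_zero_of_notMem_tsupport hx]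
  have hhc : ContDiff ℝ 1 h := contDiff_of_contDiffOn_of_eq_zero hΩ (isClosed_tsupport φ) hs
    (hn.mul hφ.contDiffOn) hh0
  have hhs : HasCompactSupport h := HasCompactSupport.intro hc hh0
  have key := integral_inner_gradient_self hhc hhs
  rw [← neg_eq_zero, ← integral_neg, ← key]
  congr 1
  ext x
  by_cases hx : x ∈ tsupport φ
  · have hx0 : x ≠ 0 := hs hx
    have hpos : 0 < ‖x‖ := norm_pos_iff.2 hx0
    have h1 := HasGradientAt.comp (Real.hasDerivAt_rpow_const (p := -d) (Or.inl hpos.ne'))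
      (hasGradientAt_norm hx0)
    have h2 := hasGradientAt_of_contDiffOn isOpen_univ hφ.contDiffOn (mem_univ x)
    have h3 := (HasGradientAt.mul h1 h2).gradient
    rw [pflux_gradient_profile hx0 hκ, h3, inner_neg_left, neg_neg, inner_add_right,
      inner_smul_left, inner_smul_right, inner_smul_right, inner_smul_right, inner_smul_right,
      real_inner_self_eq_norm_sq, Real.rpow_sub_one hpos.ne']
    simp only [hh, conj_trivial]
    field_simp
    ring
  · have h1 : gradient h x = 0 := gradient_eq_zero_of_notMem_tsupport fun hx' =>
      hx (closure_minimal (fun y hy => by by_contra hy'; exact hy (hh0 y hy'))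
        (isClosed_tsupport φ) hx')
    rw [h1, gradient_eq_zero_of_notMem_tsupport hx, hh0 x hx]
    simp

end Fundamental

section Isolated

open Module (finrank)

variable {E : Type*} [NormedAddCommGroup E] [InnerProductSpace ℝ E] [FiniteDimensional ℝ E]
  [MeasurableSpace E] [BorelSpace E] {p κ R : ℝ} {u : E → ℝ}

lemma comparison_annulus [Nontrivial E] (hp : 1 < p) {w : E → ℝ} {a b : ℝ} (ha : 0 < a)
    (hbR : b < R) (hu : IsPHarmonic p (ball 0 R \ {0}) u) (hw : IsPHarmonic p (ball 0 R \ {0}) w)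
    (h1 : ∀ x, ‖x‖ = a → u x ≤ w x) (h2 : ∀ x, ‖x‖ = b → u x ≤ w x) {x : E} (hax : a ≤ ‖x‖)
    (hxb : ‖x‖ ≤ b) : u x ≤ w x := by
  have hprop := FiniteDimensional.proper ℝ E
  rcases hax.eq_or_lt with hax | hax
  · exact h1 x hax.symm
  rcases hxb.eq_or_lt with hxb | hxb
  · exact h2 x hxb
  set D : Set E := ball 0 b \ closedBall 0 a with hD
  have hDo : IsOpen D := isOpen_ball.sdiff isClosed_closedBall
  have hcl : closure D ⊆ closedBall 0 b \ ball 0 a :=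
    closure_minimal (fun y hy => ⟨ball_subset_closedBall hy.1, fun h => hy.2
      (ball_subset_closedBall h)⟩) (isClosed_closedBall.sdiff isOpen_ball)
  refine comparison hp (isOpen_ball.sdiff isClosed_singleton) hDo
    ((isCompact_closedBall 0 b).of_isClosed_subset isClosed_closure fun y hy => (hcl hy).1)
    (fun y hy => ?_) hu hw (fun y hy => ?_) x ?_
  · have := hcl hy
    simp only [Set.mem_sdiff, mem_closedBall, mem_ball, dist_zero_right, not_lt,
      mem_singleton_iff] at this ⊢
    exact ⟨by linarith, fun h => by rw [h, norm_zero] at this; linarith⟩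
  · have h3 := hcl hy.1
    have h4 := hy.2
    rw [hDo.interior_eq] at h4
    simp only [hD, Set.mem_sdiff, mem_closedBall, mem_ball, dist_zero_right, not_lt,
      not_and, not_le] at h3 h4
    rcases h3.2.eq_or_lt with h | h
    · exact h1 y h.symm
    · refine h2 y (le_antisymm h3.1 ?_)
      by_contra! hlt
      linarith [h4 hlt]
  · simp [hD, hax, hxb]

lemma isPHarmonic_mul_profile_add (hκ : κ * (p - 1) = finrank ℝ E - p) {c : ℝ} (hc : 0 < c)
    (b : ℝ) : IsPHarmonic p (ball 0 R \ {0}) fun x : E => c * profile κ ‖x‖ + b :=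
  (((isPHarmonic_profile hκ).const_mul hc).add_const b).mono fun _ hx => hx.2

omit [InnerProductSpace ℝ E] [FiniteDimensional ℝ E] [MeasurableSpace E] [BorelSpace E] in
lemma tendsto_profile_norm (hκ0 : 0 ≤ κ) :
    Tendsto (fun x : E => profile κ ‖x‖) (𝓝[≠] 0) atTop :=
  (tendsto_profile hκ0).comp tendsto_norm_nhdsNE_zero

omit [InnerProductSpace ℝ E] [FiniteDimensional ℝ E] [MeasurableSpace E] [BorelSpace E] in
lemma eventually_punctured {P : E → Prop} : (∀ᶠ x in 𝓝[≠] 0, P x) ↔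
    ∃ δ > 0, ∀ x, 0 < ‖x‖ → ‖x‖ < δ → P x := by
  rw [eventually_nhdsWithin_iff, Metric.eventually_nhds_iff]
  simp only [dist_zero_right, mem_compl_iff, mem_singleton_iff, norm_pos_iff]
  exact exists_congr fun δ => and_congr_right fun _ => forall_congr' fun x => ⟨fun h a b => h b a,
    fun h a b => h b a⟩

/-- The maximum principle near an isolated singularity that is weaker than the fundamental one. -/
lemma le_of_le_sphere [Nontrivial E] (hp : 1 < p) (hκ : κ * (p - 1) = finrank ℝ E - p)
    (hκ0 : 0 ≤ κ) (hu : IsPHarmonic p (ball 0 R \ {0}) u) {r₀ M : ℝ} (hr₀ : r₀ < R)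
    (hM : ∀ x, ‖x‖ = r₀ → u x ≤ M)
    (hsmall : ∀ ε > 0, ∀ᶠ x in 𝓝[≠] 0, u x ≤ ε * profile κ ‖x‖) {x : E} (hx : 0 < ‖x‖)
    (hxr : ‖x‖ ≤ r₀) : u x ≤ M := by
  have key : ∀ ε > 0, u x ≤ M + ε * (profile κ ‖x‖ - profile κ r₀) := fun ε hε => by
    have h1 := hsmall (ε / 2) (by positivity)
    have h2 := (tendsto_profile_norm (E := E) hκ0).eventually_ge_atTop
      (2 * (ε * profile κ r₀ - M) / ε)
    obtain ⟨δ, hδ, h⟩ := eventually_punctured.1 (h1.and h2)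
    set a := min (δ / 2) ‖x‖ with ha
    have ha0 : 0 < a := lt_min (by positivity) hx
    have haδ : a < δ := (min_le_left _ _).trans_lt (by linarith)
    have := comparison_annulus hp ha0 hr₀ hu
      (isPHarmonic_mul_profile_add hκ hε (M - ε * profile κ r₀)) (fun y hy => ?_) (fun y hy => ?_)
      (min_le_right _ _) hxr
    · linarith
    · obtain ⟨h3, h4⟩ := h y (by rwa [hy]) (by rwa [hy])
      rw [div_le_iff₀ hε] at h4
      linarith
    · rw [hy]; linarith [hM y hy]
  have hlim : Tendsto (fun ε => M + ε * (profile κ ‖x‖ - profile κ r₀)) (𝓝[>] 0)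
      (𝓝 (M + 0 * (profile κ ‖x‖ - profile κ r₀))) :=
    (Continuous.tendsto (by fun_prop) 0).mono_left nhdsWithin_le_nhds
  rw [zero_mul, add_zero] at hlim
  exact ge_of_tendsto hlim (eventually_mem_nhdsWithin.mono key)

lemma ge_of_ge_sphere [Nontrivial E] (hp : 1 < p) (hκ : κ * (p - 1) = finrank ℝ E - p)
    (hκ0 : 0 ≤ κ) (hu : IsPHarmonic p (ball 0 R \ {0}) u) (hu0 : ∀ x ∈ ball 0 R \ {0}, 0 ≤ u x)
    {r₀ m : ℝ} (hr₀ : r₀ < R) (hm : ∀ x, ‖x‖ = r₀ → m ≤ u x) {x : E} (hx : 0 < ‖x‖)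
    (hxr : ‖x‖ ≤ r₀) : m ≤ u x := by
  refine neg_le_neg_iff.1 (le_of_le_sphere hp hκ hκ0 hu.neg hr₀ (fun y hy => neg_le_neg (hm y hy))
    (fun ε hε => ?_) hx hxr)
  have h1 := (tendsto_profile_norm (E := E) hκ0).eventually_ge_atTop 0
  have h2 : ∀ᶠ y : E in 𝓝[≠] 0, 0 < ‖y‖ ∧ ‖y‖ < R :=
    eventually_punctured.2 ⟨R, by linarith, fun y h h' => ⟨h, h'⟩⟩
  filter_upwards [h1, h2] with y hy hy'
  have h3 := hu0 y ⟨by simpa using hy'.2, by simpa using hy'.1⟩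
  have h4 : 0 ≤ ε * profile κ ‖y‖ := mul_nonneg hε.le hy
  linarith

lemma profile_lower_bound [Nontrivial E] (hp : 1 < p) (hκ : κ * (p - 1) = finrank ℝ E - p)
    (hu : IsPHarmonic p (ball 0 R \ {0}) u) (hu0 : ∀ x ∈ ball 0 R \ {0}, 0 ≤ u x)
    {r r₀ L : ℝ} (hr : 0 < r) (hrr : r < r₀) (hr₀ : r₀ < R) (hL : 0 < L)
    (hLu : ∀ x, ‖x‖ = r → L ≤ u x) {x : E} (hrx : r ≤ ‖x‖) (hxr : ‖x‖ ≤ r₀) :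
    L * (profile κ ‖x‖ - profile κ r₀) / (profile κ r - profile κ r₀) ≤ u x := by
  have hpos : 0 < profile κ r - profile κ r₀ :=
    sub_pos.2 (profile_strictAntiOn κ hr (hr.trans hrr) hrr)
  have := comparison_annulus hp hr hr₀
    (isPHarmonic_mul_profile_add hκ (c := L / (profile κ r - profile κ r₀)) (by positivity)
      (-(L / (profile κ r - profile κ r₀) * profile κ r₀))) hu (fun y hy => ?_) (fun y hy => ?_)
    hrx hxr
  · refine le_trans (le_of_eq ?_) this
    field_simp
    ring
  · refine le_trans (le_of_eq ?_) (hLu y hy)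
    rw [hy]
    field_simp
    ring
  · refine le_trans (le_of_eq ?_) (hu0 y ?_)
    · rw [hy]; ring
    · have : 0 < ‖y‖ := by rw [hy]; linarith
      exact ⟨by simpa [hy] using hr₀, by simpa using this⟩

lemma profile_pos (hκ0 : 0 ≤ κ) {r : ℝ} (hr : 0 < r) (hr1 : r < 1) : 0 < profile κ r := by
  by_cases h : κ = 0
  · rw [profile, if_pos h]
    exact neg_pos.2 (Real.log_neg hr hr1)
  · rw [profile, if_neg h]
    have : 0 < κ := lt_of_le_of_ne hκ0 (Ne.symm h)
    positivity

/-- Positive solutions are dominated by the fundamental solution. -/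
lemma exists_le_mul_profile (hp : 1 < p) (hd : 2 ≤ finrank ℝ E)
    (hκ : κ * (p - 1) = finrank ℝ E - p) (hκ0 : 0 ≤ κ) (hR : 0 < R) (hR1 : R ≤ 1)
    (hu : IsPHarmonic p (ball 0 R \ {0}) u) (hu0 : ∀ x ∈ ball 0 R \ {0}, 0 < u x) :
    ∃ Q > 0, ∀ x, 0 < ‖x‖ → ‖x‖ ≤ R / 4 → u x ≤ Q * profile κ ‖x‖ := by
  have hnt : Nontrivial E := Module.nontrivial_of_finrank_pos (R := ℝ) (by omega)
  obtain ⟨C, hC, hH⟩ := harnack_sphere E hp hd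
  obtain ⟨y₀, hy₀⟩ := exists_norm_eq E (c := R / 4) (by positivity)
  have hy₀m : y₀ ∈ ball 0 R \ {0} := by
    have : 0 < ‖y₀‖ := by rw [hy₀]; positivity
    exact ⟨by simp [hy₀]; linarith, by simpa using this⟩
  have hΔ : 0 < profile κ (R / 4) - profile κ (R / 2) :=
    sub_pos.2 (profile_strictAntiOn κ (mem_Ioi.2 (by positivity)) (mem_Ioi.2 (by positivity))
      (by linarith))
  have hu₀ := hu0 y₀ hy₀m
  refine ⟨C * u y₀ / (profile κ (R / 4) - profile κ (R / 2)), by positivity, fun x hx hxR => ?_⟩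
  have hxm : x ∈ ball 0 R \ {0} := ⟨by simp; linarith, by simpa using hx⟩
  have hux := hu0 x hxm
  have hC0 : 0 < C := by linarith
  have h := profile_lower_bound hp hκ hu (fun x hx => (hu0 x hx).le) hx (r₀ := R / 2)
    (L := u x / C) (by linarith) (by linarith) (by positivity) (fun y hy => by
      rw [div_le_iff₀ hC0, mul_comm]
      exact hH hu (fun x hx => (hu0 x hx).le) hx hy.symm (by linarith))
    (x := y₀) (by rw [hy₀]; exact hxR) (by rw [hy₀]; linarith)
  have hΔ2 : 0 < profile κ ‖x‖ - profile κ (R / 2) :=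
    sub_pos.2 (profile_strictAntiOn κ hx (mem_Ioi.2 (by positivity)) (by linarith))
  have hpp := profile_pos hκ0 (r := R / 2) (by positivity) (by linarith)
  rw [hy₀, div_le_iff₀ hΔ2, div_mul_eq_mul_div, div_le_iff₀ hC0] at h
  rw [div_mul_eq_mul_div, le_div_iff₀ hΔ]
  refine h.trans ?_
  nlinarith [mul_pos hu₀ (mul_pos hC0 hpp)]

/-- If the spherical oscillation of `u / Φ` tends to zero, then `u / Φ` converges. -/
lemma exists_tendsto_div_profile [Nontrivial E] (hp : 1 < p)
    (hκ : κ * (p - 1) = finrank ℝ E - p) (hκ0 : 0 ≤ κ) (hR : 0 < R) (hR1 : R ≤ 1)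
    (hu : IsPHarmonic p (ball 0 R \ {0}) u) (hu0 : ∀ x ∈ ball 0 R \ {0}, 0 < u x) {Q : ℝ}
    (hQ : ∀ x, 0 < ‖x‖ → ‖x‖ ≤ R / 4 → u x ≤ Q * profile κ ‖x‖)
    (hosc : ∀ ε > 0, ∃ δ > 0, ∀ x y, 0 < ‖x‖ → ‖x‖ < δ → ‖x‖ = ‖y‖ →
      u x / profile κ ‖x‖ ≤ u y / profile κ ‖y‖ + ε) :
    ∃ α ≥ 0, Tendsto (fun x => u x / profile κ ‖x‖) (𝓝[≠] 0) (𝓝 α) := by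
  have hev : ∀ δ > 0, ∀ᶠ x : E in 𝓝[≠] 0, 0 < ‖x‖ ∧ ‖x‖ < δ := fun δ hδ =>
    eventually_punctured.2 ⟨δ, hδ, fun y h h' => ⟨h, h'⟩⟩
  have hΦ : ∀ x : E, 0 < ‖x‖ → ‖x‖ < R → 0 < profile κ ‖x‖ := fun x h h' =>
    profile_pos hκ0 h (by linarith)
  have hpos : ∀ᶠ x : E in 𝓝[≠] 0, 0 ≤ u x / profile κ ‖x‖ := by
    filter_upwards [hev R hR] with x hx
    exact div_nonneg (hu0 x ⟨by simpa using hx.2, by simpa using hx.1⟩).le (hΦ x hx.1 hx.2).le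
  have hbd : ∀ᶠ x : E in 𝓝[≠] 0, u x / profile κ ‖x‖ ≤ Q := by
    filter_upwards [hev (R / 4) (by positivity)] with x hx
    rw [div_le_iff₀ (hΦ x hx.1 (by linarith))]
    exact hQ x hx.1 hx.2.le
  have hup : ∀ a ∈ (univ : Set ℝ), ∀ b ∈ (univ : Set ℝ), a < b →
      ¬((∃ᶠ x : E in 𝓝[≠] 0, u x / profile κ ‖x‖ < a) ∧
        ∃ᶠ x : E in 𝓝[≠] 0, b < u x / profile κ ‖x‖) := by
    intro a _ b _ hab
    rintro ⟨hfa, hfb⟩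
    obtain ⟨δ, hδ, hδo⟩ := hosc ((b - a) / 2) (by linarith)
    obtain ⟨x₀, hx₀a, hx₀, hx₀δ⟩ := (hfa.and_eventually (hev (min δ R) (lt_min hδ hR))).exists
    obtain ⟨x₁, hx₁b, hx₁, hx₁δ⟩ := (hfb.and_eventually (hev ‖x₀‖ hx₀)).exists
    obtain ⟨x₂, hx₂a, hx₂, hx₂δ⟩ := (hfa.and_eventually (hev ‖x₁‖ hx₁)).exists
    have hx₀R : ‖x₀‖ < R := hx₀δ.trans_le (min_le_right _ _)
    have hx₀d : ‖x₀‖ < δ := hx₀δ.trans_le (min_le_left _ _)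
    have ha0 : 0 < a := by
      refine lt_of_le_of_lt ?_ hx₀a
      exact div_nonneg (hu0 x₀ ⟨by simpa using hx₀R, by simpa using hx₀⟩).le (hΦ x₀ hx₀ hx₀R).le
    have hsph : ∀ z : E, 0 < ‖z‖ → ‖z‖ ≤ ‖x₀‖ → u z / profile κ ‖z‖ < a → ∀ y, ‖y‖ = ‖z‖ →
        u y ≤ (a + (b - a) / 2) * profile κ ‖y‖ + 0 := fun z hz hz' hza y hy => by
      have := hδo y z (by rwa [hy]) (by rw [hy]; linarith) hy
      rw [add_zero, ← div_le_iff₀ (hΦ y (by rwa [hy]) (by rw [hy]; linarith))]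
      linarith
    have := comparison_annulus hp hx₂ hx₀R hu (isPHarmonic_mul_profile_add hκ
      (c := a + (b - a) / 2) (by linarith) 0) (hsph x₂ hx₂ (by linarith) hx₂a)
      (hsph x₀ hx₀ le_rfl hx₀a) hx₂δ.le hx₁δ.le
    rw [add_zero, ← div_le_iff₀ (hΦ x₁ hx₁ (by linarith))] at this
    linarith
  obtain ⟨α, hα⟩ := tendsto_of_no_upcrossings dense_univ hup
    (isBoundedUnder_of_eventually_le hbd) (isBoundedUnder_of_eventually_ge hpos)
  exact ⟨α, ge_of_tendsto hα hpos, hα⟩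

lemma exists_tendsto_of_small (hp : 1 < p) (hd : 2 ≤ finrank ℝ E)
    (hκ : κ * (p - 1) = finrank ℝ E - p) (hκ0 : 0 ≤ κ) (hR : 0 < R)
    (hu : IsPHarmonic p (ball 0 R \ {0}) u) (hu0 : ∀ x ∈ ball 0 R \ {0}, 0 < u x)
    (hsmall : ∀ ε > 0, ∀ᶠ x in 𝓝[≠] 0, u x ≤ ε * profile κ ‖x‖) :
    ∃ l > 0, Tendsto u (𝓝[≠] 0) (𝓝 l) := by
  have hnt : Nontrivial E := Module.nontrivial_of_finrank_pos (R := ℝ) (by omega)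
  have hprop := FiniteDimensional.proper ℝ E
  obtain ⟨C, hC, hH⟩ := harnack_sphere E hp hd
  have hsub : sphere (0 : E) (R / 2) ⊆ ball 0 R \ {0} := fun x hx => by
    rw [mem_sphere_zero_iff_norm] at hx
    have : 0 < ‖x‖ := by rw [hx]; positivity
    exact ⟨by simp [hx]; linarith, by simpa using this⟩
  have hne : (sphere (0 : E) (R / 2)).Nonempty := NormedSpace.sphere_nonempty.2 (by positivity)
  have hcont := hu.1.continuousOn.mono hsub
  obtain ⟨a, ha, hamin⟩ := (isCompact_sphere (0 : E) (R / 2)).exists_isMinOn hne hcont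
  obtain ⟨b, hb, hbmax⟩ := (isCompact_sphere (0 : E) (R / 2)).exists_isMaxOn hne hcont
  set S := {m | ∀ᶠ x in 𝓝[≠] 0, m ≤ u x} with hS
  have hu0' : ∀ x ∈ ball 0 R \ {0}, 0 ≤ u x := fun x hx => (hu0 x hx).le
  have hmS : ∀ {r m : ℝ}, 0 < r → r < R → (∀ x, ‖x‖ = r → m ≤ u x) → m ∈ S := fun hr hrR h =>
    eventually_punctured.2 ⟨_, hr, fun x hx hx' =>
      ge_of_ge_sphere hp hκ hκ0 hu hu0' hrR h hx hx'.le⟩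
  have haS : u a ∈ S := hmS (r := R / 2) (by positivity) (by linarith) fun x hx =>
    hamin (mem_sphere_zero_iff_norm.2 hx)
  have hub : ∀ m ∈ S, m ≤ u b := fun m hm => by
    have h1 : ∀ᶠ x in 𝓝[≠] 0, u x ≤ u b := eventually_punctured.2 ⟨R / 2, by positivity,
      fun x hx hx' => le_of_le_sphere hp hκ hκ0 hu (by linarith)
        (fun y hy => hbmax (mem_sphere_zero_iff_norm.2 hy)) hsmall hx hx'.le⟩
    obtain ⟨x, hx, hx'⟩ := (h1.and hm).exists
    linarith
  have hlub := isLUB_csSup ⟨_, haS⟩ ⟨u b, hub⟩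
  set l := sSup S with hl
  refine ⟨l, (hu0 a (hsub ha)).trans_le (hlub.1 haS), ?_⟩
  have hbelow : ∀ c < l, ∀ᶠ x in 𝓝[≠] 0, c ≤ u x := fun c hc => by
    obtain ⟨m, hm, hcm, -⟩ := hlub.exists_between hc
    have hm' : ∀ᶠ x in 𝓝[≠] 0, m ≤ u x := hm
    exact hm'.mono fun x hx => hcm.le.trans hx
  have hC0 : 0 < C := by linarith
  refine tendsto_order.2 ⟨fun c hc => ?_, fun c hc => ?_⟩
  · exact (hbelow ((c + l) / 2) (by linarith)).mono fun x hx => by linarith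
  · set ε := (c - l) / (4 * C) with hε
    have hε0 : 0 < ε := div_pos (by linarith) (by positivity)
    have hεC : 4 * C * ε = c - l := by rw [hε]; field_simp
    obtain ⟨δ, hδ, h⟩ := eventually_punctured.1 (hbelow (l - ε) (by linarith))
    refine eventually_punctured.2 ⟨min δ R / 2, by positivity, fun x hx hxδ => ?_⟩
    have hy : ∃ y, ‖y‖ = ‖x‖ ∧ u y < l + ε := by
      by_contra! hcon
      have := hlub.1 (hmS hx (by linarith [min_le_right δ R]) hcon)
      linarith
    obtain ⟨y, hyx, hyl⟩ := hy
    have := hH (R := min δ R) ((hu.mono (sdiff_subset_sdiff_left (ball_subset_ball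
      (min_le_right δ R)))).sub_const (l - ε)) (fun z hz => ?_) hx hyx.symm (by linarith)
    · nlinarith
    · have hz1 : ‖z‖ < min δ R := by simpa using hz.1
      linarith [h z (by simpa using hz.2) (hz1.trans_le (min_le_left _ _))]

end Isolated

section Annulus

open Module (finrank)

variable {E : Type*} [NormedAddCommGroup E] [InnerProductSpace ℝ E] [FiniteDimensional ℝ E]

variable (E) in
/-- The closed annulus `s ≤ ‖x‖ ≤ 2 * s`. -/
def annulus (s : ℝ) : Set E := closedBall 0 (2 * s) \ ball 0 s

omit [InnerProductSpace ℝ E] [FiniteDimensional ℝ E] in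
lemma mem_annulus {s : ℝ} {x : E} : x ∈ annulus E s ↔ s ≤ ‖x‖ ∧ ‖x‖ ≤ 2 * s := by
  simp [annulus, and_comm]

lemma isCompact_annulus (s : ℝ) : IsCompact (annulus E s) :=
  haveI := FiniteDimensional.proper ℝ E
  (isCompact_closedBall 0 (2 * s)).diff isOpen_ball

omit [InnerProductSpace ℝ E] [FiniteDimensional ℝ E] in
lemma annulus_subset {s R : ℝ} (hs : 0 < s) (hsR : 2 * s < R) : annulus E s ⊆ ball 0 R \ {0} :=
  fun x hx => by
    rw [mem_annulus] at hx
    have : 0 < ‖x‖ := by linarith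
    exact ⟨by simp; linarith, by simpa using this⟩

variable (E) in
lemma exists_annular_cutoff : ∃ C > 0, ∀ a b : ℝ, 0 < a → 2 * a ≤ b → ∃ ζ : E → ℝ,
    ContDiff ℝ 1 ζ ∧ (∀ x, 0 ≤ ζ x) ∧ (∀ x, ζ x ≤ 1) ∧ (∀ x, 2 * a ≤ ‖x‖ → ‖x‖ ≤ b → ζ x = 1) ∧
    (∀ x, ‖x‖ < a → ζ x = 0) ∧ (∀ x, 2 * b ≤ ‖x‖ → ζ x = 0) ∧ ∀ x, ‖gradient ζ x‖ ≤
      (annulus E a).indicator (fun _ => C / a) x + (annulus E b).indicator (fun _ => C / b) x := by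
  obtain ⟨C, hC, h⟩ := exists_cutoff E
  refine ⟨C, hC, fun a b ha hab => ?_⟩
  have hb : 0 < b := by linarith
  obtain ⟨η, hη, hη0, hη1, hηi, hηo, hηg⟩ := h 0 a (2 * a) ha (by linarith)
  obtain ⟨χ, hχ, hχ0, hχ1, hχi, hχo, hχg⟩ := h 0 b (2 * b) hb (by linarith)
  simp only [mem_closedBall, mem_ball, dist_zero_right, not_lt] at hηi hηo hχi hχo
  have hgrad : ∀ {f : E → ℝ} {s : ℝ}, 0 < s → (∀ x, ‖x‖ ≤ s → f x = 1) →
      (∀ x, 2 * s ≤ ‖x‖ → f x = 0) → (∀ x, ‖gradient f x‖ ≤ C / (2 * s - s)) → ∀ x,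
      ‖gradient f x‖ ≤ (annulus E s).indicator (fun _ => C / s) x := by
    intro f s hs h1 h0 hg x
    by_cases hx : x ∈ annulus E s
    · rw [indicator_of_mem hx]
      refine (hg x).trans_eq ?_
      ring_nf
    · rw [indicator_of_notMem hx]
      rw [mem_annulus, not_and_or, not_le, not_le] at hx
      have key : ∃ c : ℝ, f =ᶠ[𝓝 x] fun _ => c := by
        rcases hx with hx | hx
        · refine ⟨1, ?_⟩
          filter_upwards [continuous_norm.continuousAt.eventually_lt continuousAt_const hx] with y hy
          exact h1 y hy.le
        · refine ⟨0, ?_⟩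
          filter_upwards [continuousAt_const.eventually_lt continuous_norm.continuousAt hx] with y hy
          exact h0 y hy.le
      obtain ⟨c, hc⟩ := key
      rw [hc.gradient_eq]
      simp
  refine ⟨fun x => χ x - η x, hχ.sub hη, fun x => ?_, fun x => by linarith [hχ1 x, hη0 x],
    fun x hx hx' => by beta_reduce; rw [hχi x hx', hηo x hx, sub_zero],
    fun x hx => by beta_reduce; rw [hχi x (by linarith), hηi x hx.le, sub_self],
    fun x hx => by beta_reduce; rw [hχo x hx, hηo x (by linarith), sub_self], fun x => ?_⟩
  · beta_reduce
    rcases le_total ‖x‖ b with hx | hx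
    · rw [hχi x hx]; linarith [hη1 x]
    · rw [hηo x (by linarith)]; linarith [hχ0 x]
  · rw [(HasGradientAt.sub (hasGradientAt_of_contDiffOn isOpen_univ hχ.contDiffOn (mem_univ x))
      (hasGradientAt_of_contDiffOn isOpen_univ hη.contDiffOn (mem_univ x))).gradient]
    refine (norm_sub_le _ _).trans ?_
    rw [add_comm]
    exact add_le_add (hgrad ha hηi hηo hηg x) (hgrad hb hχi hχo hχg x)

end Annulus

section Energy

open Module (finrank)

variable {E : Type*} [NormedAddCommGroup E] [InnerProductSpace ℝ E] [FiniteDimensional ℝ E]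
  [MeasurableSpace E] [BorelSpace E] {p κ R Q : ℝ} {u : E → ℝ}

variable (E) in
lemma log_annulus (hp : 1 < p) (hd : 2 ≤ finrank ℝ E) : ∃ C > 0, ∀ {u : E → ℝ} {R s : ℝ},
    IsPHarmonic p (ball 0 R \ {0}) u → (∀ x ∈ ball 0 R \ {0}, 0 < u x) → 0 < s → 4 * s < R →
      ∫ x in annulus E s, u x ^ (-p) * ‖gradient u x‖ ^ p ≤ C * s ^ (finrank ℝ E - p) := by
  have hprop := FiniteDimensional.proper ℝ E
  obtain ⟨C, hC, hlog⟩ := caccioppoli_log (E := E) hp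
  obtain ⟨K, hK, hcut⟩ := exists_annular_cutoff E
  set ω : ℝ := volume.real (ball (0 : E) 1) with hω
  have hnt : Nontrivial E := Module.nontrivial_of_finrank_pos (R := ℝ) (by omega)
  have hω0 : 0 < ω := volume_real_ball_pos E
  refine ⟨C * ((4 * K) ^ p * (5 ^ finrank ℝ E * ω)), by positivity, fun {u R s} hu hu0 hs hsR => ?_⟩
  have hΩ : IsOpen (ball (0 : E) R \ {0}) := isOpen_ball.sdiff isClosed_singleton
  obtain ⟨ζ, hζ, hζ0, hζ1, hζi, hζa, hζb, hζg⟩ := hcut (s / 2) (2 * s) (by positivity) (by linarith)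
  set K' : Set E := closedBall 0 (4 * s) \ ball 0 (s / 2) with hK'
  have hKc : IsCompact K' := (isCompact_closedBall 0 _).diff isOpen_ball
  have hζ0' : ∀ x ∉ K', ζ x = 0 := fun x hx => by
    rcases lt_or_ge ‖x‖ (s / 2) with h | h
    · exact hζa x h
    · refine hζb x ?_
      by_contra! hlt
      exact hx ⟨by simp; linarith, by simpa using h⟩
  have hKΩ : K' ⊆ ball 0 R \ {0} := fun x hx => by
    simp only [hK', Set.mem_sdiff, mem_closedBall, mem_ball, dist_zero_right, not_lt] at hx
    have : 0 < ‖x‖ := by linarith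
    exact ⟨by simp; linarith, by simpa using this⟩
  have hcs : HasCompactSupport ζ := HasCompactSupport.intro hKc hζ0'
  have hts : tsupport ζ ⊆ K' := closure_minimal (fun x hx => by
    by_contra hx'; exact hx (hζ0' x hx')) hKc.isClosed
  have h1 := hlog hΩ hu hu0 hζ hζ0 hcs (hts.trans hKΩ)
  have hp0 : 0 < p := by linarith
  have hcont : ContinuousOn (fun x => u x ^ (-p) * ‖gradient u x‖ ^ p) (ball 0 R \ {0}) :=
    (hu.1.continuousOn.rpow_const fun x hx => Or.inl (hu0 x hx).ne').mul
      ((continuousOn_gradient hΩ hu.1).norm.rpow_const fun _ _ => Or.inr hp0.le)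
  have hcont2 : ContinuousOn (fun x => ζ x ^ p * u x ^ (-p) * ‖gradient u x‖ ^ p)
      (ball 0 R \ {0}) := by
    refine (((hζ.continuous.rpow_const fun _ => Or.inr hp0.le).continuousOn).mul hcont).congr
      fun x _ => ?_
    simp only [mul_assoc, Pi.mul_apply]
  have hint := integrable_of_continuousOn_of_eq_zero hΩ hKc hKΩ hcont2 fun x hx => by
    rw [hζ0' x hx, Real.zero_rpow hp0.ne', zero_mul, zero_mul]
  have hAK : annulus E s ⊆ K' := fun x hx => by
    rw [mem_annulus] at hx
    simp only [hK', Set.mem_sdiff, mem_closedBall, mem_ball, dist_zero_right, not_lt]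
    constructor <;> linarith
  have hnn : ∀ x ∈ ball 0 R \ {0}, 0 ≤ u x ^ (-p) * ‖gradient u x‖ ^ p := fun x hx =>
    mul_nonneg (Real.rpow_nonneg (hu0 x hx).le _) (by positivity)
  have h2 : ∫ x in annulus E s, u x ^ (-p) * ‖gradient u x‖ ^ p ≤
      ∫ x, ζ x ^ p * u x ^ (-p) * ‖gradient u x‖ ^ p := by
    rw [setIntegral_congr_fun (isCompact_annulus s).isClosed.measurableSet
      (g := fun x => ζ x ^ p * u x ^ (-p) * ‖gradient u x‖ ^ p) fun x hx => ?_]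
    · refine setIntegral_le_integral hint (Eventually.of_forall fun x => ?_)
      by_cases hx : x ∈ K'
      · have := mul_nonneg (Real.rpow_nonneg (hζ0 x) p) (hnn x (hKΩ hx))
        simpa [mul_assoc] using this
      · simp [hζ0' x hx, Real.zero_rpow hp0.ne']
    · rw [mem_annulus] at hx
      simp [hζi x (by linarith) hx.2]
  have hg : ∀ x, ‖gradient ζ x‖ ^ p ≤
      (ball (0 : E) (5 * s)).indicator (fun _ => (4 * K / s) ^ p) x := fun x => by
    by_cases hx : x ∈ ball (0 : E) (5 * s)
    · rw [indicator_of_mem hx]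
      refine Real.rpow_le_rpow (norm_nonneg _) ((hζg x).trans ?_) hp0.le
      have e1 : (annulus E (s / 2)).indicator (fun _ => K / (s / 2)) x ≤ K / (s / 2) :=
        indicator_le_self' (fun _ _ => by positivity) x
      have e2 : (annulus E (2 * s)).indicator (fun _ => K / (2 * s)) x ≤ K / (2 * s) :=
        indicator_le_self' (fun _ _ => by positivity) x
      have e3 : K / (s / 2) + K / (2 * s) = (5 / 2) * (K / s) := by field_simp; ring
      have e4 : 4 * K / s = 4 * (K / s) := by ring
      have e5 : 0 < K / s := by positivity
      linarith
    · rw [indicator_of_notMem hx, gradient_eq_zero_of_notMem_tsupport fun h => hx ?_, norm_zero,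
        Real.zero_rpow hp0.ne']
      have := (hts h).1
      simp at this ⊢
      linarith
  have hvol : volume.real (ball (0 : E) (5 * s)) = 5 ^ finrank ℝ E * ω * s ^ (finrank ℝ E : ℝ) := by
    rw [measureReal_def, volume_ball_eq 0 (by positivity), ENNReal.toReal_ofReal (by positivity),
      Real.rpow_natCast, mul_pow]
    ring
  have h3 : ∫ x, ‖gradient ζ x‖ ^ p ≤ (4 * K / s) ^ p * volume.real (ball (0 : E) (5 * s)) := by
    have hib : Integrable ((ball (0 : E) (5 * s)).indicator fun _ => (4 * K / s) ^ p) :=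
      (integrable_indicator_iff measurableSet_ball).2 (integrableOn_const measure_ball_lt_top.ne)
    refine (integral_mono_of_nonneg (Eventually.of_forall fun x => by positivity) hib
      (Eventually.of_forall hg)).trans_eq ?_
    rw [integral_indicator measurableSet_ball, setIntegral_const, smul_eq_mul, mul_comm]
  refine h2.trans (h1.trans ?_)
  rw [mul_assoc C]
  refine mul_le_mul_of_nonneg_left (h3.trans_eq ?_) hC.le
  rw [hvol, Real.div_rpow (by positivity) hs.le, Real.rpow_sub hs]
  field_simp

end Energy

section Energy

open Module (finrank)

variable {E : Type*} [NormedAddCommGroup E] [InnerProductSpace ℝ E] [FiniteDimensional ℝ E]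
  {p κ R Q : ℝ} {u : E → ℝ}

/-- The quotient of `u` by the fundamental solution. -/
def quot (κ : ℝ) (u : E → ℝ) (x : E) : ℝ := u x / profile κ ‖x‖

lemma profile_eq (hκ0 : 0 < κ) (r : ℝ) : profile κ r = r ^ (-κ) / κ := if_neg hκ0.ne'

lemma profile_pos' (hκ0 : 0 < κ) {r : ℝ} (hr : 0 < r) : 0 < profile κ r := by
  rw [profile_eq hκ0]; positivity

omit [InnerProductSpace ℝ E] [FiniteDimensional ℝ E] in
lemma norm_pos_of_mem {x : E} (hx : x ∈ ball (0 : E) R \ {0}) : 0 < ‖x‖ := norm_pos_iff.2 hx.2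

omit [InnerProductSpace ℝ E] [FiniteDimensional ℝ E] in
lemma isOpen_punctured : IsOpen (ball (0 : E) R \ {0}) := isOpen_ball.sdiff isClosed_singleton

omit [FiniteDimensional ℝ E] in
lemma contDiffOn_quot (hκ0 : 0 < κ) (hu : ContDiffOn ℝ 1 u (ball 0 R \ {0})) :
    ContDiffOn ℝ 1 (quot κ u) (ball 0 R \ {0}) :=
  hu.div ((contDiffOn_profile_norm κ).mono fun _ hx => hx.2) fun _ hx =>
    (profile_pos' hκ0 (norm_pos_of_mem hx)).ne'

variable [MeasurableSpace E] [BorelSpace E]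

lemma volume_real_ball_mul {s c : ℝ} (hc : 0 < c) (hs : 0 < s) :
    volume.real (ball (0 : E) (c * s)) =
      c ^ finrank ℝ E * volume.real (ball (0 : E) 1) * s ^ (finrank ℝ E : ℝ) := by
  rw [measureReal_def, volume_ball_eq 0 (by positivity), ENNReal.toReal_ofReal (by positivity),
    Real.rpow_natCast, mul_pow]
  ring

lemma flux_annulus (hp : 1 < p) (hd : 2 ≤ finrank ℝ E) (hκ : κ * (p - 1) = finrank ℝ E - p)
    (hκ0 : 0 < κ) (hu : IsPHarmonic p (ball 0 R \ {0}) u) (hu0 : ∀ x ∈ ball 0 R \ {0}, 0 < u x)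
    (hQ0 : 0 < Q) (hQ : ∀ x, 0 < ‖x‖ → ‖x‖ ≤ R / 4 → u x ≤ Q * profile κ ‖x‖) :
    ∃ C > 0, ∀ s, 0 < s → s ≤ R / 8 → ∫ x in annulus E s, (quot κ u x * ‖pflux p (gradient u x)‖ +
      quot κ u x ^ p * ‖pflux p (gradient (fun y => profile κ ‖y‖) x)‖) ≤ C * s := by
  have hnt : Nontrivial E := Module.nontrivial_of_finrank_pos (R := ℝ) (by omega)
  obtain ⟨C, hC, hlog⟩ := log_annulus E hp hd
  set d : ℝ := (finrank ℝ E : ℝ) with hdd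
  set ω : ℝ := volume.real (ball (0 : E) 1) with hω
  have hω0 : 0 < ω := volume_real_ball_pos E
  have hp0 : 0 < p := by linarith
  refine ⟨(Q + Q ^ p) * (3 ^ finrank ℝ E * ω) + Q * (Q / κ) ^ p * C, by positivity,
    fun s hs hsR => ?_⟩
  have hsub : annulus E s ⊆ ball 0 R \ {0} := annulus_subset hs (by linarith)
  have hmeas : MeasurableSet (annulus E s) := (isCompact_annulus s).isClosed.measurableSet
  set W : E → ℝ := fun x => u x ^ (-p) * ‖gradient u x‖ ^ p with hW
  have hWi : IntegrableOn W (annulus E s) := by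
    refine ContinuousOn.integrableOn_compact (isCompact_annulus s) (ContinuousOn.mono ?_ hsub)
    exact (hu.1.continuousOn.rpow_const fun x hx => Or.inl (hu0 x hx).ne').mul
      ((continuousOn_gradient isOpen_punctured hu.1).norm.rpow_const fun _ _ => Or.inr hp0.le)
  have hbound : ∀ x ∈ annulus E s, quot κ u x * ‖pflux p (gradient u x)‖ +
      quot κ u x ^ p * ‖pflux p (gradient (fun y => profile κ ‖y‖) x)‖ ≤
      (Q + Q ^ p) * s ^ (1 - d) + Q * (Q / κ) ^ p * s ^ (1 - d + p) * W x := fun x hx => by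
    have hxp := norm_pos_of_mem (hsub hx)
    have hxu := hu0 x (hsub hx)
    rw [mem_annulus] at hx
    have hΦ := profile_pos' hκ0 hxp
    have hxQ := hQ x hxp (by linarith)
    have hq0 : 0 ≤ quot κ u x := (div_pos hxu hΦ).le
    have hqQ : quot κ u x ≤ Q := (div_le_iff₀ hΦ).2 hxQ
    have hlam : (s ^ (-κ - 1)) ^ (p - 1) = s ^ (1 - d) := by
      rw [← Real.rpow_mul hs.le]
      congr 1
      linarith
    have hΦs : ‖x‖ ^ (-κ) ≤ s ^ (-κ) := Real.rpow_le_rpow_of_nonpos hs hx.1 (by linarith)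
    have hus : u x ≤ Q / κ * s ^ (-κ) := by
      refine hxQ.trans ?_
      rw [profile_eq hκ0, div_mul_eq_mul_div, mul_div_assoc']
      gcongr
    set N := ‖gradient u x‖ with hN
    have hN0 : 0 ≤ N := norm_nonneg _
    have hNp : N ^ p = u x ^ p * W x := by
      rw [hW, ← mul_assoc, ← Real.rpow_add hxu, add_neg_cancel, Real.rpow_zero, one_mul]
    have hW0 : 0 ≤ W x := mul_nonneg (Real.rpow_nonneg hxu.le _) (by positivity)
    have hNp1 : N ^ (p - 1) ≤ s ^ (1 - d) + N ^ p * s ^ (κ + 1) := by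
      have hl0 : 0 < s ^ (-κ - 1) := Real.rpow_pos_of_pos hs _
      rcases le_total N (s ^ (-κ - 1)) with h | h
      · have := Real.rpow_le_rpow hN0 h (z := p - 1) (by linarith)
        rw [hlam] at this
        have h2 : 0 ≤ N ^ p * s ^ (κ + 1) := by positivity
        linarith
      · have hN1 : 0 < N := hl0.trans_le h
        have h3 : s ^ (κ + 1) = (s ^ (-κ - 1))⁻¹ := by
          rw [← Real.rpow_neg hs.le]; ring_nf
        have h4 : 0 ≤ s ^ (1 - d) := by positivity
        have h5 : N ^ (p - 1) ≤ N ^ p * s ^ (κ + 1) := by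
          rw [Real.rpow_sub_one hN1.ne', h3, div_eq_mul_inv]
          gcongr
        linarith
    have h6 : N ^ p * s ^ (κ + 1) ≤ (Q / κ) ^ p * s ^ (1 - d + p) * W x := by
      rw [hNp]
      have h7 : u x ^ p ≤ (Q / κ) ^ p * s ^ (-κ * p) := by
        rw [Real.rpow_mul hs.le, ← Real.mul_rpow (by positivity) (by positivity)]
        exact Real.rpow_le_rpow hxu.le hus hp0.le
      have h8 : s ^ (1 - d + p) = s ^ (-κ * p) * s ^ (κ + 1) := by
        rw [← Real.rpow_add hs]
        congr 1
        linarith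
      rw [h8]
      calc u x ^ p * W x * s ^ (κ + 1) ≤ (Q / κ) ^ p * s ^ (-κ * p) * W x * s ^ (κ + 1) := by
            gcongr
        _ = _ := by ring
    have h9 : ‖x‖ ^ (-κ - 1) ≤ s ^ (-κ - 1) := Real.rpow_le_rpow_of_nonpos hs hx.1 (by linarith)
    rw [norm_pflux hp, norm_pflux hp, norm_gradient_profile κ (norm_pos_iff.1 hxp)]
    calc quot κ u x * N ^ (p - 1) + quot κ u x ^ p * (‖x‖ ^ (-κ - 1)) ^ (p - 1)
        ≤ Q * (s ^ (1 - d) + (Q / κ) ^ p * s ^ (1 - d + p) * W x) +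
          Q ^ p * (s ^ (-κ - 1)) ^ (p - 1) := by
          gcongr
          exact hNp1.trans (by linarith)
      _ = _ := by rw [hlam]; ring
  have hfin : volume (annulus E s) ≠ ⊤ := (isCompact_annulus s).measure_lt_top.ne
  have hci : IntegrableOn (fun _ : E => (Q + Q ^ p) * s ^ (1 - d)) (annulus E s) :=
    integrableOn_const hfin
  have hri := hci.add (hWi.const_mul (Q * (Q / κ) ^ p * s ^ (1 - d + p)))
  have hvol : volume.real (annulus E s) ≤ 3 ^ finrank ℝ E * ω * s ^ d := by
    rw [hω, hdd, ← volume_real_ball_mul three_pos hs]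
    refine measureReal_mono (fun x hx => ?_) measure_ball_lt_top.ne
    rw [mem_annulus] at hx
    simp
    linarith
  refine (integral_mono_of_nonneg ?_ hri ((ae_restrict_iff' hmeas).2
    (Eventually.of_forall hbound))).trans ?_
  · refine (ae_restrict_iff' hmeas).2 (Eventually.of_forall fun x hx => ?_)
    have hq0 : 0 ≤ quot κ u x :=
      (div_pos (hu0 x (hsub hx)) (profile_pos' hκ0 (norm_pos_of_mem (hsub hx)))).le
    simp only [Pi.zero_apply]
    positivity
  · simp only [Pi.add_apply]
    rw [integral_add hci (hWi.const_mul _), setIntegral_const, integral_const_mul, smul_eq_mul]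
    have hl := hlog hu hu0 hs (by linarith)
    have e1 : s ^ (1 - d) * s ^ d = s := by
      rw [← Real.rpow_add hs, sub_add_cancel, Real.rpow_one]
    have e2 : s ^ (1 - d + p) * s ^ (d - p) = s := by
      rw [← Real.rpow_add hs, show 1 - d + p + (d - p) = 1 by ring, Real.rpow_one]
    calc volume.real (annulus E s) * ((Q + Q ^ p) * s ^ (1 - d)) +
          Q * (Q / κ) ^ p * s ^ (1 - d + p) * ∫ x in annulus E s, W x
        ≤ (3 ^ finrank ℝ E * ω * s ^ d) * ((Q + Q ^ p) * s ^ (1 - d)) +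
          Q * (Q / κ) ^ p * s ^ (1 - d + p) * (C * s ^ (d - p)) := by
          gcongr
      _ = (Q + Q ^ p) * (3 ^ finrank ℝ E * ω) * (s ^ (1 - d) * s ^ d) +
          Q * (Q / κ) ^ p * C * (s ^ (1 - d + p) * s ^ (d - p)) := by ring
      _ = _ := by rw [e1, e2]; ring

end Energy

section EnergyDensity

open Module (finrank)

variable {E : Type*} [NormedAddCommGroup E] [InnerProductSpace ℝ E] [FiniteDimensional ℝ E]
  {p κ R Q : ℝ} {u : E → ℝ}

/-- The energy density of the quotient of `u` by the fundamental solution. -/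
def energy (p κ : ℝ) (u : E → ℝ) (x : E) : ℝ :=
  ⟪pflux p (gradient u x) - pflux p (quot κ u x • gradient (fun y => profile κ ‖y‖) x),
    gradient (quot κ u) x⟫

lemma gradient_eq_quot (hκ0 : 0 < κ) (hu : ContDiffOn ℝ 1 u (ball 0 R \ {0})) {x : E}
    (hx : x ∈ ball 0 R \ {0}) : gradient u x =
      quot κ u x • gradient (fun y => profile κ ‖y‖) x +
        profile κ ‖x‖ • gradient (quot κ u) x := by
  have h1 := hasGradientAt_of_contDiffOn isOpen_punctured (contDiffOn_quot hκ0 hu) hx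
  have h2 := hasGradientAt_of_contDiffOn isOpen_compl_singleton (contDiffOn_profile_norm κ)
    (show x ∈ ({0}ᶜ : Set E) from hx.2)
  have h3 : u =ᶠ[𝓝 x] fun y => quot κ u y * profile κ ‖y‖ := by
    filter_upwards [isOpen_punctured.mem_nhds hx] with y hy
    rw [quot, div_mul_cancel₀ _ (profile_pos' hκ0 (norm_pos_of_mem hy)).ne']
  rw [h3.gradient_eq, (HasGradientAt.mul h1 h2).gradient]

lemma profile_mul_energy (hκ0 : 0 < κ) (hu : ContDiffOn ℝ 1 u (ball 0 R \ {0})) {x : E}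
    (hx : x ∈ ball 0 R \ {0}) : profile κ ‖x‖ * energy p κ u x =
      ⟪pflux p (gradient u x) - pflux p (quot κ u x • gradient (fun y => profile κ ‖y‖) x),
        gradient u x - quot κ u x • gradient (fun y => profile κ ‖y‖) x⟫ := by
  have h : gradient u x - quot κ u x • gradient (fun y => profile κ ‖y‖) x =
      profile κ ‖x‖ • gradient (quot κ u) x := by
    rw [gradient_eq_quot hκ0 hu hx, add_sub_cancel_left]
  rw [h, inner_smul_right, energy]

lemma energy_nonneg (hp : 1 < p) (hκ0 : 0 < κ) (hu : ContDiffOn ℝ 1 u (ball 0 R \ {0})) {x : E}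
    (hx : x ∈ ball 0 R \ {0}) : 0 ≤ energy p κ u x := by
  refine nonneg_of_mul_nonneg_right ?_ (profile_pos' hκ0 (norm_pos_of_mem hx))
  rw [profile_mul_energy hκ0 hu hx]
  exact pflux_mono hp _ _

lemma continuousOn_energy (hp : 1 < p) (hκ0 : 0 < κ) (hu : ContDiffOn ℝ 1 u (ball 0 R \ {0})) :
    ContinuousOn (energy p κ u) (ball 0 R \ {0}) := by
  have hq := contDiffOn_quot hκ0 hu
  refine ContinuousOn.inner (𝕜 := ℝ) (ContinuousOn.sub ?_ ?_)
    (continuousOn_gradient isOpen_punctured hq)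
  · exact (continuous_pflux hp).comp_continuousOn (continuousOn_gradient isOpen_punctured hu)
  · refine (continuous_pflux hp).comp_continuousOn (hq.continuousOn.smul ?_)
    exact (continuousOn_gradient isOpen_compl_singleton (contDiffOn_profile_norm κ)).mono
      fun _ h => h.2

variable [MeasurableSpace E] [BorelSpace E]

lemma energy_bound (hp : 1 < p) (hd : 2 ≤ finrank ℝ E) (hκ : κ * (p - 1) = finrank ℝ E - p)
    (hκ0 : 0 < κ) (hu : IsPHarmonic p (ball 0 R \ {0}) u) (hu0 : ∀ x ∈ ball 0 R \ {0}, 0 < u x)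
    (hR : 0 < R) (hQ0 : 0 < Q) (hQ : ∀ x, 0 < ‖x‖ → ‖x‖ ≤ R / 4 → u x ≤ Q * profile κ ‖x‖) :
    ∃ M, ∀ a, 0 < a → 2 * a ≤ R / 8 →
      ∫ x in closedBall 0 (R / 8) \ ball 0 (2 * a), energy p κ u x ≤ M := by
  have hprop := FiniteDimensional.proper ℝ E
  obtain ⟨C, hC, hcut⟩ := exists_annular_cutoff E
  obtain ⟨F, hF, hflux⟩ := flux_annulus hp hd hκ hκ0 hu hu0 hQ0 hQ
  refine ⟨2 * (C * F), fun a ha haR => ?_⟩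
  have hΩ : IsOpen (ball (0 : E) R \ {0}) := isOpen_punctured
  obtain ⟨ζ, hζ, hζ0, hζ1, hζi, hζa, hζb, hζg⟩ := hcut a (R / 8) ha haR
  set K : Set E := closedBall 0 (R / 4) \ ball 0 a with hK
  have hKc : IsCompact K := (isCompact_closedBall 0 _).diff isOpen_ball
  have hζK : ∀ x ∉ K, ζ x = 0 := fun x hx => by
    rcases lt_or_ge ‖x‖ a with h | h
    · exact hζa x h
    · refine hζb x ?_
      by_contra! hlt
      exact hx ⟨by simp; linarith, by simpa using h⟩
  have hKΩ : K ⊆ ball 0 R \ {0} := fun x hx => by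
    simp only [hK, Set.mem_sdiff, mem_closedBall, mem_ball, dist_zero_right, not_lt] at hx
    have : 0 < ‖x‖ := by linarith
    exact ⟨by simp; linarith, by simpa using this⟩
  have hsupp : ∀ {f : E → ℝ}, (∀ x ∉ K, f x = 0) → tsupport f ⊆ K := fun h =>
    closure_minimal (fun x hx => by by_contra hx'; exact hx (h x hx')) hKc.isClosed
  have hp0 : 0 < p := by linarith
  set G : E → E := gradient (fun y => profile κ ‖y‖) with hG
  set q := quot κ u with hqdef
  have hGc : ContinuousOn G (ball 0 R \ {0}) :=
    (continuousOn_gradient isOpen_compl_singleton (contDiffOn_profile_norm κ)).mono fun _ h => h.2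
  have hgc := continuousOn_gradient hΩ hu.1
  have hq := contDiffOn_quot hκ0 hu.1
  have hqpos : ∀ x ∈ ball 0 R \ {0}, 0 < q x := fun x hx =>
    div_pos (hu0 x hx) (profile_pos' hκ0 (norm_pos_of_mem hx))
  have hqp : ContDiffOn ℝ 1 (fun x => q x ^ p) (ball 0 R \ {0}) :=
    hq.rpow_const_of_ne fun x hx => (hqpos x hx).ne'
  set φ : E → ℝ := fun x => ζ x * q x with hφ
  set ψ : E → ℝ := fun x => ζ x * q x ^ p with hψ
  have hφ0 : ∀ x ∉ K, φ x = 0 := fun x hx => by rw [hφ]; simp [hζK x hx]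
  have hψ0 : ∀ x ∉ K, ψ x = 0 := fun x hx => by rw [hψ]; simp [hζK x hx]
  have hφd : ContDiff ℝ 1 φ :=
    contDiff_of_contDiffOn_of_eq_zero hΩ hKc.isClosed hKΩ (hζ.contDiffOn.mul hq) hφ0
  have hψd : ContDiff ℝ 1 ψ :=
    contDiff_of_contDiffOn_of_eq_zero hΩ hKc.isClosed hKΩ (hζ.contDiffOn.mul hqp) hψ0
  have hgφ : ∀ x ∉ K, gradient φ x = 0 := fun x hx =>
    gradient_eq_zero_of_notMem_tsupport fun h => hx (hsupp hφ0 h)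
  have hgψ : ∀ x ∉ K, gradient ψ x = 0 := fun x hx =>
    gradient_eq_zero_of_notMem_tsupport fun h => hx (hsupp hψ0 h)
  have I1 : ∫ x, ⟪pflux p (gradient u x), gradient φ x⟫ = 0 :=
    hu.2 φ hφd (HasCompactSupport.intro hKc hφ0) ((hsupp hφ0).trans hKΩ)
  have I2 : ∫ x, ⟪pflux p (G x), gradient ψ x⟫ = 0 :=
    (isPHarmonic_profile hκ).2 ψ hψd (HasCompactSupport.intro hKc hψ0)
      (((hsupp hψ0).trans hKΩ).trans fun _ h => h.2)
  have J1 : Integrable fun x => ⟪pflux p (gradient u x), gradient φ x⟫ :=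
    integrable_of_continuousOn_of_eq_zero hΩ hKc hKΩ
      (((continuous_pflux hp).comp_continuousOn hgc).inner
        (continuousOn_gradient hΩ hφd.contDiffOn)) fun x hx => by rw [hgφ x hx, inner_zero_right]
  have J2 : Integrable fun x => ⟪pflux p (G x), gradient ψ x⟫ :=
    integrable_of_continuousOn_of_eq_zero hΩ hKc hKΩ
      (((continuous_pflux hp).comp_continuousOn hGc).inner
        (continuousOn_gradient hΩ hψd.contDiffOn)) fun x hx => by rw [hgψ x hx, inner_zero_right]
  set H : E → ℝ := fun x => q x * ‖pflux p (gradient u x)‖ + q x ^ p * ‖pflux p (G x)‖ with hH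
  have hHc : ContinuousOn H (ball 0 R \ {0}) :=
    (hq.continuousOn.mul ((continuous_pflux hp).comp_continuousOn hgc).norm).add
      (hqp.continuousOn.mul ((continuous_pflux hp).comp_continuousOn hGc).norm)
  have hAm : ∀ s : ℝ, MeasurableSet (annulus E s) := fun s =>
    (isCompact_annulus s).isClosed.measurableSet
  have JH : ∀ s : ℝ, 0 < s → s ≤ R / 8 →
      Integrable ((annulus E s).indicator fun x => C / s * H x) := fun s hs hsR =>
    (integrable_indicator_iff (hAm s)).2 (((hHc.mono
      (annulus_subset hs (by linarith))).integrableOn_compact (isCompact_annulus s)).const_mul _)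
  have IH : ∀ s : ℝ, 0 < s → s ≤ R / 8 →
      ∫ x, (annulus E s).indicator (fun x => C / s * H x) x ≤ C * F := fun s hs hsR => by
    rw [integral_indicator (hAm s), integral_const_mul]
    calc C / s * ∫ x in annulus E s, H x ≤ C / s * (F * s) := by
          gcongr
          exact hflux s hs hsR
      _ = C * F := by field_simp
  have hpt : ∀ x, ζ x * energy p κ u x ≤ (⟪pflux p (gradient u x), gradient φ x⟫ -
      p⁻¹ * ⟪pflux p (G x), gradient ψ x⟫) + ((annulus E a).indicator (fun x => C / a * H x) x +
        (annulus E (R / 8)).indicator (fun x => C / (R / 8) * H x) x) := fun x => by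
    have hHi : ∀ s : ℝ, (annulus E s).indicator (fun x => C / s * H x) x =
        (annulus E s).indicator (fun _ => C / s) x * H x := fun s => by
      by_cases hx : x ∈ annulus E s <;> simp [hx]
    rw [hHi, hHi, ← add_mul]
    by_cases hx : x ∈ K
    · have hxΩ := hKΩ hx
      have hqx := hqpos x hxΩ
      have g1 := hasGradientAt_of_contDiffOn hΩ hq hxΩ
      have g2 := hasGradientAt_of_contDiffOn isOpen_univ hζ.contDiffOn (mem_univ x)
      have g3 : gradient φ x = ζ x • gradient q x + q x • gradient ζ x :=
        (HasGradientAt.mul g2 g1).gradient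
      have g4 : gradient ψ x =
          ζ x • ((p * q x ^ (p - 1)) • gradient q x) + q x ^ p • gradient ζ x :=
        (HasGradientAt.mul g2 (HasGradientAt.comp (f := q)
          (Real.hasDerivAt_rpow_const (Or.inl hqx.ne')) g1)).gradient
      have c1 := abs_real_inner_le_norm (pflux p (gradient u x)) (gradient ζ x)
      have c2 := abs_real_inner_le_norm (pflux p (G x)) (gradient ζ x)
      rw [energy, pflux_smul hqx, g3, g4]
      simp only [inner_add_right, inner_smul_right, inner_sub_left, inner_smul_left, conj_trivial,
        ← hG, ← hqdef]
      have hHx : 0 ≤ H x := by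
        have := hqx.le
        rw [hH]; positivity
      have h1 := mul_le_mul_of_nonneg_right (hζg x) hHx
      have h2 : -(q x * ⟪pflux p (gradient u x), gradient ζ x⟫) ≤
          q x * (‖pflux p (gradient u x)‖ * ‖gradient ζ x‖) := by
        rw [← mul_neg]
        exact mul_le_mul_of_nonneg_left ((neg_le_abs _).trans c1) hqx.le
      have h3 : p⁻¹ * (q x ^ p * ⟪pflux p (G x), gradient ζ x⟫) ≤
          q x ^ p * (‖pflux p (G x)‖ * ‖gradient ζ x‖) := by
        have hqp0 : 0 ≤ q x ^ p := by positivity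
        have e : q x ^ p * ⟪pflux p (G x), gradient ζ x⟫ ≤
          q x ^ p * (‖pflux p (G x)‖ * ‖gradient ζ x‖) :=
          mul_le_mul_of_nonneg_left ((le_abs_self _).trans c2) hqp0
        calc _ ≤ p⁻¹ * (q x ^ p * (‖pflux p (G x)‖ * ‖gradient ζ x‖)) :=
              mul_le_mul_of_nonneg_left e (inv_nonneg.2 hp0.le)
          _ ≤ 1 * (q x ^ p * (‖pflux p (G x)‖ * ‖gradient ζ x‖)) := by
              gcongr
              exact inv_le_one_of_one_le₀ hp.le
          _ = _ := one_mul _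
      have h4 : p⁻¹ * (ζ x * (p * q x ^ (p - 1) * ⟪pflux p (G x), gradient q x⟫)) =
          ζ x * (q x ^ (p - 1) * ⟪pflux p (G x), gradient q x⟫) := by
        field_simp
      have h5 : ‖gradient ζ x‖ * H x = q x * (‖pflux p (gradient u x)‖ * ‖gradient ζ x‖) +
          q x ^ p * (‖pflux p (G x)‖ * ‖gradient ζ x‖) := by
        rw [hH]; ring
      rw [mul_add p⁻¹, h4]
      linarith
    · rw [hζK x hx, hgφ x hx, hgψ x hx, zero_mul, inner_zero_right, inner_zero_right, mul_zero,
        sub_zero, zero_add]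
      by_cases hxΩ : x ∈ ball 0 R \ {0}
      · have hqx := (hqpos x hxΩ).le
        have hHx : 0 ≤ H x := by
          rw [hH]; positivity
        exact mul_nonneg ((norm_nonneg _).trans (hζg x)) hHx
      · have : ∀ s : ℝ, 0 < s → s ≤ R / 8 → x ∉ annulus E s := fun s hs hsR h =>
          hxΩ (annulus_subset hs (by linarith) h)
        simp [this a ha (by linarith), this (R / 8) (by positivity) le_rfl]
  have hζe : Integrable fun x => ζ x * energy p κ u x :=
    integrable_of_continuousOn_of_eq_zero hΩ hKc hKΩ
      (hζ.continuous.continuousOn.mul (continuousOn_energy hp hκ0 hu.1)) fun x hx => by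
        simp [hζK x hx]
  have J3 : Integrable fun x => ⟪pflux p (gradient u x), gradient φ x⟫ -
      p⁻¹ * ⟪pflux p (G x), gradient ψ x⟫ := J1.sub (J2.const_mul _)
  have J4 : Integrable fun x => (annulus E a).indicator (fun x => C / a * H x) x +
      (annulus E (R / 8)).indicator (fun x => C / (R / 8) * H x) x :=
    (JH a ha (by linarith)).add (JH (R / 8) (by positivity) le_rfl)
  set S : Set E := closedBall 0 (R / 8) \ ball 0 (2 * a) with hS
  have hSm : MeasurableSet S := measurableSet_closedBall.diff measurableSet_ball
  calc ∫ x in S, energy p κ u x = ∫ x in S, ζ x * energy p κ u x := by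
        refine setIntegral_congr_fun hSm fun x hx => ?_
        simp only [hS, Set.mem_sdiff, mem_closedBall, mem_ball, dist_zero_right, not_lt] at hx
        rw [hζi x hx.2 hx.1, one_mul]
    _ ≤ ∫ x, ζ x * energy p κ u x := by
        refine setIntegral_le_integral hζe (Eventually.of_forall fun x => ?_)
        by_cases hx : x ∈ K
        · exact mul_nonneg (hζ0 x) (energy_nonneg hp hκ0 hu.1 (hKΩ hx))
        · simp [hζK x hx]
    _ ≤ _ := integral_mono hζe (J3.add J4) hpt
    _ ≤ 2 * (C * F) := by
        rw [integral_add' J3 J4, integral_sub J1 (J2.const_mul _), integral_const_mul, I1, I2,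
          integral_add (JH a ha (by linarith)) (JH (R / 8) (by positivity) le_rfl)]
        linarith [IH a ha (by linarith), IH (R / 8) (by positivity) le_rfl]

end EnergyDensity

section EnergyTail

open Module (finrank)

variable {E : Type*} [NormedAddCommGroup E] [InnerProductSpace ℝ E] [FiniteDimensional ℝ E]
  [MeasurableSpace E] [BorelSpace E] {p κ R Q : ℝ} {u : E → ℝ}

lemma energy_tail (hp : 1 < p) (hd : 2 ≤ finrank ℝ E) (hκ : κ * (p - 1) = finrank ℝ E - p)
    (hκ0 : 0 < κ) (hu : IsPHarmonic p (ball 0 R \ {0}) u) (hu0 : ∀ x ∈ ball 0 R \ {0}, 0 < u x)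
    (hR : 0 < R) (hQ0 : 0 < Q) (hQ : ∀ x, 0 < ‖x‖ → ‖x‖ ≤ R / 4 → u x ≤ Q * profile κ ‖x‖)
    {ε : ℝ} (hε : 0 < ε) : ∃ r₁ > 0, ∀ r, 0 < r → r < r₁ →
      ∫⁻ x in closedBall 0 (2 * r) \ {0}, ENNReal.ofReal (energy p κ u x) ≤ ENNReal.ofReal ε := by
  have hprop := FiniteDimensional.proper ℝ E
  have hnt : Nontrivial E := Module.nontrivial_of_finrank_pos (R := ℝ) (by omega)
  obtain ⟨M, hM⟩ := energy_bound hp hd hκ hκ0 hu hu0 hR hQ0 hQ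
  set T : ℕ → Set E := fun n => closedBall 0 (R / 8) \ ball 0 (2 * (R / 16 / (n + 1))) with hT
  have hTmono : Monotone T := fun m n hmn => by
    refine Set.sdiff_subset_sdiff_right (ball_subset_ball ?_)
    gcongr
  have hTU : ⋃ n, T n = closedBall 0 (R / 8) \ {0} := by
    ext x
    simp only [hT, mem_iUnion, Set.mem_sdiff, mem_closedBall, mem_ball, dist_zero_right, not_lt,
      mem_singleton_iff]
    constructor
    · rintro ⟨n, h1, h2⟩
      have : 0 < 2 * (R / 16 / ((n : ℝ) + 1)) := by positivity
      exact ⟨h1, norm_pos_iff.1 (this.trans_le h2)⟩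
    · rintro ⟨h1, h2⟩
      have hx := norm_pos_iff.2 h2
      obtain ⟨n, hn⟩ := exists_nat_gt (R / 8 / ‖x‖)
      refine ⟨n, h1, ?_⟩
      rw [div_lt_iff₀ hx] at hn
      have hn1 : (0 : ℝ) < (n : ℝ) + 1 := by positivity
      rw [show 2 * (R / 16 / ((n : ℝ) + 1)) = R / 8 / (n + 1) by ring, div_le_iff₀ hn1]
      nlinarith
  have hTb : ∀ n, ∫⁻ x in T n, ENNReal.ofReal (energy p κ u x) ≤ ENNReal.ofReal M := fun n => by
    have hn1 : (0 : ℝ) < (n : ℝ) + 1 := by positivity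
    have ha : 0 < R / 16 / ((n : ℝ) + 1) := by positivity
    have ha2 : R / 16 / ((n : ℝ) + 1) ≤ R / 16 := div_le_self (by positivity) (by linarith)
    have hTs : T n ⊆ ball 0 R \ {0} := fun x hx => by
      simp only [hT, Set.mem_sdiff, mem_closedBall, mem_ball, dist_zero_right, not_lt] at hx
      have : 0 < ‖x‖ := by linarith
      exact ⟨by simp; linarith, by simpa using this⟩
    have hTc : IsCompact (T n) := (isCompact_closedBall 0 _).diff isOpen_ball
    rw [← ofReal_integral_eq_lintegral_ofReal
      (((continuousOn_energy hp hκ0 hu.1).mono hTs).integrableOn_compact hTc)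
      ((ae_restrict_iff' hTc.isClosed.measurableSet).2
        (Eventually.of_forall fun x hx => energy_nonneg hp hκ0 hu.1 (hTs hx)))]
    exact ENNReal.ofReal_le_ofReal (hM _ ha (by linarith))
  have hfin : ∫⁻ x in closedBall 0 (R / 8) \ {0}, ENNReal.ofReal (energy p κ u x) ≠ ⊤ := by
    rw [← hTU, setLIntegral_iUnion_of_directed _ hTmono.directed_le]
    exact ((iSup_le hTb).trans_lt ENNReal.ofReal_lt_top).ne
  have hlim : Tendsto (volume.restrict (closedBall (0 : E) (R / 8) \ {0}) ∘
      fun r : ℝ => closedBall (0 : E) (2 * r)) (𝓝[>] 0) (𝓝 0) := by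
    have h1 : Tendsto (fun r : ℝ => ENNReal.ofReal
        ((3 * r) ^ finrank ℝ E * volume.real (ball (0 : E) 1))) (𝓝[>] 0) (𝓝 0) := by
      have hc : Continuous fun r : ℝ => ENNReal.ofReal
          ((3 * r) ^ finrank ℝ E * volume.real (ball (0 : E) 1)) :=
        ENNReal.continuous_ofReal.comp (by fun_prop)
      have h0 := hc.tendsto 0
      rw [mul_zero, zero_pow (by omega), zero_mul, ENNReal.ofReal_zero] at h0
      exact h0.mono_left nhdsWithin_le_nhds
    refine tendsto_of_tendsto_of_tendsto_of_le_of_le' tendsto_const_nhds h1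
      (Eventually.of_forall fun _ => zero_le) ?_
    filter_upwards [self_mem_nhdsWithin] with r hr
    rw [← volume_ball_eq (0 : E) (mul_pos three_pos hr)]
    refine (Measure.restrict_apply_le _ _).trans (measure_mono (closedBall_subset_ball ?_))
    have : 0 < r := hr
    linarith
  have hev := (tendsto_setLIntegral_zero hfin hlim).eventually
    (ge_mem_nhds (ENNReal.ofReal_pos.2 hε))
  obtain ⟨r₁, hr₁, h⟩ := mem_nhdsGT_iff_exists_Ioo_subset.1 hev
  refine ⟨min r₁ (R / 16), lt_min hr₁ (by positivity), fun r hr hrr => ?_⟩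
  have h2 := h ⟨hr, hrr.trans_le (min_le_left _ _)⟩
  have h3 := hrr.trans_le (min_le_right _ _)
  beta_reduce at h2
  rw [Set.mem_ofPred_eq, Measure.restrict_restrict measurableSet_closedBall] at h2
  have hsub : closedBall (0 : E) (2 * r) \ {0} ⊆
      closedBall 0 (2 * r) ∩ (closedBall 0 (R / 8) \ {0}) := fun x hx => by
    refine ⟨hx.1, ?_, hx.2⟩
    have := hx.1
    rw [mem_closedBall_zero_iff] at this ⊢
    linarith
  exact (lintegral_mono_set hsub).trans h2

lemma gradient_quot_small (hp : 1 < p) (hd : 2 ≤ finrank ℝ E)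
    (hκ : κ * (p - 1) = finrank ℝ E - p)
    (hκ0 : 0 < κ) (hu : IsPHarmonic p (ball 0 R \ {0}) u) (hu0 : ∀ x ∈ ball 0 R \ {0}, 0 < u x)
    (hR : 0 < R) (hQ0 : 0 < Q) (hQ : ∀ x, 0 < ‖x‖ → ‖x‖ ≤ R / 4 → u x ≤ Q * profile κ ‖x‖)
    {ε : ℝ} (hε : 0 < ε) : ∃ r₁ > 0, ∀ r, 0 < r → r < r₁ →
      ∫⁻ x in closedBall 0 (2 * r) \ ball 0 (r / 2), ‖gradient (quot κ u) x‖ₑ ≤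
        ENNReal.ofReal (ε * r ^ ((finrank ℝ E : ℝ) - 1)) := by
  have hnt : Nontrivial E := Module.nontrivial_of_finrank_pos (R := ℝ) (by omega)
  set d : ℝ := (finrank ℝ E : ℝ) with hdd
  set ω : ℝ := volume.real (ball (0 : E) 1) with hω
  have hω0 : 0 < ω := volume_real_ball_pos E
  set A : ℝ := κ * 2 ^ κ * (3 ^ finrank ℝ E * ω) with hA
  have hA0 : 0 < A := by positivity
  obtain ⟨c, hc, hco⟩ := pflux_coercive (E := E) hp (Q * 2 ^ (κ + 1))
    (show 0 < ε / (2 * A) by positivity)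
  obtain ⟨r₁, hr₁, htail⟩ := energy_tail hp hd hκ hκ0 hu hu0 hR hQ0 hQ
    (show 0 < c * ε / 2 by positivity)
  refine ⟨min r₁ (R / 8), lt_min hr₁ (by positivity), fun r hr hrr => ?_⟩
  have hr1 := hrr.trans_le (min_le_left _ _)
  have hr2 := hrr.trans_le (min_le_right _ _)
  set δ := ε / (2 * A) with hδ
  have hpt : ∀ x ∈ closedBall (0 : E) (2 * r) \ ball 0 (r / 2), ‖gradient (quot κ u) x‖ ≤
      δ * (κ * 2 ^ κ) * r⁻¹ + c⁻¹ * r ^ (d - 1) * energy p κ u x := fun x hx => by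
    simp only [Set.mem_sdiff, mem_closedBall, mem_ball, dist_zero_right, not_lt] at hx
    have hxp : 0 < ‖x‖ := by linarith
    have hxΩ : x ∈ ball (0 : E) R \ {0} := ⟨by simp; linarith, by simpa using hxp⟩
    have hΦ := profile_pos' hκ0 hxp
    have hq0 : 0 < quot κ u x := div_pos (hu0 x hxΩ) hΦ
    have hqQ : quot κ u x ≤ Q := (div_le_iff₀ hΦ).2 (hQ x hxp (by linarith))
    set ν := r ^ (κ + 1) with hν
    have hν0 : 0 < ν := by positivity
    set b : E := quot κ u x • gradient (fun y => profile κ ‖y‖) x with hb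
    have hrx : r ≤ 2 * ‖x‖ := by linarith [hx.2]
    have hbn : ‖ν • b‖ ≤ Q * 2 ^ (κ + 1) := by
      rw [norm_smul, hb, norm_smul, norm_gradient_profile κ (norm_pos_iff.1 hxp),
        Real.norm_of_nonneg hν0.le, Real.norm_of_nonneg hq0.le]
      have h1 : ν * ‖x‖ ^ (-κ - 1) ≤ 2 ^ (κ + 1) := by
        rw [show -κ - 1 = -(κ + 1) by ring, Real.rpow_neg hxp.le, ← div_eq_mul_inv,
          div_le_iff₀ (by positivity), ← Real.mul_rpow two_pos.le hxp.le]
        exact Real.rpow_le_rpow hr.le hrx (by linarith)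
      calc ν * (quot κ u x * ‖x‖ ^ (-κ - 1)) = quot κ u x * (ν * ‖x‖ ^ (-κ - 1)) := by ring
        _ ≤ Q * 2 ^ (κ + 1) := by gcongr
    have h2 := hco (ν • b) hbn (ν • gradient u x)
    have hab : gradient u x - b = profile κ ‖x‖ • gradient (quot κ u) x := by
      rw [gradient_eq_quot hκ0 hu.1 hxΩ, ← hb, add_sub_cancel_left]
    have hen := profile_mul_energy (p := p) hκ0 hu.1 hxΩ
    rw [← hb] at hen
    rw [pflux_smul hν0, pflux_smul hν0, ← smul_sub, ← smul_sub, inner_smul_left, inner_smul_right,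
      ← hen, hab, norm_smul, norm_smul, Real.norm_of_nonneg hν0.le, Real.norm_of_nonneg hΦ.le] at h2
    simp only [conj_trivial] at h2
    have hνp : ν ^ (p - 1) = r ^ (d - 1) := by
      rw [hν, ← Real.rpow_mul hr.le]
      congr 1
      linarith
    rw [hνp] at h2
    have hνΦ : κ * 2 ^ κ * r⁻¹ * (ν * profile κ ‖x‖) ≥ 1 := by
      rw [profile_eq hκ0, Real.rpow_neg hxp.le, hν, Real.rpow_add_one hr.ne']
      have h3 : ‖x‖ ^ κ ≤ 2 ^ κ * r ^ κ := by
        rw [← Real.mul_rpow two_pos.le hr.le]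
        exact Real.rpow_le_rpow hxp.le hx.1 hκ0.le
      have h4 : 0 < ‖x‖ ^ κ := by positivity
      calc κ * 2 ^ κ * r⁻¹ * (r ^ κ * r * ((‖x‖ ^ κ)⁻¹ / κ)) = 2 ^ κ * r ^ κ / ‖x‖ ^ κ := by
            field_simp
        _ ≥ 1 := (one_le_div h4).2 h3
    have hw : 0 < ν * profile κ ‖x‖ := by positivity
    refine le_of_mul_le_mul_left ?_ hw
    have h5 : ν * profile κ ‖x‖ * ‖gradient (quot κ u) x‖ ≤
        δ + c⁻¹ * (r ^ (d - 1) * (ν * (profile κ ‖x‖ * energy p κ u x))) := by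
      rw [← sub_le_iff_le_add', inv_mul_eq_div, le_div_iff₀ hc]
      linarith
    have h6 : δ ≤ δ * (κ * 2 ^ κ * r⁻¹ * (ν * profile κ ‖x‖)) :=
      le_mul_of_one_le_right (by positivity) hνΦ
    calc _ ≤ _ := h5
      _ ≤ δ * (κ * 2 ^ κ * r⁻¹ * (ν * profile κ ‖x‖)) + c⁻¹ * (r ^ (d - 1) *
          (ν * (profile κ ‖x‖ * energy p κ u x))) := by gcongr
      _ = _ := by ring
  set S : Set E := closedBall 0 (2 * r) \ ball 0 (r / 2) with hS
  have hSm : MeasurableSet S := measurableSet_closedBall.diff measurableSet_ball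
  have hS0 : S ⊆ closedBall 0 (2 * r) \ {0} := fun x hx => ⟨hx.1, fun h => hx.2 (by
    rw [mem_singleton_iff.1 h]; exact mem_ball_self (by positivity))⟩
  have hvol : volume S ≤ ENNReal.ofReal (3 ^ finrank ℝ E * ω * r ^ d) := by
    refine (measure_mono (Set.sdiff_subset.trans (closedBall_subset_ball
      (show 2 * r < 3 * r by linarith)))).trans_eq ?_
    rw [← ofReal_measureReal measure_ball_lt_top.ne, volume_real_ball_mul three_pos hr]
  have hrd : r⁻¹ * r ^ d = r ^ (d - 1) := by
    rw [Real.rpow_sub_one hr.ne', div_eq_inv_mul]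
  calc ∫⁻ x in S, ‖gradient (quot κ u) x‖ₑ
      ≤ ∫⁻ x in S, (ENNReal.ofReal (δ * (κ * 2 ^ κ) * r⁻¹) +
          ENNReal.ofReal (c⁻¹ * r ^ (d - 1)) * ENNReal.ofReal (energy p κ u x)) := by
        refine setLIntegral_mono' hSm fun x hx => ?_
        rw [← ofReal_norm, ← ENNReal.ofReal_mul (by positivity)]
        exact (ENNReal.ofReal_le_ofReal (hpt x hx)).trans ENNReal.ofReal_add_le
    _ = ENNReal.ofReal (δ * (κ * 2 ^ κ) * r⁻¹) * volume S + ENNReal.ofReal (c⁻¹ * r ^ (d - 1)) *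
          ∫⁻ x in S, ENNReal.ofReal (energy p κ u x) := by
        rw [lintegral_add_left measurable_const, setLIntegral_const,
          lintegral_const_mul' _ _ ENNReal.ofReal_ne_top]
    _ ≤ ENNReal.ofReal (δ * (κ * 2 ^ κ) * r⁻¹) * ENNReal.ofReal (3 ^ finrank ℝ E * ω * r ^ d) +
          ENNReal.ofReal (c⁻¹ * r ^ (d - 1)) * ENNReal.ofReal (c * ε / 2) := by
        gcongr
        exact (lintegral_mono_set hS0).trans (htail r hr hr1)
    _ = ENNReal.ofReal (ε * r ^ (d - 1)) := by
        rw [← ENNReal.ofReal_mul (by positivity), ← ENNReal.ofReal_mul (by positivity),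
          ← ENNReal.ofReal_add (by positivity) (by positivity)]
        congr 1
        have e1 : δ * A = ε / 2 := by rw [hδ]; field_simp
        calc _ = δ * A * (r⁻¹ * r ^ d) + c⁻¹ * c * (ε / 2) * r ^ (d - 1) := by rw [hA]; ring
          _ = _ := by rw [e1, hrd, inv_mul_cancel₀ hc.ne']; ring

end EnergyTail

section Oscillation

open Module (finrank)

variable {E : Type*} [NormedAddCommGroup E] [InnerProductSpace ℝ E] [FiniteDimensional ℝ E]
  [MeasurableSpace E] [BorelSpace E] {p κ R Q : ℝ} {u : E → ℝ}

lemma quot_equicontinuous (hp : 1 < p) (hd : 2 ≤ finrank ℝ E) (hκ0 : 0 < κ)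
    (hu : IsPHarmonic p (ball 0 R \ {0}) u) (hu0 : ∀ x ∈ ball 0 R \ {0}, 0 < u x)
    (hQ0 : 0 < Q) (hQ : ∀ x, 0 < ‖x‖ → ‖x‖ ≤ R / 4 → u x ≤ Q * profile κ ‖x‖)
    {η : ℝ} (hη : 0 < η) : ∃ τ > 0, τ ≤ 1 / 8 ∧ ∀ x y : E, 0 < ‖x‖ → ‖x‖ ≤ R / 8 →
      ‖y - x‖ < τ * ‖x‖ → |quot κ u y - quot κ u x| ≤ η := by
  obtain ⟨θ, hθ0, hθ1, hosc⟩ := oscillation_decay E hp hd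
  obtain ⟨n, hn⟩ := exists_pow_lt_of_lt_one (show 0 < η / (2 * (Q * 2 ^ κ)) by positivity) hθ1
  have hc : ContinuousAt (fun t : ℝ => t ^ κ) 1 :=
    Real.continuousAt_rpow_const _ _ (Or.inl one_ne_zero)
  obtain ⟨δ, hδ, hδt⟩ := Metric.continuousAt_iff.1 hc (η / (2 * Q)) (by positivity)
  refine ⟨min (1 / 8) (min (1 / 2 / 2 ^ n) (δ / 2)), by positivity, min_le_left _ _,
    fun x y hx hxR hxy => ?_⟩
  set τ := min (1 / 8 : ℝ) (min (1 / 2 / 2 ^ n) (δ / 2)) with hτ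
  have t1 : τ ≤ 1 / 8 := min_le_left _ _
  have t2 : τ ≤ 1 / 2 / 2 ^ n := (min_le_right _ _).trans (min_le_left _ _)
  have t3 : τ ≤ δ / 2 := (min_le_right _ _).trans (min_le_right _ _)
  have hbn : ∀ z ∈ ball x (‖x‖ / 2), ‖x‖ / 2 < ‖z‖ ∧ ‖z‖ < 3 / 2 * ‖x‖ := fun z hz => by
    rw [mem_ball_iff_norm] at hz
    have h1 := abs_le.1 (abs_norm_sub_norm_le z x)
    constructor <;> linarith
  have hΩ : ∀ z ∈ ball x (‖x‖ / 2), z ∈ ball (0 : E) R \ {0} := fun z hz => by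
    have := hbn z hz
    have hz0 : 0 < ‖z‖ := by linarith
    exact ⟨by simp; linarith, by simpa using hz0⟩
  have hle : ∀ z ∈ ball x (‖x‖ / 2), u z ≤ Q * profile κ (‖x‖ / 2) := fun z hz => by
    have := hbn z hz
    refine (hQ z (by linarith) (by linarith)).trans ?_
    gcongr
    exact (profile_strictAntiOn κ).antitoneOn (half_pos hx : (0 : ℝ) < ‖x‖ / 2)
      (by simp only [mem_Ioi]; linarith) this.1.le
  have h1 := hosc n (half_pos hx) (hu.mono hΩ) (fun z hz => (hu0 z (hΩ z hz)).le) hle y (by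
    rw [mem_ball_iff_norm]
    refine hxy.trans_le ?_
    calc τ * ‖x‖ ≤ 1 / 2 / 2 ^ n * ‖x‖ := by gcongr
      _ = ‖x‖ / 2 / 2 ^ n := by ring)
  have hyb : y ∈ ball x (‖x‖ / 2) := by
    rw [mem_ball_iff_norm]
    refine hxy.trans_le ?_
    nlinarith
  have hy := hbn y hyb
  have hyp : 0 < ‖y‖ := by linarith
  have hyΦ := profile_pos' hκ0 hyp
  have hxΦ := profile_pos' hκ0 hx
  have hqy0 : 0 ≤ quot κ u y := (div_pos (hu0 y (hΩ y hyb)) hyΦ).le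
  have hqyQ : quot κ u y ≤ Q := (div_le_iff₀ hyΦ).2 (hQ y hyp (by linarith))
  have hrat : profile κ ‖y‖ / profile κ ‖x‖ = (‖x‖ / ‖y‖) ^ κ := by
    rw [profile_eq hκ0, profile_eq hκ0, Real.div_rpow hx.le hyp.le, Real.rpow_neg hx.le,
      Real.rpow_neg hyp.le]
    field_simp
  have hdec : quot κ u y - quot κ u x =
      (u y - u x) / profile κ ‖x‖ - quot κ u y * ((‖x‖ / ‖y‖) ^ κ - 1) := by
    rw [← hrat, quot, quot]
    field_simp
    ring
  have h2 : |(u y - u x) / profile κ ‖x‖| ≤ η / 2 := by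
    rw [abs_div, abs_of_pos hxΦ, div_le_iff₀ hxΦ]
    refine h1.trans ?_
    have e : profile κ (‖x‖ / 2) = 2 ^ κ * profile κ ‖x‖ := by
      rw [profile_eq hκ0, profile_eq hκ0, Real.div_rpow hx.le two_pos.le, Real.rpow_neg two_pos.le]
      field_simp
    rw [sub_zero, e]
    calc θ ^ n * (Q * (2 ^ κ * profile κ ‖x‖))
        ≤ η / (2 * (Q * 2 ^ κ)) * (Q * (2 ^ κ * profile κ ‖x‖)) := by gcongr
      _ = _ := by field_simp
  have h3 : |quot κ u y * ((‖x‖ / ‖y‖) ^ κ - 1)| ≤ η / 2 := by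
    rw [abs_mul, abs_of_nonneg hqy0]
    have h4 : dist (‖x‖ / ‖y‖) 1 < δ := by
      rw [Real.dist_eq, div_sub_one hyp.ne', abs_div, abs_of_pos hyp, div_lt_iff₀ hyp]
      have h5 := abs_norm_sub_norm_le x y
      rw [norm_sub_rev] at h5
      nlinarith
    have h6 := hδt h4
    rw [Real.dist_eq, Real.one_rpow] at h6
    calc quot κ u y * |(‖x‖ / ‖y‖) ^ κ - 1| ≤ Q * (η / (2 * Q)) := by gcongr
      _ = _ := by field_simp
  rw [hdec]
  exact (abs_sub _ _).trans (by linarith)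

lemma quot_oscillation (hp : 1 < p) (hd : 2 ≤ finrank ℝ E)
    (hκ : κ * (p - 1) = finrank ℝ E - p)
    (hκ0 : 0 < κ) (hu : IsPHarmonic p (ball 0 R \ {0}) u) (hu0 : ∀ x ∈ ball 0 R \ {0}, 0 < u x)
    (hR : 0 < R) (hQ0 : 0 < Q) (hQ : ∀ x, 0 < ‖x‖ → ‖x‖ ≤ R / 4 → u x ≤ Q * profile κ ‖x‖) :
    ∀ ε > 0, ∃ δ > 0, ∀ x y : E, 0 < ‖x‖ → ‖x‖ < δ → ‖x‖ = ‖y‖ →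
      u x / profile κ ‖x‖ ≤ u y / profile κ ‖y‖ + ε := by
  intro ε hε
  have hnt : Nontrivial E := Module.nontrivial_of_finrank_pos (R := ℝ) (by omega)
  set d : ℝ := (finrank ℝ E : ℝ) with hdd
  set ω : ℝ := volume.real (ball (0 : E) 1) with hω
  have hω0 : 0 < ω := volume_real_ball_pos E
  set η := ε / 128 / 4 with hη
  have hη0 : 0 < η := by positivity
  obtain ⟨τ, hτ, hτ8, heq⟩ := quot_equicontinuous hp hd hκ0 hu hu0 hQ0 hQ hη0
  set A := τ ^ finrank ℝ E * ω with hA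
  have hA0 : 0 < A := by positivity
  obtain ⟨r₁, hr₁, hsm⟩ := gradient_quot_small hp hd hκ hκ0 hu hu0 hR hQ0 hQ
    (show 0 < 2 * η * A by positivity)
  refine ⟨min r₁ (R / 8), lt_min hr₁ (by positivity), fun x y hx hxr hxy => ?_⟩
  set r := ‖x‖ with hr
  have hr1 := hxr.trans_le (min_le_left _ _)
  have hr2 := hxr.trans_le (min_le_right _ _)
  have hgr := hsm r hx hr1
  set C : Set E := closedBall 0 (2 * r) \ ball 0 (r / 2) with hC
  have hCm : MeasurableSet C := measurableSet_closedBall.diff measurableSet_ball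
  have hCΩ : C ⊆ ball 0 R \ {0} := fun w hw => by
    simp only [hC, Set.mem_sdiff, mem_closedBall, mem_ball, dist_zero_right, not_lt] at hw
    have : 0 < ‖w‖ := by linarith
    exact ⟨by simp; linarith, by simpa using this⟩
  have hstep : ∀ z z' : E, ‖z‖ = r → ‖z'‖ = r → ‖z' - z‖ ≤ r / 32 →
      |quot κ u z' - quot κ u z| ≤ 4 * η := fun z z' hz hz' hzz => by
    have hS : ∀ w ∈ ball z (τ * r), ∀ t ∈ Icc (0 : ℝ) 1, w + t • (z' - z) ∈ C := by
      intro w hw t ht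
      rw [mem_ball_iff_norm] at hw
      have h1 : ‖w + t • (z' - z) - z‖ ≤ ‖w - z‖ + ‖t • (z' - z)‖ := by
        rw [add_sub_right_comm]
        exact norm_add_le _ _
      have h2 : ‖t • (z' - z)‖ ≤ r / 32 := by
        rw [norm_smul, Real.norm_of_nonneg ht.1]
        nlinarith [norm_nonneg (z' - z), ht.2]
      have h3 : τ * r ≤ 1 / 8 * r := by gcongr
      have h4 := abs_le.1 (abs_norm_sub_norm_le (w + t • (z' - z)) z)
      simp only [hC, Set.mem_sdiff, mem_closedBall, mem_ball, dist_zero_right, not_lt]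
      constructor <;> linarith
    have hint := lintegral_translate_sub_le isOpen_punctured (contDiffOn_quot hκ0 hu.1) hCm hCΩ
      (z' - z) hS
    set D := |quot κ u z' - quot κ u z| with hD
    have hlow : ENNReal.ofReal (D - 2 * η) * volume (ball z (τ * r)) ≤
        ∫⁻ w in ball z (τ * r), ‖quot κ u (w + (z' - z)) - quot κ u w‖ₑ := by
      rw [← setLIntegral_const]
      refine setLIntegral_mono' measurableSet_ball fun w hw => ?_
      rw [← ofReal_norm]
      refine ENNReal.ofReal_le_ofReal ?_
      rw [mem_ball_iff_norm] at hw
      have h1 := heq z w (by rw [hz]; exact hx) (by rw [hz]; exact hr2.le) (by rw [hz]; exact hw)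
      have h2 := heq z' (w + (z' - z)) (by rw [hz']; exact hx) (by rw [hz']; exact hr2.le) (by
        rw [hz', show w + (z' - z) - z' = w - z by abel]; exact hw)
      have h3 : D ≤ |quot κ u (w + (z' - z)) - quot κ u w| +
          |quot κ u (w + (z' - z)) - quot κ u z'| + |quot κ u w - quot κ u z| := by
        have e : quot κ u z' - quot κ u z = (quot κ u (w + (z' - z)) - quot κ u w) -
            (quot κ u (w + (z' - z)) - quot κ u z') + (quot κ u w - quot κ u z) := by ring
        rw [hD, e]
        refine (abs_add_le _ _).trans ?_
        gcongr
        exact abs_sub _ _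
      rw [Real.norm_eq_abs]
      linarith
    have hup : ENNReal.ofReal (D - 2 * η) * ENNReal.ofReal (A * r ^ d) ≤
        ENNReal.ofReal (r / 32) * ENNReal.ofReal (2 * η * A * r ^ (d - 1)) := by
      have hv : volume (ball z (τ * r)) = ENNReal.ofReal (A * r ^ d) := by
        rw [volume_ball_eq z (by positivity), hdd, Real.rpow_natCast, mul_pow, hA]
        congr 1
        ring
      rw [← hv]
      refine hlow.trans (hint.trans ?_)
      gcongr
      rw [← ofReal_norm]
      exact ENNReal.ofReal_le_ofReal hzz
    rw [← ENNReal.ofReal_mul' (by positivity), ← ENNReal.ofReal_mul (by positivity),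
      ENNReal.ofReal_le_ofReal_iff (by positivity)] at hup
    have hrd : r * r ^ (d - 1) = r ^ d := by
      rw [Real.rpow_sub_one hx.ne']; field_simp
    have hrd0 : 0 < A * r ^ d := by positivity
    have h5 : (D - 2 * η) * (A * r ^ d) ≤ 2 * η * (A * r ^ d) := by
      calc _ ≤ _ := hup
        _ = 1 / 32 * (2 * η * (A * (r * r ^ (d - 1)))) := by ring
        _ = 1 / 32 * (2 * η * (A * r ^ d)) := by rw [hrd]
        _ ≤ _ := by
          have : 0 < 2 * η * (A * r ^ d) := by positivity
          linarith
    linarith [le_of_mul_le_mul_right h5 hrd0]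
  obtain ⟨z, hz0, hz1, hzr, hzd⟩ := exists_sphere_chain hd hx rfl hxy.symm
  have hchain : ∀ n : ℕ, |quot κ u (z n) - quot κ u (z 0)| ≤ n * (4 * η) := fun n => by
    induction n with
    | zero => simp
    | succ n ih =>
      have h1 := hstep (z n) (z (n + 1)) (hzr n) (hzr (n + 1)) (hzd n)
      have h2 := abs_sub_le (quot κ u (z (n + 1))) (quot κ u (z n)) (quot κ u (z 0))
      push_cast
      linarith
  have h := hchain 128
  rw [hz0, hz1] at h
  have h6 := (abs_le.1 h).1
  push_cast at h6
  have e : 128 * (4 * η) = ε := by rw [hη]; ring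
  rw [e] at h6
  simp only [quot] at h6
  linarith

end Oscillation

section Limit

open Module (finrank)

variable {E : Type*} [NormedAddCommGroup E] [InnerProductSpace ℝ E] [FiniteDimensional ℝ E]
  [MeasurableSpace E] [BorelSpace E] {p κ R Q : ℝ} {u : E → ℝ}

lemma log_oscillation (hp : 1 < p) (hd : 2 ≤ finrank ℝ E) (hpd : (finrank ℝ E : ℝ) = p)
    (hu : IsPHarmonic p (ball 0 R \ {0}) u) (hu0 : ∀ x ∈ ball 0 R \ {0}, 0 < u x)
    (hR : 0 < R) (hR1 : R ≤ 1) (hQ0 : 0 < Q)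
    (hQ : ∀ x, 0 < ‖x‖ → ‖x‖ ≤ R / 4 → u x ≤ Q * profile 0 ‖x‖) :
    ∀ ε > 0, ∃ δ > 0, ∀ x y : E, 0 < ‖x‖ → ‖x‖ < δ → ‖x‖ = ‖y‖ →
      u x / profile 0 ‖x‖ ≤ u y / profile 0 ‖y‖ + ε := by
  intro ε hε
  have hprop := FiniteDimensional.proper ℝ E
  have hnt : Nontrivial E := Module.nontrivial_of_finrank_pos (R := ℝ) (by omega)
  have hκ : (0 : ℝ) * (p - 1) = finrank ℝ E - p := by rw [hpd]; ring
  obtain ⟨C, hC, hH⟩ := harnack_sphere E hp hd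
  set K := 2 * Q * Real.log 4 with hK
  have hl4 : 0 < Real.log 4 := Real.log_pos (by norm_num)
  have hK0 : 0 < K := by positivity
  have hev := (tendsto_profile (le_refl (0 : ℝ))).eventually_ge_atTop
    (max (2 * profile 0 (R / 4)) (C * K / ε))
  obtain ⟨r₁, hr₁, h⟩ := mem_nhdsGT_iff_exists_Ioo_subset.1 hev
  refine ⟨min r₁ (R / 16), lt_min hr₁ (by positivity), fun x y hx hxr hxy => ?_⟩
  set r := ‖x‖ with hr
  have hr2 := hxr.trans_le (min_le_right _ _)
  have hmax := h ⟨hx, hxr.trans_le (min_le_left _ _)⟩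
  rw [Set.mem_ofPred_eq] at hmax
  have hm1 := (le_max_left _ _).trans hmax
  have hm2 := (le_max_right _ _).trans hmax
  have hΩ : ∀ z : E, 0 < ‖z‖ → ‖z‖ < R → z ∈ ball 0 R \ {0} := fun z h1 h2 =>
    ⟨by simpa using h2, by simpa using h1⟩
  have hΦ0 : 0 < profile 0 (R / 4) := profile_pos le_rfl (by positivity) (by linarith)
  have hΦ : 0 < profile 0 r := by linarith
  obtain ⟨y₀, hy₀, hmin⟩ := (isCompact_sphere (0 : E) r).exists_isMinOn
    ⟨x, by simp [hr]⟩ (hu.1.continuousOn.mono fun z hz => by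
      rw [mem_sphere_zero_iff_norm] at hz
      exact hΩ z (by rw [hz]; exact hx) (by rw [hz]; linarith))
  rw [mem_sphere_zero_iff_norm] at hy₀
  have hLu : ∀ z : E, ‖z‖ = r → u y₀ ≤ u z := fun z hz => hmin (by simpa using hz)
  have hL0 : 0 < u y₀ := hu0 y₀ (hΩ y₀ (by rw [hy₀]; exact hx) (by rw [hy₀]; linarith))
  have hLQ : u y₀ ≤ Q * profile 0 r := by
    have := hQ y₀ (by rw [hy₀]; exact hx) (by rw [hy₀]; linarith)
    rwa [hy₀] at this
  have h4r : ∀ z : E, ‖z‖ = 4 * r → u y₀ - K ≤ u z := fun z hz => by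
    have h1 := profile_lower_bound hp hκ hu (fun z hz => (hu0 z hz).le) hx
      (show r < R / 4 by linarith) (by linarith) hL0 hLu (x := z) (by rw [hz]; linarith)
      (by rw [hz]; linarith)
    refine le_trans ?_ h1
    have e : profile 0 ‖z‖ = profile 0 r - Real.log 4 := by
      rw [hz, profile, profile, if_pos rfl, if_pos rfl, Real.log_mul (by norm_num) hx.ne']
      ring
    have hden : 0 < profile 0 r - profile 0 (R / 4) := by linarith
    rw [e, le_div_iff₀ hden]
    have h2 : u y₀ * Real.log 4 ≤ K * (profile 0 r - profile 0 (R / 4)) := by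
      calc u y₀ * Real.log 4 ≤ Q * profile 0 r * Real.log 4 := by gcongr
        _ = K * (profile 0 r / 2) := by rw [hK]; ring
        _ ≤ _ := by gcongr; linarith
    linarith
  have hge : ∀ z ∈ ball (0 : E) (4 * r) \ {0}, 0 ≤ u z - (u y₀ - K) := fun z hz =>
    sub_nonneg.2 (ge_of_ge_sphere hp hκ le_rfl hu (fun z hz => (hu0 z hz).le)
      (show 4 * r < R by linarith) h4r (norm_pos_of_mem hz) (mem_ball_zero_iff.1 hz.1).le)
  have hHx := hH ((hu.mono (sdiff_subset_sdiff_left (ball_subset_ball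
    (show 4 * r ≤ R by linarith)))).sub_const (u y₀ - K)) hge hx (hr.symm.trans hy₀.symm)
    (by linarith)
  have hb : u x ≤ u y + C * K := by
    have := hLu y hxy.symm
    linarith
  rw [← hxy]
  have h5 : C * K ≤ ε * profile 0 r := by
    rw [div_le_iff₀ hε] at hm2
    linarith
  rw [div_add' _ _ _ hΦ.ne']
  gcongr
  linarith

lemma exists_asymptotic (hp : 1 < p) (hd : 2 ≤ finrank ℝ E) (hκ : κ * (p - 1) = finrank ℝ E - p)
    (hκ0 : 0 ≤ κ) (hR : 0 < R) (hR1 : R ≤ 1) (hu : IsPHarmonic p (ball 0 R \ {0}) u)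
    (hu0 : ∀ x ∈ ball 0 R \ {0}, 0 < u x) :
    (∃ α > 0, Tendsto (fun x => u x / profile κ ‖x‖) (𝓝[≠] 0) (𝓝 α)) ∨
      ∃ l > 0, Tendsto u (𝓝[≠] 0) (𝓝 l) := by
  have hnt : Nontrivial E := Module.nontrivial_of_finrank_pos (R := ℝ) (by omega)
  obtain ⟨Q, hQ0, hQ⟩ := exists_le_mul_profile hp hd hκ hκ0 hR hR1 hu hu0
  have hosc : ∀ ε > 0, ∃ δ > 0, ∀ x y : E, 0 < ‖x‖ → ‖x‖ < δ → ‖x‖ = ‖y‖ →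
      u x / profile κ ‖x‖ ≤ u y / profile κ ‖y‖ + ε := by
    rcases hκ0.eq_or_lt with rfl | hκ0
    · exact log_oscillation hp hd (by linarith) hu hu0 hR hR1 hQ0 hQ
    · exact quot_oscillation hp hd hκ hκ0 hu hu0 hR hQ0 hQ
  obtain ⟨α, hα, hlim⟩ := exists_tendsto_div_profile hp hκ hκ0 hR hR1 hu hu0 hQ hosc
  rcases hα.lt_or_eq with hα | rfl
  · exact Or.inl ⟨α, hα, hlim⟩
  · refine Or.inr (exists_tendsto_of_small hp hd hκ hκ0 hR hu hu0 fun ε hε => ?_)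
    filter_upwards [hlim.eventually_le_const hε,
      (tendsto_profile_norm (E := E) hκ0).eventually_gt_atTop 0] with x h1 h2
    exact (div_le_iff₀ h2).1 h1

lemma exists_tendsto_div (hp : 1 < p) (hd : 2 ≤ finrank ℝ E) (hpd : p ≤ finrank ℝ E) {v : E → ℝ}
    (hR : 0 < R) (hu : IsPHarmonic p (ball 0 R \ {0}) u) (hu0 : ∀ x ∈ ball 0 R \ {0}, 0 < u x)
    (hv : IsPHarmonic p (ball 0 R \ {0}) v) (hv0 : ∀ x ∈ ball 0 R \ {0}, 0 < v x) :
    ∃ l : ℝ≥0∞, Tendsto (fun x => ENNReal.ofReal (u x / v x)) (𝓝[≠] 0) (𝓝 l) := by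
  have hp1 : 0 < p - 1 := by linarith
  obtain ⟨κ, hκ, hκ0⟩ : ∃ κ : ℝ, κ * (p - 1) = finrank ℝ E - p ∧ 0 ≤ κ :=
    ⟨(finrank ℝ E - p) / (p - 1), div_mul_cancel₀ _ hp1.ne', div_nonneg (by linarith) hp1.le⟩
  have hsub : ball (0 : E) (min R 1) \ {0} ⊆ ball 0 R \ {0} :=
    sdiff_subset_sdiff_left (ball_subset_ball (min_le_left _ _))
  have hasym : ∀ {w : E → ℝ}, IsPHarmonic p (ball 0 R \ {0}) w →
      (∀ x ∈ ball 0 R \ {0}, 0 < w x) → _ := fun hw hw0 =>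
    exists_asymptotic hp hd hκ hκ0 (lt_min hR one_pos) (min_le_right _ _) (hw.mono hsub)
      fun x hx => hw0 x (hsub hx)
  have hΦ := tendsto_profile_norm (E := E) hκ0
  have hΦ0 := hΦ.eventually_gt_atTop 0
  rcases hasym hu hu0 with ⟨α, hα, ha⟩ | ⟨l, hl, ha⟩ <;>
    rcases hasym hv hv0 with ⟨β, hβ, hb⟩ | ⟨m, hm, hb⟩
  · refine ⟨ENNReal.ofReal (α / β), ENNReal.tendsto_ofReal ((ha.div hb hβ.ne').congr' ?_)⟩
    filter_upwards [hΦ0] with x hx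
    exact div_div_div_cancel_right₀ hx.ne' _ _
  · refine ⟨⊤, ENNReal.tendsto_ofReal_atTop.comp
      (((ha.div hb hm.ne').pos_mul_atTop (div_pos hα hm) hΦ).congr' ?_)⟩
    filter_upwards [hΦ0] with x hx
    simp only [Pi.div_apply]
    field_simp
  · refine ⟨ENNReal.ofReal 0, ENNReal.tendsto_ofReal
      (((ha.div hb hβ.ne').div_atTop hΦ).congr' ?_)⟩
    filter_upwards [hΦ0] with x hx
    simp only [Pi.div_apply]
    field_simp
  · exact ⟨ENNReal.ofReal (l / m), ENNReal.tendsto_ofReal (ha.div hb hm.ne')⟩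

end Limit
end PLaplace

theorem stmt11 (d : ℕ) (hd : 2 ≤ d) (p : ℝ) (hp1 : 1 < p) (hpd : p ≤ d) (ρ : ℝ) (hρ : 0 < ρ)
    (u v : EuclideanSpace ℝ (Fin d) → ℝ)
    (hu : IsPosWeakSol p (fun _ => 0) (ball (0 : EuclideanSpace ℝ (Fin d)) ρ \ {0}) u)
    (hv : IsPosWeakSol p (fun _ => 0) (ball (0 : EuclideanSpace ℝ (Fin d)) ρ \ {0}) v) :
    ∃ l : ℝ≥0∞, Tendsto (fun x => ENNReal.ofReal (u x / v x))
      (𝓝[ball (0 : EuclideanSpace ℝ (Fin d)) ρ \ {0}] 0) (𝓝 l) := by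
  obtain ⟨l, hl⟩ := PLaplace.exists_tendsto_div hp1 (by rwa [finrank_euclideanSpace_fin])
    (by rwa [finrank_euclideanSpace_fin]) hρ (hu.isPHarmonic hp1 PLaplace.isOpen_punctured) hu.2.1
    (hv.isPHarmonic hp1 PLaplace.isOpen_punctured) hv.2.1
  exact ⟨l, hl.mono_left (nhdsWithin_mono _ fun _ hx => hx.2)⟩
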